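/- Let 1 < p < ∞. Then there exist a real Banach space 𝒴 and an algebra homomorphism Φ from ℒ(𝒴) onto the algebra 𝒱_p of real sequences of bounded p-variation (with pointwise addition and multiplication) such that: Φ(Id_𝒴) is the constant sequence with all terms equal to 1, the kernel of Φ is exactly the set 𝒦(𝒴) of compact operators on 𝒴, and there exist constants c, C > 0 such that for all T ∈ ℒ(𝒴), c·inf{‖T − K‖ : K ∈ 𝒦(𝒴)} ≤ ‖Φ(T)‖_{𝒱_p} ≤ C·inf{‖T − K‖ : K ∈ 𝒦(𝒴)}. In other words, the unitization ℝe_ω⊕J_p of the p-th James space (realized as the algebra of sequences of bounded p-variation with pointwise multiplication) is isomorphic as a Banach algebra to the Calkin algebra of some Banach space. -/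

import Mathlib

open scoped BigOperators

/-- A packaged real Banach space. -/
structure BanachSpacePkg where
  carrier : Type
  [grp : NormedAddCommGroup carrier]
  [mod : NormedSpace ℝ carrier]
  [cpl : CompleteSpace carrier]

attribute [instance] BanachSpacePkg.grp BanachSpacePkg.mod BanachSpacePkg.cpl

/-- The approximating quantities for the `p`-variation of a sequence `b : ℕ → ℝ`:
all numbers `(∑ |b (k (n+1)) - b (k n)|^p)^(1/p)` over finite strictly increasing
families of indices. -/
def pVarSet (p : ℝ) (b : ℕ → ℝ) : Set ℝ :=
  {v | ∃ (r : ℕ) (k : ℕ → ℕ), StrictMono k ∧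
    v = (∑ n ∈ Finset.range r, |b (k (n + 1)) - b (k n)| ^ p) ^ p⁻¹}

/-- The algebra `𝒱_p` of real sequences of bounded `p`-variation. -/
def boundedPVariation (p : ℝ) : Set (ℕ → ℝ) :=
  {b | BddAbove (pVarSet p b)}

/-- The norm of `𝒱_p`: `‖b‖ = sup_i |b_i| + V_p(b)`. -/
noncomputable def vpNorm (p : ℝ) (b : ℕ → ℝ) : ℝ :=
  sSup (Set.range fun i => |b i|) + sSup (pVarSet p b)

namespace JamesCalkin

open Filter Topology

/-- The lengths of the chains of the construction. -/
def nn : ℕ → ℕ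
  | 0 => 1
  | j + 1 => ((nn j + 1) ^ 2) ^ 2 * (5 * nn j) ^ (((nn j + 1) ^ 2) ^ 2 + 1)

/-- The inverse weights of the construction. -/
def mm : ℕ → ℕ
  | 0 => 1
  | j + 1 => (nn j + 1) ^ 2

theorem nn_succ (j : ℕ) : nn (j + 1) = mm (j + 1) ^ 2 * (5 * nn j) ^ (mm (j + 1) ^ 2 + 1) := rfl

theorem nn_pos (j : ℕ) : 0 < nn j := by
  induction j with
  | zero => simp [nn]
  | succ j ih => rw [nn_succ]; simp only [mm]; positivity

theorem mm_pos (j : ℕ) : 0 < mm j := by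
  cases j <;> simp [mm]

theorem mm_sq_le_nn_succ (j : ℕ) : mm (j + 1) ^ 2 ≤ nn (j + 1) := by
  rw [nn_succ]
  exact Nat.le_mul_of_pos_right _ (Nat.pow_pos (by have := nn_pos j; omega))

theorem nn_lt_succ (j : ℕ) : nn j < nn (j + 1) := by
  refine lt_of_lt_of_le ?_ (mm_sq_le_nn_succ j)
  simp only [mm]
  have h2 : nn j + 1 ≤ (nn j + 1) ^ 2 := Nat.le_self_pow (by norm_num) _
  have h3 : (nn j + 1) ^ 2 ≤ ((nn j + 1) ^ 2) ^ 2 := Nat.le_self_pow (by norm_num) _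
  omega

theorem nn_mono : Monotone nn := monotone_nat_of_le_succ fun j => (nn_lt_succ j).le

theorem mm_le_succ (j : ℕ) : mm j ≤ mm (j + 1) := by
  cases j with
  | zero => simp [mm, nn]
  | succ j =>
    simp only [mm]
    have := nn_lt_succ j
    gcongr

theorem mm_mono : Monotone mm := monotone_nat_of_le_succ mm_le_succ

theorem four_le_mm {j : ℕ} (h : 1 ≤ j) : 4 ≤ mm j :=
  le_trans (by simp [mm, nn]) (mm_mono h)

theorem lt_nn (j : ℕ) : j < nn j := by
  induction j with
  | zero => simp [nn]
  | succ j ih => have := nn_lt_succ j; omega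

theorem le_mm (j : ℕ) : j ≤ mm j := by
  cases j with
  | zero => simp
  | succ j => simp only [mm]; nlinarith [lt_nn j]

theorem nn_sq_le_mm_succ (j : ℕ) : nn j ^ 2 ≤ mm (j + 1) := by
  simp only [mm]; gcongr; omega

theorem mm_sq_le_mm {i j : ℕ} (h1 : 1 ≤ i) (h : i < j) : mm i ^ 2 ≤ mm j := by
  obtain ⟨i, rfl⟩ : ∃ k, i = k + 1 := ⟨i - 1, by omega⟩
  refine le_trans ?_ (mm_mono (show i + 1 + 1 ≤ j by omega))
  refine le_trans ?_ (nn_sq_le_mm_succ (i + 1))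
  refine (mm_sq_le_nn_succ i).trans (Nat.le_self_pow (by norm_num) _)

/-- The weights. -/
noncomputable def bt (j : ℕ) : ℝ := 1 / (mm j : ℝ)

theorem bt_pos (j : ℕ) : 0 < bt j := by
  have := mm_pos j
  unfold bt; positivity

theorem bt_anti : Antitone bt := fun i j h => by
  unfold bt
  have := mm_pos i
  exact one_div_le_one_div_of_le (by exact_mod_cast this) (by exact_mod_cast mm_mono h)

theorem bt_le {j : ℕ} (h : 1 ≤ j) : bt j ≤ 1 / 4 := by
  unfold bt
  exact one_div_le_one_div_of_le (by norm_num) (by exact_mod_cast four_le_mm h)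

theorem bt_le_one (j : ℕ) : bt j ≤ 1 := by
  unfold bt
  have : (1 : ℝ) ≤ mm j := by exact_mod_cast mm_pos j
  exact (div_le_one (by linarith)).2 this

theorem bt_le_inv_sq {i j : ℕ} (h1 : 1 ≤ i) (h : i < j) : bt j ≤ bt i ^ 2 := by
  unfold bt
  rw [div_pow, one_pow]
  have := mm_pos i
  exact one_div_le_one_div_of_le (by positivity) (by exact_mod_cast mm_sq_le_mm h1 h)

theorem bt_le_nn_inv_sq {i j : ℕ} (h : i < j) : bt j ≤ (1 / (nn i : ℝ)) ^ 2 := by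
  unfold bt
  rw [div_pow, one_pow]
  have := nn_pos i
  refine one_div_le_one_div_of_le (by positivity) ?_
  exact_mod_cast (nn_sq_le_mm_succ i).trans (mm_mono h)

/-- Data from which a new functional is built. -/
abbrev Item := ℕ × ℕ∞ × Option ℕ × ((ℕ →₀ ℚ) ⊕ ℕ)

noncomputable def itemEnum : ℕ → Item := (exists_surjective_nat Item).choose

noncomputable def code (n : ℕ) : Item := itemEnum (Nat.unpair (n / 2)).1

theorem exists_code (a : Item) (M : ℕ) : ∃ n, M ≤ n ∧ Odd n ∧ code n = a := by
  obtain ⟨i, hi⟩ := (exists_surjective_nat Item).choose_spec a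
  refine ⟨2 * Nat.pair i M + 1, ?_, ⟨_, rfl⟩, ?_⟩
  · have := Nat.right_le_pair i M; omega
  · have : (2 * Nat.pair i M + 1) / 2 = Nat.pair i M := by omega
    simp only [code, this, Nat.unpair_pair]
    exact hi

/-- The finitely supported vectors on which the norm is defined. -/
abbrev V := ℕ →₀ ℝ

/-- Evaluation of a functional with given coordinates. -/
noncomputable def ev (f : ℕ → ℝ) : V →ₗ[ℝ] ℝ := Finsupp.linearCombination ℝ f

theorem ev_def (f : ℕ → ℝ) (x : V) : ev f x = ∑ n ∈ x.support, x n * f n := by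
  simp [ev, Finsupp.linearCombination_apply, Finsupp.sum]

theorem ev_eq_sum (f : ℕ → ℝ) (x : V) {q : ℕ} (h : ∀ n, f n * x n ≠ 0 → n < q) :
    ev f x = ∑ n ∈ Finset.range q, x n * f n := by
  rw [ev_def, ← Finset.sum_filter_ne_zero, ← Finset.sum_filter_ne_zero (s := Finset.range q)]
  congr 1
  ext n
  simp only [Finset.mem_filter, Finsupp.mem_support_iff, Finset.mem_range, mul_comm (x n)]
  constructor
  · rintro ⟨_, h2⟩; exact ⟨h n h2, h2⟩
  · rintro ⟨_, h2⟩; exact ⟨right_ne_zero_of_mul h2, h2⟩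

@[simp] theorem ev_single (f : ℕ → ℝ) (n : ℕ) (a : ℝ) : ev f (Finsupp.single n a) = a * f n := by
  simp [ev]

theorem ev_add (f g : ℕ → ℝ) (x : V) : ev (f + g) x = ev f x + ev g x := by
  simp [ev_def, mul_add, Finset.sum_add_distrib]

theorem ev_smul (c : ℝ) (f : ℕ → ℝ) (x : V) : ev (c • f) x = c * ev f x := by
  simp [ev_def, Finset.mul_sum, mul_left_comm]

@[simp] theorem ev_zero (x : V) : ev 0 x = 0 := by
  simp [ev_def]

theorem ev_pi_single (n : ℕ) (x : V) : ev (Pi.single n 1) x = x n := by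
  rw [ev_def]
  by_cases h : x n = 0
  · rw [h]
    refine Finset.sum_eq_zero fun k _ => ?_
    by_cases hk : k = n <;> simp [hk, h]
  · rw [Finset.sum_eq_single n] <;> simp +contextual [h]

theorem ev_congr (f g : ℕ → ℝ) (x y : V) (h : ∀ n, x n * f n = y n * g n) : ev f x = ev g y := by
  have e1 : ∀ n ∈ x.support ∪ y.support, n ∉ x.support → x n * f n = 0 := by
    intro n _ hn; simp_all
  have e2 : ∀ n ∈ x.support ∪ y.support, n ∉ y.support → y n * g n = 0 := by
    intro n _ hn; simp_all
  rw [ev_def, ev_def, Finset.sum_subset Finset.subset_union_left e1,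
    Finset.sum_subset Finset.subset_union_right e2]
  exact Finset.sum_congr rfl fun n _ => h n

theorem ev_eq_zero {f : ℕ → ℝ} {x : V} (h : ∀ n, f n ≠ 0 → x n = 0) : ev f x = 0 := by
  rw [← ev_zero x]
  refine ev_congr _ _ _ _ fun n => ?_
  by_cases hf : f n = 0
  · simp [hf]
  · simp [h n hf]

/-- The coordinates of the `N`-th type-zero block. -/
noncomputable def blk (N : ℕ) (x : V) (k : ℕ) : ℝ :=
  if k ≤ 2 * N then x (2 * (N ^ 2 + k)) else 0

/-- All type-zero blocks of `x` have `p`-variation at most `t`. -/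
def WB (p t : ℝ) (x : V) : Prop := ∀ N, ∀ v ∈ pVarSet p (blk N x), v ≤ t

structure Node where
  e : ℕ → ℝ
  wt : ℕ
  col : ℕ∞
  age : ℕ

/-- Colours allowed for the next piece of a chain of colour `κ` after `prev`. -/
def okcol (κ : ℕ∞) : Option ℕ → ℕ∞ → Prop
  | none, c => κ = ⊤ ∨ c = κ
  | some ξ, c => c = κ ∨ (κ = ⊤ ∧ (ξ : ℕ∞) < c)

/-- Functionals bounded by the norm generated by `e 0, …, e (n-1)`. -/
def InB (p : ℝ) (e : ℕ → ℕ → ℝ) (n : ℕ) (b : ℕ → ℝ) : Prop :=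
  ∀ (x : V) (t : ℝ), (∀ η < n, |ev (e η) x| ≤ t) → WB p t x → |ev b x| ≤ t

/-- The coding function. -/
def sig (j : ℕ) : Option ℕ → ℕ
  | none => 4 * j + 2
  | some ξ => 4 * ξ + 4

/-- The functional encoded by the last component of an item. -/
def pieceOf (r : ℕ → Node) : (ℕ →₀ ℚ) ⊕ ℕ → ℕ → ℝ
  | .inl q => fun k => (q k : ℝ)
  | .inr η => (r η).e

structure Admissible (p : ℝ) (r : ℕ → Node) (n j : ℕ) (κ : ℕ∞) (prev : Option ℕ)
    (s : (ℕ →₀ ℚ) ⊕ ℕ) : Prop where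
  one_le : 1 ≤ j
  le : j ≤ n
  prev_spec : ∀ ξ, prev = some ξ → ξ < n ∧ (r ξ).wt = j ∧ (r ξ).col = κ ∧ (r ξ).age < nn j
  inl_spec : ∀ q, s = .inl q → Even j
  inr_spec : ∀ η, s = .inr η → Odd j ∧ η < n ∧ (r η).wt = sig j prev
  supp : ∀ k, pieceOf r s k ≠ 0 → k < n ∧ (∀ ξ, prev = some ξ → ξ < k) ∧ okcol κ prev (r k).col
  inB : InB p (fun k => (r k).e) n (pieceOf r s)

theorem Admissible.congr {p : ℝ} {r r' : ℕ → Node} {n j : ℕ} {κ : ℕ∞} {prev : Option ℕ}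
    {s : (ℕ →₀ ℚ) ⊕ ℕ} (h : ∀ m < n, r m = r' m) (H : Admissible p r n j κ prev s) :
    Admissible p r' n j κ prev s := by
  have hp : pieceOf r s = pieceOf r' s := by
    cases s with
    | inl q => rfl
    | inr η => simp only [pieceOf]; rw [h η (H.inr_spec η rfl).2.1]
  refine ⟨H.one_le, H.le, ?_, H.inl_spec, ?_, ?_, ?_⟩
  · intro ξ hξ
    have := H.prev_spec ξ hξ
    rwa [h ξ this.1] at this
  · intro η hη
    have := H.inr_spec η hη
    rwa [h η this.2.1] at this
  · intro k hk
    rw [← hp] at hk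
    have := H.supp k hk
    rwa [h k this.1] at this
  · rw [← hp]
    intro x t h1 h2
    refine H.inB x t (fun η hη => ?_) h2
    have := h1 η hη
    simp only at this ⊢
    rwa [h η hη]

noncomputable def prevE (r : ℕ → Node) : Option ℕ → ℕ → ℝ
  | none => 0
  | some ξ => (r ξ).e

def nextAge (r : ℕ → Node) : Option ℕ → ℕ
  | none => 1
  | some ξ => (r ξ).age + 1

open Classical in
noncomputable def step (p : ℝ) (n : ℕ) (r : ℕ → Node) : Node :=
  if Even n then ⟨Pi.single n 1, 0, ((n / 2 - Nat.sqrt (n / 2) ^ 2 : ℕ) : ℕ∞), 0⟩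
  else if Admissible p r n (code n).1 (code n).2.1 (code n).2.2.1 (code n).2.2.2 then
    ⟨Pi.single n 1 + prevE r (code n).2.2.1 + bt (code n).1 • pieceOf r (code n).2.2.2,
      (code n).1, (code n).2.1, nextAge r (code n).2.2.1⟩
  else ⟨Pi.single n 1, 0, ⊤, 0⟩

theorem step_congr (p : ℝ) (n : ℕ) (r r' : ℕ → Node) (h : ∀ m < n, r m = r' m) :
    step p n r = step p n r' := by
  unfold step
  split_ifs with h1 h2 h3 h3
  · rfl
  · have e1 : prevE r (code n).2.2.1 = prevE r' (code n).2.2.1 := by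
      cases hc : (code n).2.2.1 with
      | none => rfl
      | some ξ => simp only [prevE]; rw [h ξ (h2.prev_spec ξ hc).1]
    have e2 : nextAge r (code n).2.2.1 = nextAge r' (code n).2.2.1 := by
      cases hc : (code n).2.2.1 with
      | none => rfl
      | some ξ => simp only [nextAge]; rw [h ξ (h2.prev_spec ξ hc).1]
    have e3 : pieceOf r (code n).2.2.2 = pieceOf r' (code n).2.2.2 := by
      cases hc : (code n).2.2.2 with
      | inl q => rfl
      | inr η => simp only [pieceOf]; rw [h η (h2.inr_spec η hc).2.1]
    rw [e1, e2, e3]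
  · exact absurd (h2.congr h) h3
  · exact absurd (h3.congr fun m hm => (h m hm).symm) h2
  · rfl

noncomputable def node (p : ℝ) (n : ℕ) : Node :=
  step p n fun m => if _h : m < n then node p m else ⟨0, 0, 0, 0⟩
termination_by n
decreasing_by exact _h

theorem node_eq (p : ℝ) (n : ℕ) : node p n = step p n (node p) := by
  rw [node]
  exact step_congr _ _ _ _ fun m hm => by simp [hm]

section facts
variable (p : ℝ)

/-- The `n`-th norming functional. -/
noncomputable def en (n : ℕ) : ℕ → ℝ := (node p n).e
noncomputable def wt (n : ℕ) : ℕ := (node p n).wt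
noncomputable def col (n : ℕ) : ℕ∞ := (node p n).col
noncomputable def age (n : ℕ) : ℕ := (node p n).age

noncomputable def enp : Option ℕ → ℕ → ℝ
  | none => 0
  | some ξ => en p ξ

/-- The conditions satisfied by a functional of positive weight. -/
structure Built (n : ℕ) (prev : Option ℕ) (b : ℕ → ℝ) : Prop where
  eq : en p n = Pi.single n 1 + enp p prev + bt (wt p n) • b
  one_le : 1 ≤ wt p n
  le : wt p n ≤ n
  prev_spec : ∀ ξ, prev = some ξ → ξ < n ∧ wt p ξ = wt p n ∧ col p ξ = col p n ∧
    age p ξ < nn (wt p n) ∧ age p n = age p ξ + 1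
  age_none : prev = none → age p n = 1
  supp : ∀ k, b k ≠ 0 → k < n ∧ (∀ ξ, prev = some ξ → ξ < k) ∧ okcol (col p n) prev (col p k)
  inB : InB p (en p) n b
  odd : Odd (wt p n) → ∃ η < n, wt p η = sig (wt p n) prev ∧ b = en p η

theorem built_of_admissible {n j : ℕ} {κ : ℕ∞} {prev : Option ℕ} {s : (ℕ →₀ ℚ) ⊕ ℕ}
    (hn : Odd n) (hc : code n = (j, κ, prev, s)) (H : Admissible p (node p) n j κ prev s) :
    Built p n prev (pieceOf (node p) s) ∧ wt p n = j ∧ col p n = κ := by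
  have hs : node p n = ⟨Pi.single n 1 + prevE (node p) prev + bt j • pieceOf (node p) s, j, κ,
      nextAge (node p) prev⟩ := by
    rw [node_eq]
    unfold step
    rw [if_neg (by simpa using hn), hc]
    simp only
    rw [if_pos H]
  have hw : wt p n = j := by simp [wt, hs]
  have hcol : col p n = κ := by simp [col, hs]
  refine ⟨⟨?_, ?_, ?_, ?_, ?_, ?_, H.inB, ?_⟩, hw, hcol⟩
  · rw [hw]
    simp only [en, hs]
    cases prev <;> rfl
  · rw [hw]; exact H.one_le
  · rw [hw]; exact H.le
  · intro ξ hξ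
    obtain ⟨h1, h2, h3, h4⟩ := H.prev_spec ξ hξ
    rw [hw, hcol]
    refine ⟨h1, h2, h3, h4, ?_⟩
    simp [age, hs, hξ, nextAge]
  · intro h
    simp [age, hs, h, nextAge]
  · rw [hcol]; exact H.supp
  · intro ho
    rw [hw] at ho ⊢
    cases s with
    | inl q => exact absurd (H.inl_spec q rfl) (by simpa using ho)
    | inr η => exact ⟨η, (H.inr_spec η rfl).2.1, (H.inr_spec η rfl).2.2, rfl⟩

theorem built_or (n : ℕ) :
    (∃ prev b, Built p n prev b) ∨ (wt p n = 0 ∧ en p n = Pi.single n 1 ∧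
      (col p n = ⊤ ∨ (Even n ∧ col p n = ((n / 2 - Nat.sqrt (n / 2) ^ 2 : ℕ) : ℕ∞)))) := by
  by_cases h1 : Even n
  · have : node p n = ⟨Pi.single n 1, 0, ((n / 2 - Nat.sqrt (n / 2) ^ 2 : ℕ) : ℕ∞), 0⟩ := by
      rw [node_eq]; unfold step; rw [if_pos h1]
    right; simp [wt, en, col, this, h1]
  · by_cases h2 : Admissible p (node p) n (code n).1 (code n).2.1 (code n).2.2.1 (code n).2.2.2
    · exact Or.inl ⟨_, _, (built_of_admissible p (by simpa using h1) rfl h2).1⟩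
    · have : node p n = ⟨Pi.single n 1, 0, ⊤, 0⟩ := by
        rw [node_eq]; unfold step; rw [if_neg h1, if_neg h2]
      right; simp [wt, en, col, this]

theorem exists_built {n : ℕ} (h : 1 ≤ wt p n) : ∃ prev b, Built p n prev b := by
  rcases built_or p n with h' | h'
  · exact h'
  · omega

theorem en_of_wt_zero {n : ℕ} (h : wt p n = 0) : en p n = Pi.single n 1 := by
  rcases built_or p n with ⟨prev, b, hb⟩ | h'
  · have := hb.one_le; omega
  · exact h'.2.1

theorem wt_le (n : ℕ) : wt p n ≤ n := by
  rcases built_or p n with ⟨prev, b, hb⟩ | h'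
  · exact hb.le
  · omega

theorem en_supp : ∀ n k, en p n k ≠ 0 → k ≤ n := by
  intro n
  induction n using Nat.strong_induction_on with
  | _ n ih =>
    intro k hk
    by_contra hlt
    push Not at hlt
    apply hk
    rcases built_or p n with ⟨prev, b, hb⟩ | h'
    · have h1 : enp p prev k = 0 := by
        cases prev with
        | none => rfl
        | some ξ =>
          have h := (hb.prev_spec ξ rfl).1
          by_contra hne
          have := ih ξ h k hne
          omega
      have h2 : b k = 0 := by
        by_contra hne
        have := (hb.supp k hne).1
        omega
      rw [hb.eq]
      simp [h1, h2, hlt.ne']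
    · rw [h'.2.1]; simp [hlt.ne']

theorem en_self (n : ℕ) : en p n n = 1 := by
  rcases built_or p n with ⟨prev, b, hb⟩ | h'
  · have h1 : enp p prev n = 0 := by
      cases prev with
      | none => rfl
      | some ξ =>
        have h := (hb.prev_spec ξ rfl).1
        by_contra hne
        have := en_supp p ξ n hne
        omega
    have h2 : b n = 0 := by
      by_contra hne
      have := (hb.supp n hne).1
      omega
    rw [hb.eq]
    simp [h1, h2]
  · rw [h'.2.1]; simp

theorem en_col : ∀ n, col p n ≠ ⊤ → ∀ k, en p n k ≠ 0 → col p k = col p n := by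
  intro n
  induction n using Nat.strong_induction_on with
  | _ n ih =>
    intro hc k hk
    rcases built_or p n with ⟨prev, b, hb⟩ | h'
    · by_contra hne
      apply hk
      have h0 : k ≠ n := fun h => hne (by rw [h])
      have h1 : enp p prev k = 0 := by
        cases prev with
        | none => rfl
        | some ξ =>
          obtain ⟨h, _, h3, _⟩ := hb.prev_spec ξ rfl
          by_contra hne'
          have := ih ξ h (h3 ▸ hc) k hne'
          exact hne (this.trans h3)
      have h2 : b k = 0 := by
        by_contra hne'
        have := (hb.supp k hne').2.2
        cases prev with
        | none => exact (this.resolve_left hc) |> hne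
        | some ξ => exact (this.resolve_right fun h => hc h.1) |> hne
      rw [hb.eq]
      simp [h1, h2, h0]
    · rw [h'.2.1] at hk
      by_cases hkn : k = n
      · rw [hkn]
      · simp [hkn] at hk

theorem age_le (n : ℕ) (h : 1 ≤ wt p n) : age p n ≤ nn (wt p n) := by
  obtain ⟨prev, b, hb⟩ := exists_built p h
  cases prev with
  | none => rw [hb.age_none rfl]; exact nn_pos _
  | some ξ =>
    obtain ⟨_, _, _, h4, h5⟩ := hb.prev_spec ξ rfl
    omega

/-- Index of the type-zero functional of colour `k` in block `N`. -/
def nu (N k : ℕ) : ℕ := 2 * (N ^ 2 + k)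

theorem nu_spec {N k : ℕ} (h : k ≤ 2 * N) :
    wt p (nu N k) = 0 ∧ en p (nu N k) = Pi.single (nu N k) 1 ∧ col p (nu N k) = (k : ℕ∞) := by
  have he : Even (nu N k) := ⟨N ^ 2 + k, by unfold nu; ring⟩
  have hs : node p (nu N k) = ⟨Pi.single (nu N k) 1, 0, (k : ℕ∞), 0⟩ := by
    rw [node_eq]; unfold step; rw [if_pos he]
    have h1 : nu N k / 2 = N * N + k := by unfold nu; rw [pow_two]; omega
    rw [h1, Nat.sqrt_add_eq N (by omega)]
    have : N * N + k - N ^ 2 = k := by rw [pow_two]; omega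
    rw [this]
  simp [wt, en, col, hs]

theorem nu_ge (N k : ℕ) : N ≤ nu N k := by
  unfold nu; nlinarith [Nat.zero_le k]

theorem InB.mono {n n' : ℕ} (h : n ≤ n') {b : ℕ → ℝ} (H : InB p (en p) n b) :
    InB p (en p) n' b :=
  fun x t h1 h2 => H x t (fun η hη => h1 η (lt_of_lt_of_le hη h)) h2

theorem inB_en {n η : ℕ} (h : η < n) : InB p (en p) n (en p η) :=
  fun _ _ h1 _ => h1 η h

/-- Existence of a node built from a rational functional. -/
theorem exists_node_inl (j : ℕ) (κ : ℕ∞) (prev : Option ℕ) (q : ℕ →₀ ℚ) (L : ℕ)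
    (hj : 1 ≤ j) (hev : Even j)
    (hprev : ∀ ξ, prev = some ξ → wt p ξ = j ∧ col p ξ = κ ∧ age p ξ < nn j)
    (hsupp : ∀ k, q k ≠ 0 → (∀ ξ, prev = some ξ → ξ < k) ∧ okcol κ prev (col p k))
    (hB : ∃ n, InB p (en p) n fun k => (q k : ℝ)) :
    ∃ n, L ≤ n ∧ Built p n prev (fun k => (q k : ℝ)) ∧ wt p n = j ∧ col p n = κ := by
  obtain ⟨n0, hn0⟩ := hB
  obtain ⟨n, hn, ho, hc⟩ := exists_code (j, κ, prev, .inl q)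
    (L + n0 + j + (prev.getD 0 + 1) + (q.support.sup id + 1))
  refine ⟨n, by omega, built_of_admissible p ho hc ?_⟩
  refine ⟨hj, by omega, ?_, fun _ _ => hev, ?_, ?_, hn0.mono p (by omega)⟩
  · intro ξ hξ
    refine ⟨?_, hprev ξ hξ⟩
    rw [hξ] at hn
    simp only [Option.getD_some] at hn
    omega
  · intro η h; cases h
  · intro k hk
    have hk' : q k ≠ 0 := by
      intro h0; apply hk; simp [pieceOf, h0]
    refine ⟨?_, (hsupp k hk')⟩
    have : k ≤ q.support.sup id := Finset.le_sup (f := id) (by simpa using hk')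
    omega

/-- Existence of a node built from an earlier node. -/
theorem exists_node_inr (j : ℕ) (κ : ℕ∞) (prev : Option ℕ) (η : ℕ) (L : ℕ)
    (hj : 1 ≤ j) (hodd : Odd j)
    (hprev : ∀ ξ, prev = some ξ → wt p ξ = j ∧ col p ξ = κ ∧ age p ξ < nn j)
    (hη : wt p η = sig j prev)
    (hsupp : ∀ k, en p η k ≠ 0 → (∀ ξ, prev = some ξ → ξ < k) ∧ okcol κ prev (col p k)) :
    ∃ n, L ≤ n ∧ Built p n prev (en p η) ∧ wt p n = j ∧ col p n = κ := by
  obtain ⟨n, hn, ho, hc⟩ := exists_code (j, κ, prev, .inr η)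
    (L + j + (prev.getD 0 + 1) + (η + 1))
  refine ⟨n, by omega, built_of_admissible p ho hc ?_⟩
  refine ⟨hj, by omega, ?_, (fun _ h => by cases h), ?_, ?_, inB_en p (by omega)⟩
  · intro ξ hξ
    refine ⟨?_, hprev ξ hξ⟩
    rw [hξ] at hn
    simp only [Option.getD_some] at hn
    omega
  · intro η' h; cases h
    exact ⟨hodd, by omega, hη⟩
  · intro k hk
    refine ⟨?_, (hsupp k hk)⟩
    have := en_supp p η k hk
    omega

end facts

/-- The `p`-variation of `b` is at most `t`. -/
def PV (p : ℝ) (b : ℕ → ℝ) (t : ℝ) : Prop := ∀ v ∈ pVarSet p b, v ≤ t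

section pvar
variable {p : ℝ}

theorem PV_iff {b : ℕ → ℝ} {t : ℝ} : PV p b t ↔ ∀ (r : ℕ) (k : ℕ → ℕ), StrictMono k →
    (∑ n ∈ Finset.range r, |b (k (n + 1)) - b (k n)| ^ p) ^ p⁻¹ ≤ t :=
  ⟨fun h r k hk => h _ ⟨r, k, hk, rfl⟩, by rintro h v ⟨r, k, hk, rfl⟩; exact h r k hk⟩

theorem zero_mem_pVarSet (hp : 1 < p) (b : ℕ → ℝ) : (0 : ℝ) ∈ pVarSet p b :=
  ⟨0, id, strictMono_id, by simp [Real.zero_rpow (inv_ne_zero (by linarith : p ≠ 0))]⟩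

theorem PV.nonneg (hp : 1 < p) {b : ℕ → ℝ} {t : ℝ} (h : PV p b t) : 0 ≤ t :=
  h 0 (zero_mem_pVarSet hp b)

theorem PV.mono {b : ℕ → ℝ} {s t : ℝ} (h : PV p b s) (hst : s ≤ t) : PV p b t :=
  fun v hv => (h v hv).trans hst

theorem Lp_add_le' (hp : 1 < p) (s : Finset ℕ) (f g : ℕ → ℝ) :
    (∑ i ∈ s, |f i + g i| ^ p) ^ p⁻¹ ≤ (∑ i ∈ s, |f i| ^ p) ^ p⁻¹ + (∑ i ∈ s, |g i| ^ p) ^ p⁻¹ := by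
  simpa [one_div] using Real.Lp_add_le s f g hp.le

theorem Lp_le_of_le (hp : 1 < p) (s : Finset ℕ) {f g : ℕ → ℝ} (h : ∀ i ∈ s, |f i| ≤ |g i|) :
    (∑ i ∈ s, |f i| ^ p) ^ p⁻¹ ≤ (∑ i ∈ s, |g i| ^ p) ^ p⁻¹ := by
  have hp0 : 0 ≤ p := by linarith
  refine Real.rpow_le_rpow (Finset.sum_nonneg fun i _ => by positivity) ?_ (by positivity)
  exact Finset.sum_le_sum fun i hi => Real.rpow_le_rpow (abs_nonneg _) (h i hi) hp0

theorem Lp_smul (hp : 1 < p) (s : Finset ℕ) (c : ℝ) (f : ℕ → ℝ) :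
    (∑ i ∈ s, |c * f i| ^ p) ^ p⁻¹ = |c| * (∑ i ∈ s, |f i| ^ p) ^ p⁻¹ := by
  have hp0 : p ≠ 0 := by linarith
  have : ∀ i ∈ s, |c * f i| ^ p = |c| ^ p * |f i| ^ p := fun i _ => by
    rw [abs_mul, Real.mul_rpow (abs_nonneg _) (abs_nonneg _)]
  rw [Finset.sum_congr rfl this, ← Finset.mul_sum, Real.mul_rpow (by positivity)
    (Finset.sum_nonneg fun i _ => by positivity), Real.rpow_rpow_inv (abs_nonneg _) hp0]

theorem Lp_at_most_one (hp : 1 < p) (s : Finset ℕ) (f : ℕ → ℝ) {a : ℝ} (ha : 0 ≤ a)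
    (h : ∀ i, |f i| ≤ a) (h1 : ∀ i j, f i ≠ 0 → f j ≠ 0 → i = j) :
    (∑ i ∈ s, |f i| ^ p) ^ p⁻¹ ≤ a := by
  have hp0 : 0 < p := by linarith
  by_cases hz : ∀ i ∈ s, f i = 0
  · rw [Finset.sum_eq_zero fun i hi => by rw [hz i hi, abs_zero, Real.zero_rpow hp0.ne']]
    rw [Real.zero_rpow (by positivity)]
    exact ha
  · push Not at hz
    obtain ⟨i, hi, hi0⟩ := hz
    rw [Finset.sum_eq_single i]
    · rw [Real.rpow_rpow_inv (abs_nonneg _) hp0.ne']; exact h i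
    · intro j _ hj
      have : f j = 0 := by
        by_contra hne; exact hj (h1 j i hne hi0)
      rw [this, abs_zero, Real.zero_rpow hp0.ne']
    · exact fun h => absurd hi h

theorem PV.add (hp : 1 < p) {b c : ℕ → ℝ} {s t : ℝ} (hb : PV p b s) (hc : PV p c t) :
    PV p (b + c) (s + t) := by
  rw [PV_iff] at *
  intro r k hk
  refine le_trans ?_ (add_le_add (hb r k hk) (hc r k hk))
  refine le_trans (le_of_eq ?_) (Lp_add_le' hp _ _ _)
  congr 1
  refine Finset.sum_congr rfl fun i _ => ?_
  congr 2
  simp only [Pi.add_apply]; ring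

theorem PV.smul (hp : 1 < p) (a : ℝ) {b : ℕ → ℝ} {s : ℝ} (hb : PV p b s) :
    PV p (a • b) (|a| * s) := by
  rw [PV_iff] at *
  intro r k hk
  refine le_trans (le_of_eq ?_) (mul_le_mul_of_nonneg_left (hb r k hk) (abs_nonneg a))
  rw [← Lp_smul hp]
  congr 1
  refine Finset.sum_congr rfl fun i _ => ?_
  congr 2
  simp only [Pi.smul_apply, smul_eq_mul]; ring

theorem PV.mul (hp : 1 < p) {b c : ℕ → ℝ} {s t B C : ℝ} (hb : PV p b s) (hc : PV p c t)
    (hB : ∀ n, |b n| ≤ B) (hC : ∀ n, |c n| ≤ C) :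
    PV p (fun n => b n * c n) (B * t + C * s) := by
  have hB0 : 0 ≤ B := (abs_nonneg _).trans (hB 0)
  have hC0 : 0 ≤ C := (abs_nonneg _).trans (hC 0)
  rw [PV_iff] at *
  intro r k hk
  have h1 := mul_le_mul_of_nonneg_left (hc r k hk) (abs_nonneg B)
  have h2 := mul_le_mul_of_nonneg_left (hb r k hk) (abs_nonneg C)
  rw [← Lp_smul hp] at h1 h2
  rw [abs_of_nonneg hB0] at h1
  rw [abs_of_nonneg hC0] at h2
  refine le_trans ?_ (add_le_add h1 h2)
  refine le_trans (le_of_eq ?_) ((Lp_add_le' hp _ (fun i => b (k (i+1)) * (c (k (i+1)) - c (k i)))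
    (fun i => c (k i) * (b (k (i+1)) - b (k i)))).trans (add_le_add (Lp_le_of_le hp _ ?_)
      (Lp_le_of_le hp _ ?_)))
  · congr 1
    refine Finset.sum_congr rfl fun i _ => ?_
    congr 2
    ring
  · intro i _
    rw [abs_mul, abs_mul, abs_of_nonneg hB0]
    exact mul_le_mul_of_nonneg_right (hB _) (abs_nonneg _)
  · intro i _
    rw [abs_mul, abs_mul, abs_of_nonneg hC0]
    exact mul_le_mul_of_nonneg_right (hC _) (abs_nonneg _)

theorem PV.trunc {b : ℕ → ℝ} {t : ℝ} (hb : PV p b t) {L : ℕ} (hL : ∀ n, L ≤ n → b n = 0) (c : ℕ) :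
    PV p (fun n => if n < c then b n else 0) t := by
  rw [PV_iff] at *
  intro r k hk
  let k' : ℕ → ℕ := fun n => if k n < c then k n else k n + L
  have hk' : StrictMono k' := by
    intro m n hmn
    have := hk hmn
    simp only [k']
    split_ifs <;> omega
  have e : ∀ n, (if k n < c then b (k n) else 0) = b (k' n) := by
    intro n
    simp only [k']
    split_ifs with h
    · rfl
    · rw [hL]; omega
  simp only [e]
  exact hb r k' hk'

theorem PV_spike (hp : 1 < p) (m : ℕ) (a : ℝ) :
    PV p (fun n => if n = m then a else 0) (2 * |a|) := by
  rw [PV_iff]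
  intro r k hk
  refine le_trans (le_of_eq ?_) ((Lp_add_le' hp (Finset.range r)
    (fun i => if k (i+1) = m then a else 0) (fun i => - if k i = m then a else 0)).trans (le_of_le_of_eq (add_le_add
      (Lp_at_most_one hp _ _ (abs_nonneg a) ?_ ?_) (Lp_at_most_one hp _ _ (abs_nonneg a) ?_ ?_))
      (two_mul |a|).symm))
  · simp only [sub_eq_add_neg]
  · intro i; split_ifs <;> simp
  · intro i j hi hj
    have h1 : k (i+1) = m := by by_contra h; simp [h] at hi
    have h2 : k (j+1) = m := by by_contra h; simp [h] at hj
    have := hk.injective (h1.trans h2.symm)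
    omega
  · intro i; split_ifs <;> simp
  · intro i j hi hj
    have h1 : k i = m := by by_contra h; simp [h] at hi
    have h2 : k j = m := by by_contra h; simp [h] at hj
    exact hk.injective (h1.trans h2.symm)

theorem PV_step (hp : 1 < p) (K : ℕ) : PV p (fun n => if n ≤ K then (1 : ℝ) else 0) 1 := by
  rw [PV_iff]
  intro r k hk
  refine Lp_at_most_one hp _ _ zero_le_one ?_ ?_
  · intro i; split_ifs <;> simp
  · intro i j hi hj
    have key : ∀ i, ((if k (i+1) ≤ K then (1:ℝ) else 0) - if k i ≤ K then 1 else 0) ≠ 0 →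
        k i ≤ K ∧ K < k (i+1) := by
      intro i hi
      have : k i < k (i+1) := hk (Nat.lt_succ_self i)
      constructor
      · by_contra h
        apply hi
        rw [if_neg h, if_neg (by omega), sub_zero]
      · by_contra h
        apply hi
        rw [if_pos (by omega), if_pos (by omega), sub_self]
    have h1 := key i hi
    have h2 := key j hj
    rcases lt_trichotomy i j with h | h | h
    · have := hk.monotone (show i + 1 ≤ j by omega); omega
    · exact h
    · have := hk.monotone (show j + 1 ≤ i by omega); omega

theorem PV_zero (hp : 1 < p) : PV p (fun _ => 0) 0 := by
  have := PV_spike hp 0 0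
  simpa using this

end pvar

/-- Diagonal operators. -/
noncomputable def dg (c : ℕ → ℝ) : V →ₗ[ℝ] V where
  toFun x := Finsupp.onFinset x.support (fun n => c n * x n) fun n h => by
    rw [Finsupp.mem_support_iff]; exact right_ne_zero_of_mul h
  map_add' x y := by ext n; simp [mul_add]
  map_smul' a x := by ext n; simp [mul_left_comm]

@[simp] theorem dg_apply (c : ℕ → ℝ) (x : V) (n : ℕ) : dg c x n = c n * x n := rfl

/-- Truncation to `[0, q)`. -/
noncomputable def tr (q : ℕ) : V →ₗ[ℝ] V := dg fun n => if n < q then 1 else 0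

theorem tr_apply (q : ℕ) (x : V) (n : ℕ) : tr q x n = if n < q then x n else 0 := by
  simp [tr]

section norm
variable {p : ℝ}

theorem blk_zero_of_lt {N : ℕ} {x : V} {k : ℕ} (h : 2 * N < k) : blk N x k = 0 := by
  simp [blk, h]

theorem blk_add (N : ℕ) (x y : V) : blk N (x + y) = blk N x + blk N y := by
  ext k; simp only [blk, Pi.add_apply]; split_ifs <;> simp

theorem blk_smul (N : ℕ) (a : ℝ) (x : V) : blk N (a • x) = a • blk N x := by
  ext k; simp only [blk, Pi.smul_apply]; split_ifs <;> simp

theorem WB.nonneg (hp : 1 < p) {t : ℝ} {x : V} (h : WB p t x) : 0 ≤ t := PV.nonneg hp (h 0)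

theorem WB.mono {s t : ℝ} {x : V} (h : WB p s x) (hst : s ≤ t) : WB p t x :=
  fun N => PV.mono (h N) hst

theorem WB.add (hp : 1 < p) {s t : ℝ} {x y : V} (hx : WB p s x) (hy : WB p t y) :
    WB p (s + t) (x + y) := fun N => by
  rw [blk_add]; exact PV.add hp (hx N) (hy N)

theorem WB.smul (hp : 1 < p) (a : ℝ) {t : ℝ} {x : V} (hx : WB p t x) :
    WB p (|a| * t) (a • x) := fun N => by
  rw [blk_smul]; exact PV.smul hp a (hx N)

theorem WB.tr {t : ℝ} {x : V} (hx : WB p t x) (q : ℕ) : WB p t (tr q x) := fun N => by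
  have := PV.trunc (hx N) (L := 2 * N + 1) (fun n hn => blk_zero_of_lt (by omega)) ((q + 1) / 2 - N ^ 2)
  refine cast ?_ this
  congr 1
  ext k
  simp only [blk, tr_apply]
  have : k < (q + 1) / 2 - N ^ 2 ↔ 2 * (N ^ 2 + k) < q := by omega
  simp only [this]
  split_ifs <;> rfl

theorem nu_injOn {N N' k k' : ℕ} (h : k ≤ 2 * N) (h' : k' ≤ 2 * N') (e : nu N k = nu N' k') :
    N = N' ∧ k = k' := by
  have e' : N * N + k = N' * N' + k' := by simp only [nu, pow_two] at e; omega
  have h1 := Nat.sqrt_add_eq N (show k ≤ N + N by omega)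
  have h2 := Nat.sqrt_add_eq N' (show k' ≤ N' + N' by omega)
  rw [e', h2] at h1
  subst h1
  exact ⟨rfl, by omega⟩

theorem WB_single (hp : 1 < p) (n : ℕ) (a : ℝ) : WB p (2 * |a|) (Finsupp.single n a) := fun N => by
  by_cases h : ∃ k ≤ 2 * N, n = 2 * (N ^ 2 + k)
  · obtain ⟨k, hk, rfl⟩ := h
    refine cast ?_ (PV_spike hp k a)
    congr 1
    ext m
    simp only [blk, Finsupp.single_apply]
    by_cases hm : m = k
    · subst hm; simp [hk]
    · rw [if_neg hm, if_neg (by omega : ¬ 2 * (N ^ 2 + k) = 2 * (N ^ 2 + m))]; simp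
  · have : blk N (Finsupp.single n a) = fun _ => 0 := by
      ext m
      simp only [blk, Finsupp.single_apply]
      split_ifs with h1 h2
      · exact absurd ⟨m, h1, h2⟩ h
      · rfl
      · rfl
    show PV p _ _
    rw [this]
    exact (PV_zero hp).mono (by positivity)

theorem exists_WB (hp : 1 < p) (x : V) : ∃ t, WB p t x := by
  induction x using Finsupp.induction_linear with
  | zero => exact ⟨_, by simpa using WB_single hp 0 0⟩
  | add f g hf hg =>
    obtain ⟨s, hs⟩ := hf
    obtain ⟨t, ht⟩ := hg
    exact ⟨_, hs.add hp ht⟩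
  | single n a => exact ⟨_, WB_single hp n a⟩

/-- The norm of `x` is at most `t`. -/
def Bd (p t : ℝ) (x : V) : Prop := (∀ n, |ev (en p n) x| ≤ t) ∧ WB p t x

theorem Bd.mono {s t : ℝ} {x : V} (h : Bd p s x) (hst : s ≤ t) : Bd p t x :=
  ⟨fun n => (h.1 n).trans hst, h.2.mono hst⟩

theorem Bd.add (hp : 1 < p) {s t : ℝ} {x y : V} (hx : Bd p s x) (hy : Bd p t y) :
    Bd p (s + t) (x + y) :=
  ⟨fun n => by rw [map_add]; exact (abs_add_le _ _).trans (add_le_add (hx.1 n) (hy.1 n)),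
    hx.2.add hp hy.2⟩

theorem Bd.smul (hp : 1 < p) (a : ℝ) {t : ℝ} {x : V} (hx : Bd p t x) : Bd p (|a| * t) (a • x) :=
  ⟨fun n => by
    rw [map_smul, smul_eq_mul, abs_mul]
    exact mul_le_mul_of_nonneg_left (hx.1 n) (abs_nonneg _), hx.2.smul hp a⟩

theorem InB.le {n : ℕ} {b : ℕ → ℝ} (h : InB p (en p) n b) {x : V} {t : ℝ} (hx : Bd p t x) :
    |ev b x| ≤ t := h x t (fun η _ => hx.1 η) hx.2

theorem ev_tr_of_lt {f : ℕ → ℝ} {q : ℕ} (h : ∀ k, f k ≠ 0 → k < q) (x : V) :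
    ev f (tr q x) = ev f x := by
  refine ev_congr _ _ _ _ fun n => ?_
  rw [tr_apply]
  by_cases hn : f n = 0
  · simp [hn]
  · simp [h n hn]

theorem Built.ev_eq {n : ℕ} {prev : Option ℕ} {b : ℕ → ℝ} (h : Built p n prev b) (x : V) :
    ev (en p n) x = x n + ev (enp p prev) x + bt (wt p n) * ev b x := by
  rw [h.eq, ev_add, ev_add, ev_smul, ev_pi_single]

theorem Bd_tr (hp : 1 < p) {q : ℕ} {t : ℝ} {x : V} (h : ∀ η < q, |ev (en p η) x| ≤ t)
    (hw : WB p t x) : Bd p (2 * t) (tr q x) := by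
  have ht := hw.nonneg hp
  have hw2 : WB p (2 * t) (tr q x) := (hw.tr q).mono (by linarith)
  refine ⟨fun γ => ?_, hw2⟩
  induction γ using Nat.strong_induction_on with
  | _ γ ih =>
    have small : ∀ γ < q, |ev (en p γ) (tr q x)| ≤ t := by
      intro γ hγ
      rw [ev_tr_of_lt (fun k hk => lt_of_le_of_lt (en_supp p γ k hk) hγ)]
      exact h γ hγ
    by_cases hγ : γ < q
    · exact (small γ hγ).trans (by linarith)
    · have hz : tr q x γ = 0 := by rw [tr_apply, if_neg hγ]
      rcases built_or p γ with ⟨prev, b, hb⟩ | h'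
      · have hbx : |ev b (tr q x)| ≤ 2 * t := hb.inB _ _ ih hw2
        have hβ : |bt (wt p γ) * ev b (tr q x)| ≤ t := by
          rw [abs_mul, abs_of_pos (bt_pos _)]
          have := bt_le hb.one_le
          have := bt_pos (wt p γ)
          nlinarith [abs_nonneg (ev b (tr q x))]
        rw [hb.ev_eq, hz, zero_add]
        cases prev with
        | none =>
          simp only [enp, ev_zero, zero_add]
          linarith
        | some ξ =>
          have hs := hb.prev_spec ξ rfl
          simp only [enp]
          by_cases hξ : ξ < q
          · have := small ξ hξ
            exact (abs_add_le _ _).trans (by linarith)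
          · have : ev b (tr q x) = 0 := by
              refine ev_eq_zero fun k hk => ?_
              have := (hb.supp k hk).2.1 ξ rfl
              rw [tr_apply, if_neg (by omega)]
            rw [this, mul_zero, add_zero]
            exact ih ξ hs.1
      · rw [h'.2.1, ev_pi_single, hz, abs_zero]; linarith

theorem tr_eq_self {q : ℕ} {x : V} (h : ∀ n, q ≤ n → x n = 0) : tr q x = x := by
  ext n
  rw [tr_apply]
  split_ifs with hn
  · rfl
  · rw [h n (by omega)]

theorem exists_supp (x : V) : ∃ q, ∀ n, q ≤ n → x n = 0 := by
  refine ⟨x.support.sup id + 1, fun n hn => ?_⟩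
  by_contra h
  have : n ≤ x.support.sup id := Finset.le_sup (f := id) (by simpa using h)
  omega

theorem exists_Bd (hp : 1 < p) (x : V) : ∃ t, Bd p t x := by
  obtain ⟨q, hq⟩ := exists_supp x
  obtain ⟨t, ht⟩ := exists_WB hp x
  have ht0 := ht.nonneg hp
  set s := ∑ η ∈ Finset.range q, |ev (en p η) x| with hs
  have hs0 : 0 ≤ s := Finset.sum_nonneg fun _ _ => abs_nonneg _
  refine ⟨2 * (s + t), ?_⟩
  rw [← tr_eq_self hq]
  refine Bd_tr hp (fun η hη => ?_) (ht.mono (by linarith))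
  have : |ev (en p η) x| ≤ s := Finset.single_le_sum (f := fun η => |ev (en p η) x|)
    (fun _ _ => abs_nonneg _) (Finset.mem_range.2 hη)
  linarith

/-- The norm. -/
noncomputable def nrm (p : ℝ) (x : V) : ℝ := sInf {t | Bd p t x}

theorem nrm_le_iff (hp : 1 < p) {x : V} {t : ℝ} : nrm p x ≤ t ↔ Bd p t x := by
  have hb : BddBelow {t | Bd p t x} := ⟨0, fun t ht => ht.2.nonneg hp⟩
  constructor
  · intro h
    have key : ∀ s, t < s → Bd p s x := fun s hs => by
      obtain ⟨u, hu, hus⟩ := exists_lt_of_csInf_lt (exists_Bd hp x) (lt_of_le_of_lt h hs)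
      exact Bd.mono hu hus.le
    exact ⟨fun n => le_of_forall_gt_imp_ge_of_dense fun s hs => (key s hs).1 n,
      fun N v hv => le_of_forall_gt_imp_ge_of_dense fun s hs => (key s hs).2 N v hv⟩
  · intro h
    exact csInf_le hb h

theorem Bd_nrm (hp : 1 < p) (x : V) : Bd p (nrm p x) x := (nrm_le_iff hp).1 le_rfl

theorem nrm_nonneg (hp : 1 < p) (x : V) : 0 ≤ nrm p x := (Bd_nrm hp x).2.nonneg hp

theorem nrm_add_le (hp : 1 < p) (x y : V) : nrm p (x + y) ≤ nrm p x + nrm p y :=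
  (nrm_le_iff hp).2 ((Bd_nrm hp x).add hp (Bd_nrm hp y))

theorem nrm_smul_le (hp : 1 < p) (a : ℝ) (x : V) : nrm p (a • x) ≤ |a| * nrm p x :=
  (nrm_le_iff hp).2 ((Bd_nrm hp x).smul hp a)

theorem nrm_smul (hp : 1 < p) (a : ℝ) (x : V) : nrm p (a • x) = |a| * nrm p x := by
  refine le_antisymm (nrm_smul_le hp a x) ?_
  by_cases ha : a = 0
  · simpa [ha] using nrm_nonneg hp _
  · have := nrm_smul_le hp a⁻¹ (a • x)
    rw [smul_smul, inv_mul_cancel₀ ha, one_smul, abs_inv] at this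
    rwa [← le_inv_mul_iff₀ (abs_pos.2 ha)]

theorem coord_le (hp : 1 < p) {t : ℝ} {x : V} {n : ℕ} (h : ∀ η ≤ n, |ev (en p η) x| ≤ t)
    (hw : WB p t x) : |x n| ≤ 3 * t := by
  have h1 := (Bd_tr hp (q := n) (fun η hη => h η hη.le) hw).1 n
  have h2 : ev (en p n) x = ev (en p n) (tr n x) + x n := by
    have e : ev (en p n) (tr (n + 1) x) = ev (en p n) x :=
      ev_tr_of_lt (fun k hk => Nat.lt_succ_of_le (en_supp p n k hk)) x
    have e2 : tr (n + 1) x = tr n x + Finsupp.single n (x n) := by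
      ext m
      simp only [tr_apply, Finsupp.add_apply, Finsupp.single_apply]
      rcases lt_trichotomy m n with h | h | h
      · rw [if_pos (by omega), if_pos h, if_neg (by omega), add_zero]
      · subst h; simp
      · rw [if_neg (by omega), if_neg (by omega), if_neg (by omega), add_zero]
    rw [← e, e2, map_add, ev_single, en_self, mul_one]
  have h3 := h n le_rfl
  have : x n = ev (en p n) x - ev (en p n) (tr n x) := by linarith
  rw [this]
  exact (abs_sub _ _).trans (by linarith)

theorem abs_apply_le (hp : 1 < p) (x : V) (n : ℕ) : |x n| ≤ 3 * nrm p x :=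
  coord_le hp (fun η _ => (Bd_nrm hp x).1 η) (Bd_nrm hp x).2

theorem nrm_tr_le (hp : 1 < p) (q : ℕ) (x : V) : nrm p (tr q x) ≤ 2 * nrm p x :=
  (nrm_le_iff hp).2 (Bd_tr hp (fun η _ => (Bd_nrm hp x).1 η) (Bd_nrm hp x).2)

theorem abs_ev_en_le (hp : 1 < p) (x : V) (n : ℕ) : |ev (en p n) x| ≤ nrm p x := (Bd_nrm hp x).1 n

end norm

/-- The space of finitely supported vectors with its norm. -/
def VN (_ : ℝ) : Type := V

noncomputable instance (p : ℝ) : AddCommGroup (VN p) := inferInstanceAs (AddCommGroup V)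
noncomputable instance (p : ℝ) : Module ℝ (VN p) := inferInstanceAs (Module ℝ V)
noncomputable instance (p : ℝ) : Norm (VN p) := ⟨fun x => nrm p x⟩

theorem normCore (p : ℝ) [hp : Fact (1 < p)] : NormedSpace.Core ℝ (VN p) where
  norm_nonneg x := nrm_nonneg hp.out x
  norm_smul a x := nrm_smul hp.out a x
  norm_triangle x y := nrm_add_le hp.out x y
  norm_eq_zero_iff x := by
    constructor
    · intro h
      have h' : nrm p x = 0 := h
      refine Finsupp.ext fun n => ?_
      have := abs_apply_le hp.out x n
      rw [h', mul_zero] at this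
      exact abs_nonpos_iff.1 this
    · rintro rfl
      have := nrm_smul hp.out (0 : ℝ) (0 : V)
      rw [zero_smul, abs_zero, zero_mul] at this
      exact this

noncomputable instance (p : ℝ) [Fact (1 < p)] : NormedAddCommGroup (VN p) :=
  NormedAddCommGroup.ofCore (normCore p)

noncomputable instance (p : ℝ) [Fact (1 < p)] : NormedSpace ℝ (VN p) :=
  NormedSpace.ofCore (normCore p)

/-- The Banach space. -/
abbrev Y (p : ℝ) [Fact (1 < p)] : Type := UniformSpace.Completion (VN p)

section Y
variable {p : ℝ} [hp : Fact (1 < p)]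

variable (p) in
/-- The inclusion of the finitely supported vectors. -/
noncomputable def emb : V →ₗ[ℝ] Y p where
  toFun x := UniformSpace.Completion.coe' (α := VN p) x
  map_add' x y := UniformSpace.Completion.coe_add (α := VN p) x y
  map_smul' a x := UniformSpace.Completion.coe_smul (X := VN p) a x

theorem norm_emb (x : V) : ‖emb p x‖ = nrm p x :=
  UniformSpace.Completion.norm_coe (E := VN p) x

theorem dense_emb : DenseRange (emb p) :=
  UniformSpace.Completion.denseRange_coe (α := VN p)

theorem exists_approx (y : Y p) {ε : ℝ} (hε : 0 < ε) : ∃ x : V, ‖y - emb p x‖ < ε := by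
  obtain ⟨x, hx⟩ := dense_emb.exists_dist_lt y hε
  exact ⟨x, by rwa [← dist_eq_norm]⟩

/-- Extension of a bounded linear map on finitely supported vectors. -/
noncomputable def extOp {F : Type} [NormedAddCommGroup F] [NormedSpace ℝ F] [CompleteSpace F]
    (f : V →ₗ[ℝ] F) : Y p →L[ℝ] F := LinearMap.extendOfNorm f (emb p)

theorem extOp_emb {F : Type} [NormedAddCommGroup F] [NormedSpace ℝ F] [CompleteSpace F]
    (f : V →ₗ[ℝ] F) {C : ℝ} (h : ∀ x, ‖f x‖ ≤ C * nrm p x) (x : V) :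
    extOp (p := p) f (emb p x) = f x := by
  refine LinearMap.extendOfNorm_eq dense_emb ⟨C, fun x => ?_⟩ x
  rw [norm_emb]; exact h x

theorem norm_le_of_emb {F : Type} [NormedAddCommGroup F] [NormedSpace ℝ F]
    (T : Y p →L[ℝ] F) {C : ℝ} (hC : 0 ≤ C) (h : ∀ x, ‖T (emb p x)‖ ≤ C * nrm p x) : ‖T‖ ≤ C := by
  refine T.opNorm_le_bound hC fun y => ?_
  refine dense_emb.induction_on (p := fun y => ‖T y‖ ≤ C * ‖y‖) y ?_ fun x => ?_
  · exact isClosed_le (by fun_prop) (by fun_prop)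
  · rw [norm_emb]; exact h x

theorem clm_ext_emb {F : Type} [NormedAddCommGroup F] [NormedSpace ℝ F]
    {S T : Y p →L[ℝ] F} (h : ∀ x, S (emb p x) = T (emb p x)) : S = T := by
  refine ContinuousLinearMap.ext fun y => ?_
  refine dense_emb.induction_on (p := fun y => S y = T y) y ?_ h
  exact isClosed_eq (by fun_prop) (by fun_prop)

end Y

section RIS
variable {p : ℝ}

theorem abs_sum_le_exc (J : Finset ℕ) (a : ℕ → ℝ) {A B : ℝ} (exc : ℕ → Prop) (hA : 0 ≤ A)
    (hB : 0 ≤ B) (h : ∀ i ∈ J, exc i ∨ |a i| ≤ A) (h' : ∀ i ∈ J, |a i| ≤ B)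
    (huniq : ∀ i ∈ J, ∀ i' ∈ J, exc i → exc i' → i = i') :
    |∑ i ∈ J, a i| ≤ J.card * A + B := by
  classical
  refine (Finset.abs_sum_le_sum_abs _ _).trans ?_
  have h1 : ∀ i ∈ J, |a i| ≤ A + if exc i then B else 0 := by
    intro i hi
    split_ifs with he
    · linarith [h' i hi]
    · linarith [(h i hi).resolve_left he]
  refine (Finset.sum_le_sum h1).trans ?_
  rw [Finset.sum_add_distrib, Finset.sum_const, nsmul_eq_mul, ← Finset.sum_filter,
    Finset.sum_const, nsmul_eq_mul]
  have h2 : (J.filter exc).card ≤ 1 := Finset.card_le_one.2 fun i hi i' hi' => by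
    rw [Finset.mem_filter] at hi hi'
    exact huniq i hi.1 i' hi'.1 hi.2 hi'.2
  have h3 : ((J.filter exc).card : ℝ) ≤ 1 := by exact_mod_cast h2
  nlinarith

theorem abs_ev_le_of_supp_le_wt {x : V} {h : ℕ} {t : ℝ} (hx : ∀ n, x n ≠ 0 → n < h) (hb : Bd p t x) :
    ∀ γ, 1 ≤ wt p γ → h ≤ wt p γ → |ev (en p γ) x| ≤ t * bt (wt p γ) := by
  intro γ
  induction γ using Nat.strong_induction_on with
  | _ γ ih =>
    intro h1 hh
    obtain ⟨prev, b, hB⟩ := exists_built p h1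
    have hz : ∀ n, h ≤ n → x n = 0 := fun n hn => by
      by_contra hne; have := hx n hne; omega
    rw [hB.ev_eq, hz γ (hh.trans (wt_le p γ)), zero_add]
    cases prev with
    | none =>
      simp only [enp, ev_zero, zero_add]
      rw [abs_mul, abs_of_pos (bt_pos _), mul_comm]
      exact mul_le_mul_of_nonneg_right (hB.inB.le hb) (bt_pos _).le
    | some ξ =>
      obtain ⟨h2, h3, -⟩ := hB.prev_spec ξ rfl
      have : ev b x = 0 := ev_eq_zero fun k hk => by
        have h4 := (hB.supp k hk).2.1 ξ rfl
        have h5 := wt_le p ξ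
        exact hz k (by omega)
      rw [this, mul_zero, add_zero, ← h3]
      exact ih ξ h2 (by omega) (by omega)

/-- Rapidly increasing sequences of length `L`. -/
structure RISseq (p : ℝ) (L : ℕ) (C : ℝ) (x : ℕ → V) (lo hi jj : ℕ → ℕ) : Prop where
  supp : ∀ i < L, ∀ n, x i n ≠ 0 → lo i ≤ n ∧ n < hi i
  bd : ∀ i < L, Bd p C (x i)
  wtb : ∀ i < L, ∀ γ, 1 ≤ wt p γ → wt p γ < jj i → |ev (en p γ) (x i)| ≤ C * bt (wt p γ)
  lohi : ∀ i < L, lo i ≤ hi i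
  sep : ∀ i i', i < i' → i' < L → 3 * hi i ≤ lo i'
  jhi : ∀ i i', i < i' → i' < L → hi i ≤ jj i'

variable {L : ℕ} {C : ℝ} {x : ℕ → V} {lo hi jj : ℕ → ℕ}

theorem RISseq.abs_coord_le (hp : 1 < p) (R : RISseq p L C x lo hi jj) (hC : 0 ≤ C) {J : Finset ℕ}
    (hJ : ∀ i ∈ J, i < L) (n : ℕ) : |(∑ i ∈ J, x i) n| ≤ 3 * C := by
  rw [Finsupp.finsetSum_apply]
  refine (abs_sum_le_exc J (fun i => x i n) (A := 0) (B := 3 * C) (fun i => x i n ≠ 0) le_rfl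
    (by linarith) ?_ ?_ ?_).trans (by simp)
  · intro i _
    by_cases h : x i n = 0
    · right; simp [h]
    · left; exact h
  · intro i h
    exact coord_le hp (fun η _ => (R.bd i (hJ i h)).1 η) (R.bd i (hJ i h)).2
  · intro i h i' h' e e'
    have h1 := R.supp i (hJ i h) n e
    have h2 := R.supp i' (hJ i' h') n e'
    rcases lt_trichotomy i i' with h3 | h3 | h3
    · have := R.sep i i' h3 (hJ i' h'); omega
    · exact h3
    · have := R.sep i' i h3 (hJ i h); omega

theorem blk_sum (N : ℕ) (J : Finset ℕ) (x : ℕ → V) : blk N (∑ i ∈ J, x i) = ∑ i ∈ J, blk N (x i) := by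
  classical
  induction J using Finset.induction_on with
  | empty => ext k; simp [blk]
  | insert a s ha ih => rw [Finset.sum_insert ha, Finset.sum_insert ha, blk_add, ih]

theorem RISseq.wb (hp : 1 < p) (R : RISseq p L C x lo hi jj) (hC : 0 ≤ C) {J : Finset ℕ}
    (hJ : ∀ i ∈ J, i < L) : WB p C (∑ i ∈ J, x i) := by
  intro N
  show PV p _ _
  rw [blk_sum]
  have key : ∀ i ∈ J, ∀ i' ∈ J, i < i' → blk N (x i) ≠ 0 → blk N (x i') = 0 := by
    intro i h i' h' hlt hne
    by_contra hne'
    obtain ⟨k, hk⟩ := Function.ne_iff.1 hne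
    obtain ⟨k', hk'⟩ := Function.ne_iff.1 hne'
    simp only [blk, Pi.zero_apply, ne_eq, ite_eq_right_iff, Classical.not_imp] at hk hk'
    have h1 := (R.supp i (hJ i h) _ hk.2).2
    have h2 := (R.supp i' (hJ i' h') _ hk'.2).1
    have h3 := R.sep i i' hlt (hJ i' h')
    have : 2 * N ≤ 2 * N ^ 2 + 1 := by nlinarith [sq_nonneg ((N : ℤ) - 1), Nat.le_self_pow two_ne_zero N]
    omega
  by_cases hz : ∀ i ∈ J, blk N (x i) = 0
  · rw [Finset.sum_eq_zero hz]
    exact (PV_zero hp).mono hC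
  · push Not at hz
    obtain ⟨i, h, hne⟩ := hz
    rw [Finset.sum_eq_single i]
    · exact (R.bd i (hJ i h)).2 N
    · intro i' h' hii
      rcases lt_or_gt_of_ne hii with h3 | h3
      · by_contra h4
        exact hne (key i' h' i h h3 h4)
      · exact key i h i' h' h3 hne
    · exact fun h' => absurd h h'

theorem RISseq.big (R : RISseq p L C x lo hi jj) (hC : 0 ≤ C) {J : Finset ℕ}
    (hJ : ∀ i ∈ J, i < L) {γ : ℕ} (hγ : 1 ≤ wt p γ) :
    |ev (en p γ) (∑ i ∈ J, x i)| ≤ C * (J.card * bt (wt p γ) + 1) := by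
  rw [map_sum]
  refine (abs_sum_le_exc J (fun i => ev (en p γ) (x i)) (A := C * bt (wt p γ)) (B := C)
    (fun i => jj i ≤ wt p γ ∧ wt p γ < hi i) (mul_nonneg hC (bt_pos _).le) hC ?_ ?_ ?_).trans
      (le_of_eq (by ring))
  · intro i h
    by_cases h1 : wt p γ < jj i
    · exact Or.inr (R.wtb i (hJ i h) γ hγ h1)
    · by_cases h2 : wt p γ < hi i
      · exact Or.inl ⟨by omega, h2⟩
      · exact Or.inr (abs_ev_le_of_supp_le_wt (h := hi i) (fun n hn => (R.supp i (hJ i h) n hn).2)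
          (R.bd i (hJ i h)) γ hγ (by omega))
  · intro i h
    exact (R.bd i (hJ i h)).1 γ
  · intro i h i' h' e e'
    rcases lt_trichotomy i i' with h3 | h3 | h3
    · have := R.jhi i i' h3 (hJ i' h'); omega
    · exact h3
    · have := R.jhi i' i h3 (hJ i h); omega

theorem ev_sum_filter {f : ℕ → ℝ} {J : Finset ℕ} (P : ℕ → Prop) [DecidablePred P]
    (h : ∀ i ∈ J, ¬ P i → ∀ n, f n ≠ 0 → x i n = 0) :
    ev f (∑ i ∈ J, x i) = ev f (∑ i ∈ J.filter P, x i) := by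
  rw [map_sum, map_sum, Finset.sum_filter]
  refine Finset.sum_congr rfl fun i hi => ?_
  split_ifs with hP
  · rfl
  · exact ev_eq_zero (h i hi hP)

theorem RISseq.card_split (R : RISseq p L C x lo hi jj) {J : Finset ℕ} (hJ : ∀ i ∈ J, i < L) (ξ : ℕ) :
    (J.filter fun i => lo i ≤ ξ).card + (J.filter fun i => ξ < hi i).card ≤ J.card + 1 := by
  classical
  rw [← Finset.card_union_add_card_inter]
  refine add_le_add (Finset.card_le_card (Finset.union_subset (Finset.filter_subset _ _)
    (Finset.filter_subset _ _))) (Finset.card_le_one.2 fun i h i' h' => ?_)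
  simp only [Finset.mem_inter, Finset.mem_filter] at h h'
  rcases lt_trichotomy i i' with h3 | h3 | h3
  · have := R.sep i i' h3 (hJ i' h'.1.1); omega
  · exact h3
  · have := R.sep i' i h3 (hJ i h.1.1); omega

theorem RISseq.chain (hp : 1 < p) (R : RISseq p L C x lo hi jj) (hC : 0 ≤ C) {C' θ A : ℝ}
    (hC' : 0 ≤ C') (hθ : 0 ≤ θ)
    (H : ∀ J : Finset ℕ, (∀ i ∈ J, i < L) → Bd p (C' * (J.card * θ + A)) (∑ i ∈ J, x i)) :
    ∀ γ, 1 ≤ wt p γ → ∀ J : Finset ℕ, (∀ i ∈ J, i < L) → |ev (en p γ) (∑ i ∈ J, x i)| ≤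
      age p γ * (3 * C + bt (wt p γ) * C' * (θ + A)) + bt (wt p γ) * C' * θ * J.card := by
  intro γ
  induction γ using Nat.strong_induction_on with
  | _ γ ih =>
    intro h1 J hJ
    obtain ⟨prev, b, hB⟩ := exists_built p h1
    have hβ := bt_pos (wt p γ)
    have hcoord := R.abs_coord_le hp hC hJ γ
    rw [hB.ev_eq]
    cases prev with
    | none =>
      simp only [enp, ev_zero, add_zero]
      rw [hB.age_none rfl]
      have h2 := hB.inB.le (H J hJ)
      refine (abs_add_le _ _).trans ?_
      rw [abs_mul, abs_of_pos hβ]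
      have h3 := mul_le_mul_of_nonneg_left h2 hβ.le
      have : 0 ≤ bt (wt p γ) * C' * θ := by positivity
      rw [Nat.cast_one]
      nlinarith
    | some ξ =>
      obtain ⟨g1, g2, -, -, g5⟩ := hB.prev_spec ξ rfl
      simp only [enp]
      have e1 : ev (en p ξ) (∑ i ∈ J, x i) = ev (en p ξ) (∑ i ∈ J.filter fun i => lo i ≤ ξ, x i) :=
        ev_sum_filter _ fun i h hP n hn => by
          by_contra hne
          have := (R.supp i (hJ i h) n hne).1
          have := en_supp p ξ n hn
          omega
      have e2 : ev b (∑ i ∈ J, x i) = ev b (∑ i ∈ J.filter fun i => ξ < hi i, x i) :=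
        ev_sum_filter _ fun i h hP n hn => by
          by_contra hne
          have := (R.supp i (hJ i h) n hne).2
          have := (hB.supp n hn).2.1 ξ rfl
          omega
      have hJ1 : ∀ i ∈ J.filter fun i => lo i ≤ ξ, i < L := fun i h => hJ i (Finset.mem_filter.1 h).1
      have hJ2 : ∀ i ∈ J.filter fun i => ξ < hi i, i < L := fun i h => hJ i (Finset.mem_filter.1 h).1
      have h2 := ih ξ g1 (by omega) _ hJ1
      rw [← e1, g2] at h2
      have h3 := hB.inB.le (H _ hJ2)
      rw [← e2] at h3
      have h4 := mul_le_mul_of_nonneg_left h3 hβ.le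
      have h5 : (((J.filter fun i => lo i ≤ ξ).card : ℝ) + (J.filter fun i => ξ < hi i).card) ≤
          J.card + 1 := by exact_mod_cast R.card_split hJ ξ
      have h6 : 0 ≤ bt (wt p γ) * C' * θ := by positivity
      have h7 := mul_le_mul_of_nonneg_left h5 h6
      rw [g5]
      refine (abs_add_le _ _).trans ((add_le_add_left (abs_add_le _ _) _).trans ?_)
      rw [abs_mul, abs_of_pos hβ, Nat.cast_add, Nat.cast_one]
      nlinarith

theorem RISseq.bd_card (hp : 1 < p) (R : RISseq p L C x lo hi jj) {J : Finset ℕ}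
    (hJ : ∀ i ∈ J, i < L) : Bd p (J.card * C) (∑ i ∈ J, x i) := by
  classical
  induction J using Finset.induction_on with
  | empty =>
    simp only [Finset.card_empty, Nat.cast_zero, zero_mul, Finset.sum_empty]
    refine ⟨fun n => by simp, ?_⟩
    have := WB_single hp 0 0
    simpa using this
  | insert a s ha ih =>
    rw [Finset.sum_insert ha, Finset.card_insert_of_notMem ha]
    have h1 := R.bd a (hJ a (Finset.mem_insert_self _ _))
    have h2 := ih fun i hi => hJ i (Finset.mem_insert_of_mem hi)
    refine (h1.add hp h2).mono (le_of_eq ?_)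
    push_cast; ring

theorem RISseq.induct (hp : 1 < p) (R : RISseq p L C x lo hi jj) (hC : 0 ≤ C) {C' τ : ℝ} {j : ℕ}
    (hC' : C ≤ C') (hτ : 0 ≤ τ) (hτ1 : τ ≤ 1)
    (H : ∀ γ, j + 1 ≤ wt p γ → ∀ J : Finset ℕ, (∀ i ∈ J, i < L) →
      |ev (en p γ) (∑ i ∈ J, x i)| ≤ C' * (J.card * τ + 1)) (d : ℕ) :
    ∀ J : Finset ℕ, (∀ i ∈ J, i < L) →
      Bd p (C' * (J.card * ((1 / 2) ^ d + τ) + (5 * nn j : ℝ) ^ d)) (∑ i ∈ J, x i) := by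
  have hn : (1 : ℝ) ≤ nn j := by exact_mod_cast nn_pos j
  have hC'0 := hC.trans hC'
  induction d with
  | zero =>
    intro J hJ
    refine (R.bd_card hp hJ).mono ?_
    have : (0 : ℝ) ≤ J.card := by positivity
    simp only [pow_zero]
    nlinarith [mul_le_mul_of_nonneg_left hC' this, mul_nonneg (mul_nonneg hC'0 this) hτ]
  | succ d ih =>
    intro J hJ
    set Nd := (5 * nn j : ℝ) ^ d with hNd
    have hNd1 : 1 ≤ Nd := one_le_pow₀ (by linarith)
    have hs : (5 * nn j : ℝ) ^ (d + 1) = 5 * nn j * Nd := by rw [pow_succ, hNd]; ring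
    have hp2 : (1 / 2 : ℝ) ^ d ≤ 1 := pow_le_one₀ (by norm_num) (by norm_num)
    have hp0 : (0 : ℝ) ≤ (1 / 2 : ℝ) ^ d := by positivity
    have hJ0 : (0 : ℝ) ≤ J.card := by positivity
    have hnN : Nd ≤ nn j * Nd := by nlinarith
    have hfirst : 0 ≤ C' * (J.card * ((1 / 2) ^ (d + 1) + τ)) := by positivity
    have hbig : C' * 5 ≤ C' * (5 * nn j * Nd) := mul_le_mul_of_nonneg_left (by nlinarith) hC'0
    rw [hs]
    refine ⟨fun γ => ?_, (R.wb hp hC hJ).mono (by nlinarith)⟩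
    by_cases h0 : wt p γ = 0
    · rw [en_of_wt_zero p h0, ev_pi_single]
      refine (R.abs_coord_le hp hC hJ γ).trans (by nlinarith)
    · by_cases h1 : j + 1 ≤ wt p γ
      · refine (H γ h1 J hJ).trans ?_
        refine mul_le_mul_of_nonneg_left ?_ hC'0
        have : 0 ≤ (J.card : ℝ) * (1 / 2) ^ (d + 1) := by positivity
        nlinarith
      · have hch := R.chain hp hC hC'0 (add_nonneg hp0 hτ) ih γ (by omega) J hJ
        refine hch.trans ?_
        have ha : (age p γ : ℝ) ≤ nn j := by
          exact_mod_cast (age_le p γ (by omega)).trans (nn_mono (by omega))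
        have hb := bt_le (show 1 ≤ wt p γ by omega)
        have hb0 := bt_pos (wt p γ)
        have e1 : 3 * C + bt (wt p γ) * C' * ((1 / 2) ^ d + τ + Nd) ≤ C' * (5 * Nd) := by
          have : bt (wt p γ) * (C' * ((1 / 2) ^ d + τ + Nd)) ≤ 1 / 4 * (C' * (3 * Nd)) :=
            mul_le_mul hb (mul_le_mul_of_nonneg_left (by linarith) hC'0) (by positivity) (by norm_num)
          nlinarith
        have e2 : (age p γ : ℝ) * (3 * C + bt (wt p γ) * C' * ((1 / 2) ^ d + τ + Nd)) ≤
            nn j * (C' * (5 * Nd)) :=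
          mul_le_mul ha e1 (by positivity) (by positivity)
        have e3 : bt (wt p γ) * C' * ((1 / 2) ^ d + τ) * J.card ≤
            C' * (J.card * ((1 / 2) ^ (d + 1) + τ)) := by
          have : bt (wt p γ) * ((C' * J.card) * ((1 / 2) ^ d + τ)) ≤
              1 / 4 * ((C' * J.card) * ((1 / 2) ^ d + τ)) :=
            mul_le_mul_of_nonneg_right hb (by positivity)
          have h3 : 0 ≤ C' * J.card * (1 / 2) ^ d := by positivity
          have h4 : 0 ≤ C' * J.card * τ := by positivity
          rw [pow_succ]
          nlinarith
        linarith

theorem nn_params (j : ℕ) : (1 / 2 : ℝ) ^ (mm (j + 1) ^ 2) ≤ 1 / (mm (j + 1) : ℝ) ^ 2 ∧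
    (nn (j + 1) : ℝ) = (mm (j + 1) : ℝ) ^ 2 * (5 * nn j : ℝ) ^ (mm (j + 1) ^ 2 + 1) := by
  constructor
  · rw [div_pow, one_pow]
    refine one_div_le_one_div_of_le (by have := mm_pos (j + 1); positivity) ?_
    have : mm (j + 1) ^ 2 < 2 ^ (mm (j + 1) ^ 2) := Nat.lt_two_pow_self
    exact_mod_cast this.le
  · rw [nn_succ]; push_cast; rfl

theorem RISseq.bd_final (hp : 1 < p) (R : RISseq p L C x lo hi jj) (hC : 0 ≤ C) {C' τ : ℝ} {j : ℕ}
    (hC' : C ≤ C') (hτ : 0 ≤ τ) (hτ1 : τ ≤ 1)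
    (H : ∀ γ, j + 1 ≤ wt p γ → ∀ J : Finset ℕ, (∀ i ∈ J, i < L) →
      |ev (en p γ) (∑ i ∈ J, x i)| ≤ C' * (J.card * τ + 1)) {J : Finset ℕ} (hJ : ∀ i ∈ J, i < L)
    (hcard : J.card ≤ nn (j + 1)) :
    Bd p (C' * nn (j + 1) * (τ + 2 / (mm (j + 1) : ℝ) ^ 2)) (∑ i ∈ J, x i) := by
  refine (R.induct hp hC hC' hτ hτ1 H (mm (j + 1) ^ 2) J hJ).mono ?_
  obtain ⟨h1, h2⟩ := nn_params j
  have hn : (1 : ℝ) ≤ nn j := by exact_mod_cast nn_pos j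
  have hc : (J.card : ℝ) ≤ nn (j + 1) := by exact_mod_cast hcard
  have hC'0 := hC.trans hC'
  rw [mul_assoc]
  refine mul_le_mul_of_nonneg_left ?_ hC'0
  have hm : (0 : ℝ) < mm (j + 1) := by exact_mod_cast mm_pos (j + 1)
  have h3 : (5 * nn j : ℝ) ^ (mm (j + 1) ^ 2) ≤ nn (j + 1) * (1 / (mm (j + 1) : ℝ) ^ 2) := by
    rw [h2, mul_one_div, mul_div_cancel_left₀ _ (by positivity), pow_succ]
    exact le_mul_of_one_le_right (by positivity) (by linarith)
  have h4 : (J.card : ℝ) * ((1 / 2) ^ (mm (j + 1) ^ 2) + τ) ≤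
      nn (j + 1) * (1 / (mm (j + 1) : ℝ) ^ 2 + τ) :=
    mul_le_mul hc (by linarith) (by positivity) (by positivity)
  have : (2 : ℝ) / (mm (j + 1) : ℝ) ^ 2 = 1 / (mm (j + 1) : ℝ) ^ 2 + 1 / (mm (j + 1) : ℝ) ^ 2 := by ring
  rw [this]
  nlinarith

/-- The average used in exact pairs. -/
noncomputable def avg (j : ℕ) (x : ℕ → V) : V :=
  ((mm j : ℝ) / nn j) • ∑ i ∈ Finset.range (nn j), x i

theorem RISseq.avg_spec (hp : 1 < p) {j : ℕ} (hj : 1 ≤ j) (R : RISseq p (nn j) C x lo hi jj)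
    (hC : 0 ≤ C) :
    Bd p (3 * C) (avg j x) ∧
    (∀ γ, 1 ≤ wt p γ → wt p γ < j → |ev (en p γ) (avg j x)| ≤ 3 * C * bt (wt p γ)) ∧
    (∀ γ, j < wt p γ → |ev (en p γ) (avg j x)| ≤ 2 * C * bt j) ∧
    ∀ n, |avg j x n| ≤ 3 * C * bt j := by
  obtain ⟨j, rfl⟩ : ∃ k, j = k + 1 := ⟨j - 1, by omega⟩
  obtain ⟨h1, h2⟩ := nn_params j
  have hJ : ∀ i ∈ Finset.range (nn (j + 1)), i < nn (j + 1) := fun i h => Finset.mem_range.1 h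
  have hm : (4 : ℝ) ≤ mm (j + 1) := by exact_mod_cast four_le_mm hj
  have hn : (0 : ℝ) < nn (j + 1) := by exact_mod_cast nn_pos (j + 1)
  have hn0 : (1 : ℝ) ≤ nn j := by exact_mod_cast nn_pos j
  have hmn : (mm (j + 1) : ℝ) ^ 2 ≤ nn (j + 1) := by exact_mod_cast mm_sq_le_nn_succ j
  have hβ : bt (j + 1) = 1 / (mm (j + 1) : ℝ) := rfl
  set m : ℝ := (mm (j + 1) : ℝ) with hmdef
  set n : ℝ := (nn (j + 1) : ℝ) with hndef
  have hm0 : 0 < m := by linarith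
  have hmn' : m / n ≤ 1 / m := by
    rw [div_le_div_iff₀ hn hm0]; nlinarith
  have hmn0 : 0 ≤ m / n := by positivity
  have hbound : ∀ γ, j + 1 ≤ wt p γ → ∀ J : Finset ℕ, (∀ i ∈ J, i < nn (j + 1)) →
      |ev (en p γ) (∑ i ∈ J, x i)| ≤ C * (J.card * bt (j + 1) + 1) := fun γ hγ J hJ =>
    (R.big hC hJ (by omega)).trans (mul_le_mul_of_nonneg_left (add_le_add_left
      (mul_le_mul_of_nonneg_left (bt_anti hγ) (by positivity)) _) hC)
  have hev : ∀ f : ℕ → ℝ, |ev f (avg (j + 1) x)| =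
      m / n * |ev f (∑ i ∈ Finset.range (nn (j + 1)), x i)| := fun f => by
    rw [avg, map_smul, smul_eq_mul, abs_mul, abs_of_nonneg hmn0]
  refine ⟨?_, ?_, ?_, ?_⟩
  · have := (R.bd_final hp hC le_rfl (bt_pos _).le (bt_le_one _) hbound hJ (by simp)).smul hp (m / n)
    refine this.mono ?_
    rw [abs_of_nonneg hmn0, hβ]
    have e : m / n * (C * n * (1 / m + 2 / m ^ 2)) = C * (1 + 2 * (1 / m)) := by
      field_simp
    rw [← hmdef, e]
    have : 1 / m ≤ 1 := by rw [div_le_one hm0]; linarith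
    nlinarith
  · intro γ hγ1 hγ
    rw [hev]
    have hch := R.chain hp hC hC (θ := (1 / 2) ^ (mm (j + 1) ^ 2) + bt (j + 1))
      (A := (5 * nn j : ℝ) ^ (mm (j + 1) ^ 2)) (by have := bt_pos (j + 1); positivity)
      (R.induct hp hC le_rfl (bt_pos _).le (bt_le_one _) hbound _) γ hγ1 _ hJ
    rw [Finset.card_range] at hch
    have ha : (age p γ : ℝ) ≤ nn j := by
      exact_mod_cast (age_le p γ (by omega)).trans (nn_mono (by omega))
    have hb := bt_le hγ1
    have hb0 := bt_pos (wt p γ)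
    have hbj : 1 / m ≤ bt (wt p γ) := by rw [← hβ]; exact bt_anti hγ.le
    set b := bt (wt p γ)
    set A := (5 * nn j : ℝ) ^ (mm (j + 1) ^ 2) with hA
    set θ := (1 / 2 : ℝ) ^ (mm (j + 1) ^ 2) + bt (j + 1) with hθ
    have hA1 : 1 ≤ A := one_le_pow₀ (by linarith)
    have hn' : n = m ^ 2 * (A * (5 * nn j)) := by rw [h2, hA, ← pow_succ]
    have h1m : 1 / m ≤ 1 / 4 := one_div_le_one_div_of_le (by norm_num) hm
    have hθm : θ ≤ 1 / m * (5 / 4) := by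
      have : 1 / m ^ 2 ≤ 1 / m * (1 / 4) := by
        have : 1 / m ^ 2 = 1 / m * (1 / m) := by rw [pow_two]; field_simp
        rw [this]
        exact mul_le_mul_of_nonneg_left h1m (by positivity)
      rw [hθ, hβ]
      linarith
    have hθ0 : 0 ≤ θ := by have := bt_pos (j + 1); positivity
    have hθ1 : θ ≤ 1 := by nlinarith
    have e1 : 3 * C + b * C * (θ + A) ≤ C * (5 * A) := by
      have : b * (C * (θ + A)) ≤ 1 / 4 * (C * (2 * A)) :=
        mul_le_mul hb (mul_le_mul_of_nonneg_left (by linarith) hC) (by positivity) (by norm_num)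
      nlinarith
    have e2 : (age p γ : ℝ) * (3 * C + b * C * (θ + A)) ≤ nn j * (C * (5 * A)) :=
      mul_le_mul ha e1 (by positivity) (by positivity)
    have e3 : m / n * (nn j * (C * (5 * A))) = C * (1 / m) := by
      have hx : m * (nn j * (C * (5 * A))) = C * (1 / m) * n := by
        rw [hn']; field_simp
      rw [div_mul_eq_mul_div, hx, mul_div_cancel_right₀ _ hn.ne']
    have e4 : m / n * (b * C * θ * n) = b * C * (m * θ) := by field_simp
    have e5 : m * θ ≤ 5 / 4 := by
      have := mul_le_mul_of_nonneg_left hθm hm0.le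
      have e : m * (1 / m * (5 / 4)) = 5 / 4 := by field_simp
      linarith
    calc m / n * |ev (en p γ) (∑ i ∈ Finset.range (nn (j + 1)), x i)|
        ≤ m / n * (nn j * (C * (5 * A)) + b * C * θ * n) :=
          mul_le_mul_of_nonneg_left (hch.trans (by linarith)) hmn0
      _ = C * (1 / m) + b * C * (m * θ) := by rw [mul_add, e3, e4]
      _ ≤ C * b + b * C * (5 / 4) := add_le_add (mul_le_mul_of_nonneg_left hbj hC)
          (mul_le_mul_of_nonneg_left e5 (by positivity))
      _ ≤ 3 * C * b := by nlinarith [mul_nonneg hC hb0.le]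
  · intro γ hγ
    rw [hev]
    have hb := R.big hC hJ (show 1 ≤ wt p γ by omega)
    rw [Finset.card_range, ← hndef] at hb
    have hw : bt (wt p γ) ≤ (1 / m) ^ 2 := by
      have := bt_le_inv_sq hj hγ
      rwa [hβ] at this
    calc _ ≤ m / n * (C * (n * bt (wt p γ) + 1)) := mul_le_mul_of_nonneg_left hb hmn0
      _ = C * (m * bt (wt p γ) + m / n) := by field_simp
      _ ≤ C * (1 / m + 1 / m) := by
          refine mul_le_mul_of_nonneg_left (add_le_add ?_ hmn') hC
          have := mul_le_mul_of_nonneg_left hw hm0.le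
          have e : m * (1 / m) ^ 2 = 1 / m := by field_simp
          linarith
      _ = 2 * C * bt (j + 1) := by rw [hβ]; ring
  · intro k
    have := R.abs_coord_le hp hC hJ k
    rw [avg, Finsupp.smul_apply, smul_eq_mul, abs_mul, abs_of_nonneg hmn0, hβ]
    calc _ ≤ 1 / m * (3 * C) := mul_le_mul hmn' this (abs_nonneg _) (by positivity)
      _ = _ := by ring

end RIS

section chains
variable {p : ℝ}

/-- The predecessor in a chain. -/
def pr (ξ : ℕ → ℕ) : ℕ → Option ℕ
  | 0 => none
  | r + 1 => some (ξ r)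

theorem exists_chain {α : Type} (j : ℕ) (κ : ℕ∞) (Q : Option ℕ → α → ℕ → (ℕ → ℝ) → Prop)
    (H : ∀ prev : Option ℕ, (∀ ξ, prev = some ξ → wt p ξ = j ∧ col p ξ = κ ∧ age p ξ < nn j) →
      ∃ a ξ b, Built p ξ prev b ∧ wt p ξ = j ∧ col p ξ = κ ∧ Q prev a ξ b) :
    ∃ (a : ℕ → α) (ξ : ℕ → ℕ) (b : ℕ → ℕ → ℝ), ∀ r < nn j, Built p (ξ r) (pr ξ r) (b r) ∧
      wt p (ξ r) = j ∧ col p (ξ r) = κ ∧ Q (pr ξ r) (a r) (ξ r) (b r) := by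
  classical
  obtain ⟨a0, -⟩ := H none (fun ξ h => by cases h)
  have H' : ∀ prev : Option ℕ, ∃ t : α × ℕ × (ℕ → ℝ),
      (∀ ξ, prev = some ξ → wt p ξ = j ∧ col p ξ = κ ∧ age p ξ < nn j) →
      Built p t.2.1 prev t.2.2 ∧ wt p t.2.1 = j ∧ col p t.2.1 = κ ∧ Q prev t.1 t.2.1 t.2.2 := by
    intro prev
    by_cases h : ∀ ξ, prev = some ξ → wt p ξ = j ∧ col p ξ = κ ∧ age p ξ < nn j
    · obtain ⟨a, ξ, b, hh⟩ := H prev h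
      exact ⟨(a, ξ, b), fun _ => hh⟩
    · exact ⟨(a0, 0, 0), fun h' => absurd h' h⟩
  choose F hF using H'
  let s : ℕ → α × ℕ × (ℕ → ℝ) := fun r => Nat.rec (F none) (fun _ t => F (some t.2.1)) r
  have hs : ∀ r, s r = F (pr (fun r => (s r).2.1) r) := fun r => by cases r <;> rfl
  refine ⟨fun r => (s r).1, fun r => (s r).2.1, fun r => (s r).2.2, ?_⟩
  have key : ∀ r < nn j, (Built p (s r).2.1 (pr (fun r => (s r).2.1) r) (s r).2.2 ∧
      wt p (s r).2.1 = j ∧ col p (s r).2.1 = κ ∧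
      Q (pr (fun r => (s r).2.1) r) (s r).1 (s r).2.1 (s r).2.2) ∧ age p (s r).2.1 = r + 1 := by
    intro r
    induction r with
    | zero =>
      intro _
      have := hF none (fun ξ h => by cases h)
      exact ⟨this, this.1.age_none rfl⟩
    | succ r ih =>
      intro hr
      obtain ⟨⟨h1, h2, h3, -⟩, h5⟩ := ih (by omega)
      have := hF (some (s r).2.1) (fun ξ h => by
        cases h; exact ⟨h2, h3, by omega⟩)
      refine ⟨this, ?_⟩
      have h6 := (this.1.prev_spec _ rfl).2.2.2.2
      rw [h5] at h6
      exact h6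
  exact fun r hr => (key r hr).1

/-- A chain of length `L`. -/
structure Chain (p : ℝ) (L j : ℕ) (κ : ℕ∞) (ξ : ℕ → ℕ) (b : ℕ → ℕ → ℝ) : Prop where
  built : ∀ r < L, Built p (ξ r) (pr ξ r) (b r)
  wt_eq : ∀ r < L, wt p (ξ r) = j
  col_eq : ∀ r < L, col p (ξ r) = κ

variable {L j : ℕ} {κ : ℕ∞} {ξ : ℕ → ℕ} {b : ℕ → ℕ → ℝ}

theorem Chain.lt (H : Chain p L j κ ξ b) {i i' : ℕ} (h : i < i') (h' : i' < L) : ξ i < ξ i' := by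
  induction i', h using Nat.le_induction with
  | base => exact ((H.built (i + 1) h').prev_spec _ rfl).1
  | succ k hk ih => exact (ih (by omega)).trans ((H.built (k + 1) h').prev_spec _ rfl).1

/-- The support of `x` lies strictly between the predecessor and `ξ r`. -/
def Between (ξ : ℕ → ℕ) (r : ℕ) (x : V) : Prop :=
  ∀ n, x n ≠ 0 → (∀ a, pr ξ r = some a → a < n) ∧ n < ξ r

theorem Chain.disj (H : Chain p L j κ ξ b) {i i' n : ℕ} (hi : i < L) (hi' : i' < L)
    (h1 : ∀ a, pr ξ i = some a → a < n) (h2 : n < ξ i)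
    (h3 : ∀ a, pr ξ i' = some a → a < n) (h4 : n ≤ ξ i') : i = i' := by
  have key : ∀ i i', i < i' → i' < L → n ≤ ξ i → (∀ a, pr ξ i' = some a → a < n) → False := by
    intro i i' h hL hn h'
    obtain ⟨k, rfl⟩ : ∃ k, i' = k + 1 := ⟨i' - 1, by omega⟩
    have h5 := h' (ξ k) rfl
    rcases Nat.lt_or_ge i k with h6 | h6
    · have := H.lt h6 (by omega); omega
    · have : i = k := by omega
      subst this; omega
  rcases lt_trichotomy i i' with h | h | h
  · exact (key i i' h hi' h2.le h3).elim
  · exact h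
  · exact (key i' i h hi h4 h1).elim

theorem Chain.coord (H : Chain p L j κ ξ b) {i r : ℕ} (hi : i < L) (hr : r < L) {x : V}
    (hx : Between ξ i x) : x (ξ r) = 0 := by
  by_contra hne
  obtain ⟨h1, h2⟩ := hx _ hne
  have h3 : i = r := H.disj hi hr h1 h2 (fun a ha => by
    have := ((H.built r hr).prev_spec a ha).1; exact this) le_rfl
  subst h3; omega

theorem Chain.piece (H : Chain p L j κ ξ b) {i r : ℕ} (hi : i < L) (hr : r < L) (hir : i ≠ r) {x : V}
    (hx : Between ξ i x) : ev (b r) x = 0 := by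
  refine ev_eq_zero fun n hn => ?_
  by_contra hne
  obtain ⟨h1, h2⟩ := hx _ hne
  obtain ⟨h3, h4, -⟩ := (H.built r hr).supp n hn
  exact hir (H.disj hi hr h1 h2 h4 h3.le)

theorem Chain.ev_one (H : Chain p L j κ ξ b) {i : ℕ} (hi : i < L) {x : V} (hx : Between ξ i x) (r : ℕ)
    (hr : r < L) : ev (en p (ξ r)) x = if i ≤ r then bt j * ev (b i) x else 0 := by
  induction r with
  | zero =>
    rw [(H.built 0 hr).ev_eq, H.coord hi hr hx, H.wt_eq 0 hr]
    simp only [pr, enp, ev_zero, zero_add]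
    split_ifs with h
    · have : i = 0 := by omega
      subst this; rfl
    · rw [H.piece hi hr (by omega) hx, mul_zero]
  | succ r ih =>
    rw [(H.built _ hr).ev_eq, H.coord hi hr hx, H.wt_eq _ hr]
    simp only [pr, enp, zero_add]
    rw [ih (by omega)]
    by_cases h : i = r + 1
    · subst h; simp
    · rw [H.piece hi hr h hx, mul_zero, add_zero]
      split_ifs <;> first | rfl | omega

theorem Chain.ev_sum (H : Chain p L j κ ξ b) {x : ℕ → V} (hx : ∀ i < L, Between ξ i (x i))
    {J : Finset ℕ} (hJ : ∀ i ∈ J, i < L) {r : ℕ} (hr : r < L) :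
    ev (en p (ξ r)) (∑ i ∈ J, x i) = ∑ i ∈ J, if i ≤ r then bt j * ev (b i) (x i) else 0 := by
  rw [map_sum]
  exact Finset.sum_congr rfl fun i hi => H.ev_one (hJ i hi) (hx i (hJ i hi)) r hr

theorem Chain.supp (H : Chain p L j κ ξ b) (P : ℕ → Prop) (h1 : ∀ r < L, P (ξ r))
    (h2 : ∀ r < L, ∀ k, b r k ≠ 0 → P k) (r : ℕ) (hr : r < L) : ∀ k, en p (ξ r) k ≠ 0 → P k := by
  induction r with
  | zero =>
    intro k hk
    by_contra hne
    apply hk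
    rw [(H.built 0 hr).eq]
    have e1 : k ≠ ξ 0 := by rintro rfl; exact hne (h1 0 hr)
    have e2 : b 0 k = 0 := by by_contra h; exact hne (h2 0 hr k h)
    simp [pr, enp, e1, e2]
  | succ r ih =>
    intro k hk
    by_contra hne
    apply hk
    rw [(H.built _ hr).eq]
    have e1 : k ≠ ξ (r + 1) := by rintro rfl; exact hne (h1 _ hr)
    have e2 : b (r + 1) k = 0 := by by_contra h; exact hne (h2 _ hr k h)
    have e3 : en p (ξ r) k = 0 := by by_contra h; exact hne (ih (by omega) k h)
    simp [pr, enp, e1, e2, e3]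

/-- Vectors that can be used as members of rapidly increasing sequences. -/
structure RIS (p : ℝ) (M : ℕ) (C : ℝ) (x : V) : Prop where
  supp : ∀ n, x n ≠ 0 → M ≤ n
  bd : Bd p C x
  wtb : ∀ γ, 1 ≤ wt p γ → wt p γ < M → |ev (en p γ) x| ≤ C * bt (wt p γ)

theorem okcol.of_some {κ c : ℕ∞} {M : ℕ} (h : okcol κ (some M) c) {prev : Option ℕ}
    (hp : ∀ ξ, prev = some ξ → ξ ≤ M) : okcol κ prev c := by
  cases prev with
  | none =>
    rcases h with h | h
    · exact Or.inr h
    · exact Or.inl h.1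
  | some ξ =>
    rcases h with h | h
    · exact Or.inl h
    · exact Or.inr ⟨h.1, lt_of_le_of_lt (by exact_mod_cast hp ξ rfl) h.2⟩

/-- Starting points of the supports of the members of a chain. -/
def Mof (M0 : ℕ) : Option ℕ → ℕ
  | none => M0
  | some ξ => M0 + 3 * ξ + 3

theorem le_Mof (M0 : ℕ) (o : Option ℕ) : M0 ≤ Mof M0 o := by
  cases o <;> simp only [Mof] <;> omega

theorem lt_Mof (M0 : ℕ) {o : Option ℕ} {ξ : ℕ} (h : o = some ξ) : 3 * ξ < Mof M0 o := by
  subst h; simp only [Mof]; omega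

theorem Chain.Mof_le (H : Chain p L j κ ξ b) (M0 : ℕ) {i i' : ℕ} (h : i < i') (h' : i' < L) :
    3 * ξ i ≤ Mof M0 (pr ξ i') := by
  obtain ⟨k, rfl⟩ : ∃ k, i' = k + 1 := ⟨i' - 1, by omega⟩
  have h1 : ξ i ≤ ξ k := by
    rcases Nat.lt_or_ge i k with h6 | h6
    · exact (H.lt h6 (by omega)).le
    · rw [show i = k by omega]
  simp only [pr, Mof]; omega

theorem lt_sig {j : ℕ} {prev : Option ℕ} (h : ∀ ξ, prev = some ξ → wt p ξ = j) : j < sig j prev := by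
  cases prev with
  | none => simp only [sig]; omega
  | some ξ =>
    have := h ξ rfl
    have := wt_le p ξ
    simp only [sig]; omega

theorem sig_inj {j : ℕ} {a b : Option ℕ} (h : sig j a = sig j b) : a = b := by
  cases a <;> cases b <;> simp only [sig] at h
  · rfl
  · omega
  · omega
  · congr 1; omega

theorem odd_chain_bound {C : ℝ} (hC : 0 ≤ C) {j : ℕ} (hodd : Odd j) {κ : ℕ∞} {ξ : ℕ → ℕ}
    {b : ℕ → ℕ → ℝ} (hch : Chain p (nn j) j κ ξ b) {z : ℕ → V} (hbz : ∀ i < nn j, Between ξ i (z i))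
    {lo : ℕ → ℕ} (hR : RISseq p (nn j) (3 * C) z lo ξ (fun i => sig j (pr ξ i)))
    (high : ∀ i < nn j, ∀ γ, sig j (pr ξ i) < wt p γ →
      |ev (en p γ) (z i)| ≤ 2 * C * bt (sig j (pr ξ i)))
    (coord : ∀ i < nn j, ∀ n, |z i n| ≤ 3 * C * bt (sig j (pr ξ i)))
    (hev : ∀ i < nn j, |ev (b i) (z i)| ≤ 1 / nn j)
    {J : Finset ℕ} (hJ : ∀ i ∈ J, i < nn j) :
    ∀ γ, wt p γ = j → |ev (en p γ) (∑ i ∈ J, z i)| ≤ 1 + 12 * C := by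
  have hn : (1 : ℝ) ≤ nn j := by exact_mod_cast nn_pos j
  have hcard : (J.card : ℝ) ≤ nn j := by
    have : J ⊆ Finset.range (nn j) := fun i hi => Finset.mem_range.2 (hJ i hi)
    exact_mod_cast (Finset.card_le_card this).trans (by simp)
  have hin : ∀ r < nn j, |ev (en p (ξ r)) (∑ i ∈ J, z i)| ≤ 1 := by
    intro r hr
    rw [hch.ev_sum hbz hJ hr]
    refine (Finset.abs_sum_le_sum_abs _ _).trans ((Finset.sum_le_sum (g := fun _ => 1 / (nn j : ℝ))
      fun i hi => ?_).trans ?_)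
    · split_ifs
      · rw [abs_mul, abs_of_pos (bt_pos _)]
        exact (mul_le_of_le_one_left (abs_nonneg _) (bt_le_one _)).trans (hev i (hJ i hi))
      · simp
    · rw [Finset.sum_const, nsmul_eq_mul, mul_one_div]
      exact (div_le_one (by linarith)).2 hcard
  have hsmall : ∀ h, j < h → bt h ≤ 1 / nn j * (1 / nn j) := fun h hh =>
    (bt_le_nn_inv_sq hh).trans (le_of_eq (pow_two _))
  have hn1 : 1 / (nn j : ℝ) ≤ 1 := (div_le_one (by linarith)).2 hn
  have hn0 : 0 < 1 / (nn j : ℝ) := by positivity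
  have hnn : (nn j : ℝ) * (1 / nn j) = 1 := by field_simp
  have hsigpr : ∀ i < nn j, j < sig j (pr ξ i) := fun i hi => lt_sig (p := p) fun a ha => by
    have := ((hch.built i hi).prev_spec a ha).2.1
    rw [hch.wt_eq i hi] at this
    exact this
  have hco : ∀ γ, |(∑ i ∈ J, z i) γ| ≤ 3 * C * (1 / nn j) := by
    intro γ
    rw [Finsupp.finsetSum_apply]
    refine (abs_sum_le_exc J (fun i => z i γ) (A := 0) (B := 3 * C * (1 / nn j)) (fun i => z i γ ≠ 0)
      le_rfl (by positivity) ?_ ?_ ?_).trans (by simp)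
    · intro i _
      by_cases h : z i γ = 0
      · right; simp [h]
      · left; exact h
    · intro i h
      refine (coord i (hJ i h) γ).trans (mul_le_mul_of_nonneg_left ?_ (by linarith))
      refine (hsmall _ (hsigpr i (hJ i h))).trans ?_
      nlinarith
    · intro i h i' h' e e'
      obtain ⟨h1, h2⟩ := hbz i (hJ i h) γ e
      obtain ⟨h3, h4⟩ := hbz i' (hJ i' h') γ e'
      exact hch.disj (hJ i h) (hJ i' h') h1 h2 h3 h4.le
  have main : ∀ γ, wt p γ = j → |ev (en p γ) (∑ i ∈ J, z i)| ≤
      1 + 6 * C + age p γ * (6 * C * (1 / nn j)) ∧ 1 ≤ age p γ := by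
    intro γ
    induction γ using Nat.strong_induction_on with
    | _ γ ih =>
      intro hγ
      have hj1 : 1 ≤ wt p γ := by rw [hγ]; exact hodd.pos
      obtain ⟨prev, b', hB⟩ := exists_built p hj1
      have hage : 1 ≤ age p γ := by
        cases prev with
        | none => rw [hB.age_none rfl]
        | some a => have := (hB.prev_spec a rfl).2.2.2.2; omega
      refine ⟨?_, hage⟩
      have hage' : (1 : ℝ) ≤ age p γ := by exact_mod_cast hage
      have hC6 : 0 ≤ 6 * C * (1 / (nn j : ℝ)) := by positivity
      obtain ⟨η, hη1, hη2, rfl⟩ := hB.odd (by rw [hγ]; exact hodd)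
      rw [hγ] at hη2
      have hsig : j < wt p η := by
        rw [hη2]
        exact lt_sig (p := p) fun a ha => by rw [(hB.prev_spec a ha).2.1, hγ]
      have hbig : |ev (en p η) (∑ i ∈ J, z i)| ≤ 6 * C := by
        refine (hR.big (by positivity) hJ (by omega)).trans ?_
        have : (J.card : ℝ) * bt (wt p η) ≤ 1 := by
          refine (mul_le_mul hcard (hsmall _ hsig) (bt_pos _).le (by positivity)).trans ?_
          rw [← mul_assoc, hnn, one_mul]
          exact hn1
        nlinarith
      have hco' := hco γ
      have hβ1 := bt_le_one (wt p γ)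
      have hβ0 := bt_pos (wt p γ)
      rw [hB.ev_eq]
      by_cases hprev : ∃ ξ', prev = some ξ' ∧ ∀ r < nn j, ξ' ≠ ξ r
      · obtain ⟨ξ', rfl, hne⟩ := hprev
        obtain ⟨h1, h2, -, -, h5⟩ := hB.prev_spec ξ' rfl
        obtain ⟨h6, -⟩ := ih ξ' h1 (by rw [h2, hγ])
        have h7 : |ev (en p η) (∑ i ∈ J, z i)| ≤ 3 * C * (1 / nn j) := by
          rw [map_sum]
          refine (Finset.abs_sum_le_sum_abs _ _).trans ((Finset.sum_le_sum
            (g := fun _ => 3 * C * (1 / (nn j : ℝ) * (1 / nn j))) fun i hi => ?_).trans ?_)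
          · have hi' := hJ i hi
            rcases lt_trichotomy (wt p η) (sig j (pr ξ i)) with h | h | h
            · exact (hR.wtb i hi' η (by omega) h).trans
                (mul_le_mul_of_nonneg_left (hsmall _ hsig) (by linarith))
            · exfalso
              rw [hη2] at h
              have := sig_inj h
              cases i with
              | zero => simp [pr] at this
              | succ i =>
                simp only [pr, Option.some.injEq] at this
                exact hne i (by omega) this
            · refine (high i hi' η h).trans ?_
              have := hsmall _ (hsigpr i hi')
              have h0 := bt_pos (sig j (pr ξ i))
              nlinarith
          · rw [Finset.sum_const, nsmul_eq_mul]
            have : (J.card : ℝ) * (1 / nn j) ≤ 1 := by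
              rw [mul_one_div]; exact (div_le_one (by linarith)).2 hcard
            calc _ = 3 * C * (1 / nn j) * ((J.card : ℝ) * (1 / nn j)) := by ring
              _ ≤ 3 * C * (1 / nn j) * 1 := mul_le_mul_of_nonneg_left this (by positivity)
              _ = _ := mul_one _
        have h8 : |bt (wt p γ) * ev (en p η) (∑ i ∈ J, z i)| ≤ 3 * C * (1 / nn j) := by
          rw [abs_mul, abs_of_pos hβ0]
          exact (mul_le_of_le_one_left (abs_nonneg _) hβ1).trans h7
        have h9 : (age p γ : ℝ) = age p ξ' + 1 := by rw [h5]; push_cast; rfl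
        rw [h9]
        refine (abs_add_le _ _).trans ((add_le_add_left (abs_add_le _ _) _).trans ?_)
        simp only [enp]
        linarith
      · have h6 : |ev (enp p prev) (∑ i ∈ J, z i)| ≤ 1 := by
          cases prev with
          | none => simp [enp]
          | some ξ' =>
            push Not at hprev
            obtain ⟨r, hr, rfl⟩ := hprev ξ' rfl
            exact hin r hr
        have h8 : |bt (wt p γ) * ev (en p η) (∑ i ∈ J, z i)| ≤ 6 * C := by
          rw [abs_mul, abs_of_pos hβ0]
          exact (mul_le_of_le_one_left (abs_nonneg _) hβ1).trans hbig
        refine (abs_add_le _ _).trans ((add_le_add_left (abs_add_le _ _) _).trans ?_)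
        nlinarith
  intro γ hγ
  obtain ⟨h1, h2⟩ := main γ hγ
  have h3 : (age p γ : ℝ) ≤ nn j := by
    have := age_le p γ (by rw [hγ]; exact hodd.pos)
    rw [hγ] at this
    exact_mod_cast this
  have h4 : (age p γ : ℝ) * (6 * C * (1 / nn j)) ≤ nn j * (6 * C * (1 / nn j)) :=
    mul_le_mul_of_nonneg_right h3 (by positivity)
  have h5 : (nn j : ℝ) * (6 * C * (1 / nn j)) = 6 * C := by field_simp
  linarith

end chains

section key
variable {p : ℝ} [hp : Fact (1 < p)]

theorem norm_sum_sub_le (T : Y p →L[ℝ] Y p) (J : Finset ℕ) (x y : ℕ → V) {ε : ℝ}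
    (h : ∀ i ∈ J, ‖T (emb p (x i)) - emb p (y i)‖ ≤ ε) :
    ‖T (emb p (∑ i ∈ J, x i)) - emb p (∑ i ∈ J, y i)‖ ≤ J.card * ε := by
  rw [map_sum, map_sum, map_sum, ← Finset.sum_sub_distrib]
  refine (norm_sum_le_of_le _ h).trans ?_
  rw [Finset.sum_const, nsmul_eq_mul]

/-- The configurations excluded for bounded operators. -/
def BadFor (T : Y p →L[ℝ] Y p) (κ : ℕ∞) (C δ : ℝ) (M : ℕ) (ε : ℝ) (x y : V) (f : ℕ →₀ ℚ) : Prop :=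
  RIS p M C x ∧ (∀ n, y n ≠ 0 → M ≤ n) ∧ ‖T (emb p x) - emb p y‖ ≤ ε ∧
    (∀ k, f k ≠ 0 → M ≤ k ∧ okcol κ (some M) (col p k)) ∧
    (∃ q, InB p (en p) q fun k => (f k : ℝ)) ∧ |ev (fun k => (f k : ℝ)) x| ≤ ε ∧
    δ ≤ ev (fun k => (f k : ℝ)) y

variable {T : Y p →L[ℝ] Y p} {κ : ℕ∞} {C δ : ℝ}

theorem exists_max_supp (x y : V) : ∃ q, ∀ n, (x n ≠ 0 ∨ y n ≠ 0) → n < q := by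
  obtain ⟨q, hq⟩ := exists_supp x
  obtain ⟨q', hq'⟩ := exists_supp y
  refine ⟨q + q', fun n hn => ?_⟩
  by_contra h
  rcases hn with hn | hn
  · exact hn (hq n (by omega))
  · exact hn (hq' n (by omega))

/-- Exact pairs. -/
structure Pair (T : Y p →L[ℝ] Y p) (κ : ℕ∞) (C δ : ℝ) (M : ℕ) (ε : ℝ) (j : ℕ) (z y : V) (η : ℕ) :
    Prop where
  supp_z : ∀ n, z n ≠ 0 → M ≤ n
  supp_y : ∀ n, y n ≠ 0 → M ≤ n
  supp_e : ∀ k, en p η k ≠ 0 → M ≤ k ∧ okcol κ (some M) (col p k)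
  wt_eq : wt p η = j
  bd : Bd p (3 * C) z
  low : ∀ γ, 1 ≤ wt p γ → wt p γ < j → |ev (en p γ) z| ≤ 3 * C * bt (wt p γ)
  high : ∀ γ, j < wt p γ → |ev (en p γ) z| ≤ 2 * C * bt j
  coord : ∀ n, |z n| ≤ 3 * C * bt j
  ev_z : |ev (en p η) z| ≤ ε
  ev_y : δ ≤ ev (en p η) y
  near : ‖T (emb p z) - emb p y‖ ≤ ε

theorem exists_pair (hC : 0 ≤ C) (H : ∀ M ε, 0 < ε → ∃ x y f, BadFor T κ C δ M ε x y f)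
    (M0 : ℕ) {ε : ℝ} (hε : 0 < ε) {j : ℕ} (hj : 1 ≤ j) (hev : Even j) :
    ∃ z y η, Pair T κ C δ M0 ε j z y η := by
  have hm : (0 : ℝ) < mm j := by exact_mod_cast mm_pos j
  have hm1 : (1 : ℝ) ≤ mm j := by exact_mod_cast mm_pos j
  have hn : (0 : ℝ) < nn j := by exact_mod_cast nn_pos j
  obtain ⟨a, ξ, b, hch⟩ := exists_chain (p := p) (α := V × V) j κ
    (fun prev a ξ b => RIS p (Mof M0 prev) C a.1 ∧ (∀ n, a.2 n ≠ 0 → Mof M0 prev ≤ n) ∧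
      ‖T (emb p a.1) - emb p a.2‖ ≤ ε / mm j ∧
      (∀ k, b k ≠ 0 → Mof M0 prev ≤ k ∧ okcol κ (some (Mof M0 prev)) (col p k)) ∧
      |ev b a.1| ≤ ε / mm j ∧ δ ≤ ev b a.2 ∧ (∀ n, (a.1 n ≠ 0 ∨ a.2 n ≠ 0) → n < ξ) ∧
      Mof M0 prev ≤ ξ) (by
    intro prev hprev
    obtain ⟨x, y, f, h1, h2, h3, h4, h5, h6, h7⟩ := H (Mof M0 prev) (ε / mm j) (by positivity)
    obtain ⟨q, hq⟩ := exists_max_supp x y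
    obtain ⟨n, hnL, hB, hw, hc⟩ := exists_node_inl p j κ prev f (q + Mof M0 prev) hj hev hprev
      (fun k hk => ⟨fun ξ hξ => by
        have := (h4 k hk).1
        have := lt_Mof M0 hξ
        omega, (h4 k hk).2.of_some fun ξ hξ => by
        have := lt_Mof M0 hξ
        omega⟩) h5
    refine ⟨(x, y), n, _, hB, hw, hc, h1, h2, h3, fun k hk => ?_, h6, h7, fun m hm => ?_, ?_⟩
    · exact h4 k fun h => hk (by simp [h])
    · exact lt_of_lt_of_le (hq m hm) (by omega)
    · omega)
  have hC2 : Chain p (nn j) j κ ξ b :=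
    ⟨fun r hr => (hch r hr).1, fun r hr => (hch r hr).2.1, fun r hr => (hch r hr).2.2.1⟩
  have hQ := fun r hr => (hch r hr).2.2.2
  have hbx : ∀ i < nn j, Between ξ i (a i).1 := fun i hi n hn =>
    ⟨fun c hc => by
      have := (hQ i hi).1.supp n hn
      have := lt_Mof M0 hc
      omega, (hQ i hi).2.2.2.2.2.2.1 n (Or.inl hn)⟩
  have hby : ∀ i < nn j, Between ξ i (a i).2 := fun i hi n hn =>
    ⟨fun c hc => by
      have := (hQ i hi).2.1 n hn
      have := lt_Mof M0 hc
      omega, (hQ i hi).2.2.2.2.2.2.1 n (Or.inr hn)⟩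
  have hR : RISseq p (nn j) C (fun i => (a i).1) (fun i => Mof M0 (pr ξ i)) ξ
      (fun i => Mof M0 (pr ξ i)) := by
    refine ⟨fun i hi n hn => ⟨(hQ i hi).1.supp n hn, (hbx i hi n hn).2⟩, fun i hi => (hQ i hi).1.bd,
      fun i hi => (hQ i hi).1.wtb, fun i hi => (hQ i hi).2.2.2.2.2.2.2, fun i i' h h' =>
      hC2.Mof_le M0 h h', fun i i' h h' => ?_⟩
    have := hC2.Mof_le M0 h h'
    omega
  obtain ⟨s1, s2, s3, s4⟩ := hR.avg_spec hp.out hj hC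
  have hJ : ∀ i ∈ Finset.range (nn j), i < nn j := fun i h => Finset.mem_range.1 h
  have hlast : nn j - 1 < nn j := by have := nn_pos j; omega
  have hev : ∀ w : ℕ → V, (∀ i < nn j, Between ξ i (w i)) → ev (en p (ξ (nn j - 1))) (avg j w) =
      1 / (nn j : ℝ) * ∑ i ∈ Finset.range (nn j), ev (b i) (w i) := fun w hw => by
    rw [avg, map_smul, hC2.ev_sum hw hJ hlast, smul_eq_mul]
    have : ∀ i ∈ Finset.range (nn j), (if i ≤ nn j - 1 then bt j * ev (b i) (w i) else 0) =
        bt j * ev (b i) (w i) := fun i hi => if_pos (by have := hJ i hi; omega)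
    rw [Finset.sum_congr rfl this, ← Finset.mul_sum, bt]
    field_simp
  have hsuppavg : ∀ w : ℕ → V, (∀ i < nn j, ∀ n, w i n ≠ 0 → M0 ≤ n) → ∀ n, avg j w n ≠ 0 → M0 ≤ n := by
    intro w hw n hn
    by_contra hlt
    apply hn
    rw [avg, Finsupp.smul_apply, Finsupp.finsetSum_apply, Finset.sum_eq_zero, smul_zero]
    intro i hi
    by_contra hne
    exact hlt (hw i (hJ i hi) n hne)
  refine ⟨avg j fun i => (a i).1, avg j fun i => (a i).2, ξ (nn j - 1), ?_, ?_, ?_, ?_, s1, s2, s3,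
    s4, ?_, ?_, ?_⟩
  · exact hsuppavg _ fun i hi n hn => (le_Mof _ _).trans ((hQ i hi).1.supp n hn)
  · exact hsuppavg _ fun i hi n hn => (le_Mof _ _).trans ((hQ i hi).2.1 n hn)
  · refine hC2.supp (fun k => M0 ≤ k ∧ okcol κ (some M0) (col p k)) ?_ ?_ _ hlast
    · exact fun r hr => ⟨(le_Mof _ _).trans (hQ r hr).2.2.2.2.2.2.2, Or.inl (hC2.col_eq r hr)⟩
    · intro r hr k hk
      have := (hQ r hr).2.2.2.1 k hk
      refine ⟨(le_Mof _ _).trans this.1, this.2.of_some fun ξ hξ => ?_⟩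
      cases hξ; exact le_Mof _ _
  · exact hC2.wt_eq _ hlast
  · rw [hev _ hbx, abs_mul, abs_of_pos (by positivity)]
    have h1 : |∑ i ∈ Finset.range (nn j), ev (b i) (a i).1| ≤ nn j * ε := by
      refine (Finset.abs_sum_le_sum_abs _ _).trans ((Finset.sum_le_sum (g := fun _ => ε)
        fun i hi => ?_).trans (by simp))
      exact (hQ i (hJ i hi)).2.2.2.2.1.trans (div_le_self hε.le hm1)
    calc _ ≤ 1 / (nn j : ℝ) * (nn j * ε) := mul_le_mul_of_nonneg_left h1 (by positivity)
      _ = ε := by field_simp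
  · rw [hev _ hby]
    have h1 : nn j * δ ≤ ∑ i ∈ Finset.range (nn j), ev (b i) (a i).2 := by
      refine le_trans (by simp) (Finset.sum_le_sum (f := fun _ => δ) fun i hi => ?_)
      exact (hQ i (hJ i hi)).2.2.2.2.2.1
    calc δ = 1 / (nn j : ℝ) * (nn j * δ) := by field_simp
      _ ≤ _ := mul_le_mul_of_nonneg_left h1 (by positivity)
  · have h1 := norm_sum_sub_le T (Finset.range (nn j)) (fun i => (a i).1) (fun i => (a i).2)
      fun i hi => (hQ i (hJ i hi)).2.2.1
    rw [Finset.card_range] at h1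
    rw [avg, avg, map_smul, map_smul, map_smul, ← smul_sub, norm_smul, Real.norm_eq_abs,
      abs_of_pos (by positivity)]
    calc _ ≤ (mm j : ℝ) / nn j * (nn j * (ε / mm j)) := mul_le_mul_of_nonneg_left h1 (by positivity)
      _ = ε := by field_simp

theorem even_sig (j : ℕ) (prev : Option ℕ) : Even (sig j prev) := by
  cases prev with
  | none => exact ⟨2 * j + 1, by simp only [sig]; ring⟩
  | some ξ => exact ⟨2 * ξ + 2, by simp only [sig]; ring⟩

theorem key_bound (hC : 0 ≤ C) (H : ∀ M ε, 0 < ε → ∃ x y f, BadFor T κ C δ M ε x y f)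
    {j : ℕ} (hodd : Odd j) : δ * mm j ≤ 3 * (1 + 12 * C) * ‖T‖ + 1 := by
  have hj : 1 ≤ j := hodd.pos
  have hm : (0 : ℝ) < mm j := by exact_mod_cast mm_pos j
  have hn : (0 : ℝ) < nn j := by exact_mod_cast nn_pos j
  set ε : ℝ := min (1 / nn j) (1 / (mm j : ℝ) ^ 2) with hε
  have hε0 : 0 < ε := by positivity
  obtain ⟨a, ξ, b, hch⟩ := exists_chain (p := p) (α := V × V × ℕ) j κ
    (fun prev a ξ b => Pair T κ C δ (Mof 0 prev) ε (sig j prev) a.1 a.2.1 a.2.2 ∧ b = en p a.2.2 ∧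
      (∀ n, (a.1 n ≠ 0 ∨ a.2.1 n ≠ 0) → n < ξ) ∧ Mof 0 prev ≤ ξ) (by
    intro prev hprev
    have hs := lt_sig (p := p) (prev := prev) (j := j) fun ξ hξ => (hprev ξ hξ).1
    obtain ⟨z, y, η, hP⟩ := exists_pair hC H (Mof 0 prev) hε0 (by omega) (even_sig j prev)
    obtain ⟨q, hq⟩ := exists_max_supp z y
    obtain ⟨n, hnL, hB, hw, hc⟩ := exists_node_inr p j κ prev η (q + Mof 0 prev) hj hodd hprev
      hP.wt_eq (fun k hk => ⟨fun ξ hξ => by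
        have := (hP.supp_e k hk).1
        have := lt_Mof 0 hξ
        omega, (hP.supp_e k hk).2.of_some fun ξ hξ => by
        have := lt_Mof 0 hξ
        omega⟩)
    refine ⟨(z, y, η), n, _, hB, hw, hc, hP, rfl, fun m hm => ?_, ?_⟩
    · exact lt_of_lt_of_le (hq m hm) (by omega)
    · omega)
  have hC2 : Chain p (nn j) j κ ξ b :=
    ⟨fun r hr => (hch r hr).1, fun r hr => (hch r hr).2.1, fun r hr => (hch r hr).2.2.1⟩
  have hQ := fun r hr => (hch r hr).2.2.2
  have hbx : ∀ i < nn j, Between ξ i (a i).1 := fun i hi n hn =>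
    ⟨fun c hc => by
      have := (hQ i hi).1.supp_z n hn
      have := lt_Mof 0 hc
      omega, (hQ i hi).2.2.1 n (Or.inl hn)⟩
  have hby : ∀ i < nn j, Between ξ i (a i).2.1 := fun i hi n hn =>
    ⟨fun c hc => by
      have := (hQ i hi).1.supp_y n hn
      have := lt_Mof 0 hc
      omega, (hQ i hi).2.2.1 n (Or.inr hn)⟩
  have hR : RISseq p (nn j) (3 * C) (fun i => (a i).1) (fun i => Mof 0 (pr ξ i)) ξ
      (fun i => sig j (pr ξ i)) := by
    refine ⟨fun i hi n hn => ⟨(hQ i hi).1.supp_z n hn, (hbx i hi n hn).2⟩,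
      fun i hi => (hQ i hi).1.bd, fun i hi => (hQ i hi).1.low, fun i hi => (hQ i hi).2.2.2,
      fun i i' h h' => hC2.Mof_le 0 h h', fun i i' h h' => ?_⟩
    have h3 := hC2.Mof_le 0 h h'
    obtain ⟨k, rfl⟩ : ∃ k, i' = k + 1 := ⟨i' - 1, by omega⟩
    simp only [pr, Mof] at h3
    simp only [pr, sig]
    omega
  obtain ⟨j', rfl⟩ : ∃ k, j = k + 1 := ⟨j - 1, by omega⟩
  have hJ : ∀ i ∈ Finset.range (nn (j' + 1)), i < nn (j' + 1) := fun i h => Finset.mem_range.1 h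
  have hbound : ∀ γ, j' + 1 ≤ wt p γ → ∀ J : Finset ℕ, (∀ i ∈ J, i < nn (j' + 1)) →
      |ev (en p γ) (∑ i ∈ J, (a i).1)| ≤ 3 * (1 + 12 * C) / 3 * (J.card * bt (j' + 1) ^ 2 + 1) := by
    intro γ hγ J hJ'
    have hJ0 : (0 : ℝ) ≤ J.card * bt (j' + 1) ^ 2 := by positivity
    rcases hγ.eq_or_lt with h | h
    · have := odd_chain_bound hC hodd hC2 hbx hR (fun i hi => (hQ i hi).1.high)
        (fun i hi => (hQ i hi).1.coord) (fun i hi => by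
          rw [(hQ i hi).2.1]
          exact (hQ i hi).1.ev_z.trans (min_le_left _ _)) hJ' γ h.symm
      nlinarith
    · refine (hR.big (by positivity) hJ' (by omega)).trans ?_
      have h1 : (J.card : ℝ) * bt (wt p γ) ≤ J.card * bt (j' + 1) ^ 2 :=
        mul_le_mul_of_nonneg_left (bt_le_inv_sq hj h) (by positivity)
      nlinarith
  have hβ1 : bt (j' + 1) ^ 2 ≤ 1 := pow_le_one₀ (bt_pos _).le (bt_le_one _)
  have hfin := hR.bd_final hp.out (by positivity) (by linarith) (by positivity) hβ1 hbound hJ (by simp)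
  have hnear := norm_sum_sub_le T (Finset.range (nn (j' + 1))) (fun i => (a i).1) (fun i => (a i).2.1)
      fun i hi => (hQ i (hJ i hi)).1.near
  rw [Finset.card_range] at hnear
  have hlast : nn (j' + 1) - 1 < nn (j' + 1) := by have := nn_pos (j' + 1); omega
  have hevy := hC2.ev_sum hby hJ hlast
  have hlow : nn (j' + 1) * (bt (j' + 1) * δ) ≤
      ev (en p (ξ (nn (j' + 1) - 1))) (∑ i ∈ Finset.range (nn (j' + 1)), (a i).2.1) := by
    rw [hevy]
    refine le_trans (by simp) (Finset.sum_le_sum (f := fun _ => bt (j' + 1) * δ) fun i hi => ?_)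
    rw [if_pos (by have := hJ i hi; omega), (hQ i (hJ i hi)).2.1]
    exact mul_le_mul_of_nonneg_left (hQ i (hJ i hi)).1.ev_y (bt_pos _).le
  have hup := (le_abs_self _).trans (abs_ev_en_le hp.out
    (∑ i ∈ Finset.range (nn (j' + 1)), (a i).2.1) (ξ (nn (j' + 1) - 1)))
  rw [← norm_emb] at hup
  have hz := (nrm_le_iff hp.out).2 hfin
  rw [← norm_emb] at hz
  have hT := T.le_opNorm (emb p (∑ i ∈ Finset.range (nn (j' + 1)), (a i).1))
  have hT2 := mul_le_mul_of_nonneg_left hz (norm_nonneg T)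
  have htri : ‖emb p (∑ i ∈ Finset.range (nn (j' + 1)), (a i).2.1)‖ ≤
      ‖T (emb p (∑ i ∈ Finset.range (nn (j' + 1)), (a i).1))‖ +
      ‖T (emb p (∑ i ∈ Finset.range (nn (j' + 1)), (a i).1)) -
        emb p (∑ i ∈ Finset.range (nn (j' + 1)), (a i).2.1)‖ := by
    have := norm_sub_norm_le (emb p (∑ i ∈ Finset.range (nn (j' + 1)), (a i).2.1))
      (T (emb p (∑ i ∈ Finset.range (nn (j' + 1)), (a i).1)))
    rw [norm_sub_rev] at this
    linarith
  have hεm : nn (j' + 1) * ε ≤ nn (j' + 1) * (1 / (mm (j' + 1) : ℝ) ^ 2) :=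
    mul_le_mul_of_nonneg_left (min_le_right _ _) hn.le
  have hb : bt (j' + 1) = 1 / (mm (j' + 1) : ℝ) := rfl
  have hall : (nn (j' + 1) : ℝ) * (bt (j' + 1) * δ) ≤
      ‖T‖ * (3 * (1 + 12 * C) / 3 * nn (j' + 1) * (bt (j' + 1) ^ 2 + 2 / (mm (j' + 1) : ℝ) ^ 2)) +
      nn (j' + 1) * (1 / (mm (j' + 1) : ℝ) ^ 2) := by linarith only [hlow, hup, htri, hT, hT2, hnear, hεm]
  rw [hb] at hall
  have e1 : (nn (j' + 1) : ℝ) * (1 / mm (j' + 1) * δ) =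
      nn (j' + 1) / (mm (j' + 1) : ℝ) ^ 2 * (δ * mm (j' + 1)) := by field_simp
  have e2 : ‖T‖ * (3 * (1 + 12 * C) / 3 * nn (j' + 1) * ((1 / (mm (j' + 1) : ℝ)) ^ 2 + 2 / (mm (j' + 1) : ℝ) ^ 2)) +
      nn (j' + 1) * (1 / (mm (j' + 1) : ℝ) ^ 2) =
      nn (j' + 1) / (mm (j' + 1) : ℝ) ^ 2 * (3 * (1 + 12 * C) * ‖T‖ + 1) := by field_simp; ring
  rw [e1, e2] at hall
  exact le_of_mul_le_mul_left hall (by positivity)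

theorem not_bad (hC : 0 ≤ C) (hδ : 0 < δ) :
    ∃ M ε, 0 < ε ∧ ∀ x y f, ¬ BadFor T κ C δ M ε x y f := by
  by_contra H
  push Not at H
  obtain ⟨k, hk⟩ := exists_nat_gt ((3 * (1 + 12 * C) * ‖T‖ + 1) / δ)
  have h1 := key_bound hC H (show Odd (2 * k + 1) from ⟨k, rfl⟩)
  have h2 : (k : ℝ) ≤ mm (2 * k + 1) := by
    exact_mod_cast (show k ≤ 2 * k + 1 by omega).trans (le_mm _)
  rw [div_lt_iff₀ hδ] at hk
  nlinarith

end key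

section vectors
variable {p : ℝ}

theorem abs_ev_le_of_level_eq_zero {x : V} {q h : ℕ} {t : ℝ} (hh : 1 ≤ h) (hx : ∀ n, x n ≠ 0 → n < q)
    (hb : Bd p t x) (h0 : ∀ γ < q, wt p γ = h → ev (en p γ) x = 0) :
    ∀ γ, wt p γ = h → |ev (en p γ) x| ≤ t * bt h := by
  have hp0 : 0 ≤ t := (abs_nonneg _).trans (hb.1 0)
  intro γ
  induction γ using Nat.strong_induction_on with
  | _ γ ih =>
    intro hγ
    by_cases hq : γ < q
    · rw [h0 γ hq hγ, abs_zero]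
      exact mul_nonneg hp0 (bt_pos _).le
    obtain ⟨prev, b, hB⟩ := exists_built p (n := γ) (by omega)
    rw [hB.ev_eq, hγ]
    have h1 : x γ = 0 := by
      by_contra hne
      exact hq (hx γ hne)
    have h2 : |bt h * ev b x| ≤ t * bt h := by
      rw [abs_mul, abs_of_pos (bt_pos h), mul_comm]
      exact mul_le_mul_of_nonneg_right (hB.inB.le hb) (bt_pos h).le
    rw [h1, zero_add]
    cases prev with
    | none => simpa [enp] using h2
    | some ξ =>
      have hξ := hB.prev_spec ξ rfl
      simp only [enp]
      by_cases hξq : ξ < q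
      · rw [h0 ξ hξq (by rw [hξ.2.1, hγ]), zero_add]
        exact h2
      · have : ev b x = 0 := ev_eq_zero fun k hk => by
          by_contra hne
          have := hx k hne
          have := (hB.supp k hk).2.1 ξ rfl
          omega
        rw [this, mul_zero, add_zero]
        exact ih ξ hξ.1 (by rw [hξ.2.1, hγ])

noncomputable def dd (n : ℕ) : V := Finsupp.single n 1

theorem dd_apply (n m : ℕ) : dd n m = if n = m then 1 else 0 := Finsupp.single_apply

theorem ev_dd (f : ℕ → ℝ) (n : ℕ) : ev f (dd n) = f n := by simp [dd]

theorem Bd_dd (hp : 1 < p) (n : ℕ) : Bd p 4 (dd n) := by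
  have h := Bd_tr (p := p) hp (q := n + 1) (t := 2) (x := dd n) (fun η hη => ?_)
    (by simpa [dd] using WB_single hp n 1)
  · rw [tr_eq_self fun m hm => by rw [dd_apply, if_neg (by omega)]] at h
    exact h.mono (by norm_num)
  · rw [ev_dd]
    rcases (Nat.lt_succ_iff.1 hη).eq_or_lt with rfl | hlt
    · rw [en_self]; norm_num
    · by_cases h0 : en p η n = 0
      · simp [h0]
      · exact absurd (en_supp p η n h0) (by omega)

theorem RIS_dd (hp : 1 < p) {n M : ℕ} (hn : wt p n = 0) (hM : M ≤ n) : RIS p M 4 (dd n) := by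
  have hs : ∀ m, dd n m ≠ 0 → m = n := fun m hm => by
    by_contra hne
    exact hm (by rw [dd_apply, if_neg (Ne.symm hne)])
  refine ⟨fun m hm => (hs m hm).symm ▸ hM, Bd_dd hp n, fun γ h1 _ => ?_⟩
  refine abs_ev_le_of_level_eq_zero (q := n + 1) h1 (fun m hm => by rw [hs m hm]; omega) (Bd_dd hp n)
    (fun η hη hw => ?_) γ rfl
  rw [ev_dd]
  by_contra h0
  have h2 := en_supp p η n h0
  have h3 : η = n := by omega
  subst h3
  omega

theorem RIS.mono {M M' : ℕ} {C C' : ℝ} {x : V} (h : RIS p M C x) (hM : M' ≤ M) (hC : C ≤ C') :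
    RIS p M' C' x :=
  ⟨fun n hn => hM.trans (h.supp n hn), h.bd.mono hC, fun γ h1 h2 =>
    (h.wtb γ h1 (by omega)).trans (mul_le_mul_of_nonneg_right hC (bt_pos _).le)⟩

theorem RIS.add (hp : 1 < p) {M : ℕ} {C C' : ℝ} {x x' : V} (h : RIS p M C x) (h' : RIS p M C' x') :
    RIS p M (C + C') (x + x') := by
  refine ⟨fun n hn => ?_, h.bd.add hp h'.bd, fun γ h1 h2 => ?_⟩
  · by_contra hlt
    apply hn
    rw [Finsupp.add_apply]
    have e1 : x n = 0 := by
      by_contra hne; exact hlt (h.supp n hne)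
    have e2 : x' n = 0 := by
      by_contra hne; exact hlt (h'.supp n hne)
    rw [e1, e2, add_zero]
  · rw [map_add, add_mul]
    exact (abs_add_le _ _).trans (add_le_add (h.wtb γ h1 h2) (h'.wtb γ h1 h2))

theorem RIS.smul (hp : 1 < p) (a : ℝ) {M : ℕ} {C : ℝ} {x : V} (h : RIS p M C x) :
    RIS p M (|a| * C) (a • x) := by
  refine ⟨fun n hn => h.supp n fun h0 => hn (by simp [h0]), h.bd.smul hp a, fun γ h1 h2 => ?_⟩
  rw [map_smul, smul_eq_mul, abs_mul, mul_assoc]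
  exact mul_le_mul_of_nonneg_left (h.wtb γ h1 h2) (abs_nonneg _)

theorem Bd_of_supp (hp : 1 < p) {q : ℕ} {t : ℝ} {x : V} (hq : ∀ n, q ≤ n → x n = 0)
    (h : ∀ η < q, |ev (en p η) x| ≤ t) (hw : WB p t x) : Bd p (2 * t) x := by
  have := Bd_tr hp h hw
  rwa [tr_eq_self hq] at this

theorem exists_ev_eq (u : ℕ → ℝ) {M : ℕ} (hu : ∀ n < M, u n = 0) (q : ℕ) :
    ∃ x : V, (∀ n, q ≤ n → x n = 0) ∧ (∀ n < M, x n = 0) ∧ ∀ γ < q, ev (en p γ) x = u γ := by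
  induction q with
  | zero => exact ⟨0, by simp⟩
  | succ q ih =>
    obtain ⟨x, h1, h2, h3⟩ := ih
    refine ⟨x + (u q - ev (en p q) x) • dd q, fun n hn => ?_, fun n hn => ?_, fun γ hγ => ?_⟩
    · rw [Finsupp.add_apply, Finsupp.smul_apply, dd_apply, if_neg (by omega), h1 n (by omega)]
      simp
    · rw [Finsupp.add_apply, Finsupp.smul_apply, dd_apply, h2 n hn]
      split_ifs with hqn
      · subst hqn
        rw [hu q hn, ev_eq_zero fun k hk => h2 k ((en_supp p q k hk).trans_lt hn)]
        simp
      · simp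
    · rw [map_add, map_smul, ev_dd]
      rcases (Nat.lt_succ_iff.1 hγ).eq_or_lt with rfl | hlt
      · rw [en_self]; simp
      · have : en p γ q = 0 := by
          by_contra h0
          exact absurd (en_supp p γ q h0) (by omega)
        rw [this, h3 γ hlt]; simp

theorem WB_congr {t : ℝ} {x y : V} (h : ∀ n, wt p n = 0 → x n = y n) (hx : WB p t x) : WB p t y := by
  intro N
  have : blk N y = blk N x := by
    ext k
    unfold blk
    split_ifs with hk
    · exact (h _ (nu_spec p hk).1).symm
    · rfl
  rw [this]
  exact hx N

theorem WB_zero (hp : 1 < p) : WB p 0 0 := by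
  simpa using WB_single hp 0 0

/-- A vector supported far out is the sum of two vectors with good estimates on the nodes of
small weight. -/
theorem exists_split (hp : 1 < p) {x : V} {M : ℕ} (hM : ∀ n, x n ≠ 0 → M ≤ n) (hx : Bd p 1 x) (w : ℕ) :
    ∃ y, RIS p (min M (w + 1)) 2 y ∧ RIS p M (2 * mm w) (x - y) := by
  classical
  obtain ⟨q, hq⟩ := exists_supp x
  have hx0 : ∀ n < M, x n = 0 := fun n hn => by
    by_contra hne
    have := hM n hne
    omega
  have hxe : ∀ n < M, ev (en p n) x = 0 := fun n hn =>
    ev_eq_zero fun k hk => hx0 k ((en_supp p n k hk).trans_lt hn)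
  obtain ⟨y, hy1, hy2, hy3⟩ := exists_ev_eq (p := p)
    (fun n => if wt p n = 0 ∨ w < wt p n then ev (en p n) x else 0)
    (M := M) (fun n hn => by simp only [hxe n hn, ite_self]) q
  have hz1 : ∀ n, q ≤ n → (x - y) n = 0 := fun n hn => by
    rw [Finsupp.sub_apply, hq n hn, hy1 n hn, sub_zero]
  have hz3 : ∀ γ < q, ev (en p γ) (x - y) =
      if wt p γ = 0 ∨ w < wt p γ then 0 else ev (en p γ) x := fun γ hγ => by
    rw [map_sub, hy3 γ hγ]
    split_ifs <;> simp
  have hxy : ∀ n, wt p n = 0 → x n = y n := fun n hn => by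
    by_cases hnq : n < q
    · have := hy3 n hnq
      rw [if_pos (Or.inl hn), en_of_wt_zero p hn, ev_pi_single, ev_pi_single] at this
      exact this.symm
    · rw [hq n (by omega), hy1 n (by omega)]
  have hyB : Bd p 2 y := by
    have := Bd_of_supp hp hy1 (t := 1) (fun η hη => ?_) (WB_congr hxy hx.2)
    · simpa using this
    · rw [hy3 η hη]
      split_ifs
      · exact hx.1 η
      · simp
  have hzB : Bd p 2 (x - y) := by
    have := Bd_of_supp hp hz1 (t := 1) (fun η hη => ?_) (WB_congr (x := 0) (fun n hn => ?_)
      ((WB_zero hp).mono zero_le_one))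
    · simpa using this
    · rw [hz3 η hη]
      split_ifs
      · simp
      · exact hx.1 η
    · rw [Finsupp.sub_apply, hxy n hn, sub_self]; rfl
  have hyq : ∀ n, y n ≠ 0 → n < q := fun n hn => by
    by_contra h; exact hn (hy1 n (by omega))
  have hzq : ∀ n, (x - y) n ≠ 0 → n < q := fun n hn => by
    by_contra h; exact hn (hz1 n (by omega))
  have hm1 : (1 : ℝ) ≤ mm w := by exact_mod_cast mm_pos w
  refine ⟨y, ⟨fun n hn => ?_, hyB, fun γ h1 h2 => ?_⟩, ⟨fun n hn => ?_, hzB.mono (by linarith),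
    fun γ h1 _ => ?_⟩⟩
  · refine (min_le_left _ _).trans ?_
    by_contra h; exact hn (hy2 n (by omega))
  · refine abs_ev_le_of_level_eq_zero h1 hyq hyB (fun η hη hw => ?_) γ rfl
    rw [hy3 η hη, if_neg]
    have := lt_of_lt_of_le h2 (min_le_right _ _)
    omega
  · by_contra h
    exact hn (by rw [Finsupp.sub_apply, hx0 n (by omega), hy2 n (by omega), sub_zero])
  · by_cases hγw : w < wt p γ
    · refine (abs_ev_le_of_level_eq_zero h1 hzq hzB (fun η hη hw => ?_) γ rfl).trans ?_
      · rw [hz3 η hη, if_pos (Or.inr (by omega))]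
      · have := bt_pos (wt p γ)
        nlinarith
    · refine (hzB.1 γ).trans ?_
      have h3 : 1 ≤ mm w * bt (wt p γ) := by
        have h4 : bt w ≤ bt (wt p γ) := bt_anti (by omega)
        have h5 : (mm w : ℝ) * bt w = 1 := by unfold bt; field_simp
        nlinarith
      linarith

variable (p) in
/-- The filter of vectors with good estimates, supported far out. -/
noncomputable def risF (C : ℝ) : Filter V := ⨅ M, 𝓟 {x | RIS p M C x}

theorem eventually_risF {C : ℝ} {P : V → Prop} :
    (∀ᶠ x in risF p C, P x) ↔ ∃ M, ∀ x, RIS p M C x → P x := by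
  have h := Filter.hasBasis_iInf_principal (s := fun M => {x | RIS p M C x})
    (directed_of_isDirected_le fun M M' hM x hx => RIS.mono hx hM le_rfl)
  rw [risF, h.eventually_iff]
  simp

theorem exists_RISseq {C : ℝ} {Q : V → Prop} (h : ∀ M, ∃ x, RIS p M C x ∧ Q x) :
    ∃ (x : ℕ → V), (∀ i, Q (x i)) ∧ ∀ L, ∃ lo hi jj, RISseq p L C x lo hi jj := by
  choose X hX hQ using h
  have hb : ∀ x : V, ∃ q, ∀ n, x n ≠ 0 → n < q := fun x => by
    obtain ⟨q, hq⟩ := exists_supp x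
    exact ⟨q, fun n hn => by by_contra hlt; exact hn (hq n (by omega))⟩
  choose q hq using hb
  let S : ℕ → ℕ := fun i => Nat.rec 0 (fun _ m => 3 * (m + q (X m))) i
  have hS : ∀ i, S (i + 1) = 3 * (S i + q (X (S i))) := fun _ => rfl
  have hmono : ∀ i i', i < i' → 3 * (S i + q (X (S i))) ≤ S i' := fun i i' hii => by
    induction i', hii using Nat.le_induction with
    | base => exact (hS i).ge
    | succ k _ ih => have := hS k; omega
  refine ⟨fun i => X (S i), fun i => hQ _, fun L => ⟨S, fun i => S i + q (X (S i)), S, ?_⟩⟩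
  exact ⟨fun i _ n hn => ⟨(hX _).supp n hn, (hq _ n hn).trans_le (by omega)⟩, fun i _ => (hX _).bd,
    fun i _ => (hX _).wtb, fun i _ => by omega, fun i i' h _ => hmono i i' h,
    fun i i' h _ => by have := hmono i i' h; omega⟩

end vectors

section colours
variable {p : ℝ}

theorem Bd_of_col (hp : 1 < p) {y : V} {M : ℕ} {A : ℝ}
    (hy : ∀ n, y n ≠ 0 → M ≤ n ∧ col p n ≠ ⊤ ∧ col p n ≤ M)
    (hA : ∀ γ, col p γ ≠ ⊤ → |ev (en p γ) y| ≤ A) (hw : WB p A y) : Bd p A y := by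
  have hA0 := hw.nonneg hp
  refine ⟨fun γ => ?_, hw⟩
  induction γ using Nat.strong_induction_on with
  | _ γ ih =>
    by_cases hγ : col p γ = ⊤
    swap
    · exact hA γ hγ
    have hyγ : y γ = 0 := by
      by_contra hne
      exact (hy γ hne).2.1 hγ
    rcases built_or p γ with ⟨prev, b, hB⟩ | h
    swap
    · rw [h.2.1, ev_pi_single, hyγ, abs_zero]; exact hA0
    rw [hB.ev_eq, hyγ, zero_add]
    have h2 : |bt (wt p γ) * ev b y| ≤ A := by
      rw [abs_mul, abs_of_pos (bt_pos _)]
      exact (mul_le_of_le_one_left (abs_nonneg _) (bt_le_one _)).trans (hB.inB y A ih hw)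
    cases prev with
    | none => simpa [enp] using h2
    | some ξ =>
      simp only [enp]
      by_cases hξ : ξ < M
      · rw [ev_eq_zero (f := en p ξ), zero_add]
        · exact h2
        · intro k hk
          by_contra hne
          have := (hy k hne).1
          have := en_supp p ξ k hk
          omega
      · rw [ev_eq_zero (f := b), mul_zero, add_zero]
        · exact ih ξ (hB.prev_spec ξ rfl).1
        · intro k hk
          by_contra hne
          obtain ⟨-, h3, h4⟩ := hy k hne
          rcases (hB.supp k hk).2.2 with h5 | h5
          · rw [hγ] at h5; exact h3 h5
          · have h6 : (ξ : ℕ∞) < M := lt_of_lt_of_le h5.2 h4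
            exact hξ (by exact_mod_cast h6)

/-- The diagonal multiplier acting as `b k` on the coordinates `≥ M` of finite colour `k`. -/
noncomputable def cmul (p : ℝ) (b : ℕ → ℝ) (M : ℕ) : V →ₗ[ℝ] V := by
  classical
  exact dg fun n => if M ≤ n ∧ col p n ≠ ⊤ then b (col p n).toNat else 0

theorem cmul_apply_of_lt {b : ℕ → ℝ} {M n : ℕ} (h : n < M) (x : V) : cmul p b M x n = 0 := by
  simp [cmul, show ¬ M ≤ n by omega]

theorem cmul_apply_of_top {b : ℕ → ℝ} {M n : ℕ} (h : col p n = ⊤) (x : V) : cmul p b M x n = 0 := by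
  simp [cmul, h]

theorem cmul_apply {b : ℕ → ℝ} {M n k : ℕ} (h : M ≤ n) (hk : col p n = k) (x : V) :
    cmul p b M x n = b k * x n := by
  simp [cmul, h, hk]

theorem Bd_cmul (hp : 1 < p) {b : ℕ → ℝ} {M : ℕ} {B s t : ℝ} (hB : ∀ k, |b k| ≤ B) (hs : PV p b s)
    (hM : ∀ k, M < k → b k = 0) {x : V} (hx : Bd p t x) : Bd p (3 * (B + s) * t) (cmul p b M x) := by
  have ht := hx.2.nonneg hp
  have hs0 := hs.nonneg hp
  have hB0 : 0 ≤ B := (abs_nonneg _).trans (hB 0)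
  set x' := x - tr M x with hx'
  have hx'B : Bd p (3 * t) x' := by
    have := hx.add hp ((Bd_tr hp (q := M) (fun η _ => hx.1 η) hx.2).smul hp (-1))
    rw [abs_neg, abs_one] at this
    rw [hx', sub_eq_add_neg, ← neg_one_smul ℝ (tr M x)]
    exact this.mono (by linarith)
  have hx'a : ∀ n, x' n = if n < M then 0 else x n := fun n => by
    rw [hx', Finsupp.sub_apply, tr_apply]; split_ifs <;> simp
  have hcm : ∀ n k : ℕ, col p n = k → cmul p b M x n = b k * x' n := fun n k hk => by
    rw [hx'a]
    split_ifs with h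
    · rw [cmul_apply_of_lt h, mul_zero]
    · rw [cmul_apply (by omega) hk]
  refine Bd_of_col (M := M) hp (fun n hn => ?_) (fun γ hγ => ?_) fun N => ?_
  · refine ⟨?_, fun h => hn (cmul_apply_of_top h x), ?_⟩
    · by_contra h; exact hn (cmul_apply_of_lt (by omega) x)
    · by_contra h
      obtain ⟨k, hk⟩ := ENat.ne_top_iff_exists.1 fun h => hn (cmul_apply_of_top (b := b) (M := M) h x)
      rw [← hk, not_le] at h
      have h' : M < k := by exact_mod_cast h
      exact hn (by rw [hcm n k hk.symm, hM k h', zero_mul])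
  · obtain ⟨k, hk⟩ := ENat.ne_top_iff_exists.1 hγ
    have : ev (en p γ) (cmul p b M x) = b k * ev (en p γ) x' := by
      rw [← ev_smul]
      refine ev_congr _ _ _ _ fun n => ?_
      by_cases h : en p γ n = 0
      · simp [h]
      · rw [hcm n k ((en_col p γ hγ n h).trans hk.symm), Pi.smul_apply, smul_eq_mul]
        ring
    rw [this, abs_mul]
    have h1 := mul_le_mul (hB k) (hx'B.1 γ) (abs_nonneg _) hB0
    nlinarith
  · have h1 : blk N (cmul p b M x) = fun k => b k * blk N x' k := by
      ext k
      unfold blk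
      split_ifs with hk
      · exact hcm _ k (nu_spec p hk).2.2
      · simp
    rw [h1]
    refine PV.mono (PV.mul hp hs (hx'B.2 N) hB (C := 3 * t) fun k => ?_) (by linarith)
    unfold blk
    split_ifs
    · rw [hx'a]
      split_ifs
      · simpa using by linarith
      · exact coord_le hp (fun η _ => hx.1 η) hx.2
    · simpa using by linarith

theorem nrm_cmul_le (hp : 1 < p) {b : ℕ → ℝ} {M : ℕ} {B s : ℝ} (hB : ∀ k, |b k| ≤ B) (hs : PV p b s)
    (hM : ∀ k, M < k → b k = 0) (x : V) : nrm p (cmul p b M x) ≤ 3 * (B + s) * nrm p x :=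
  (nrm_le_iff hp).2 (Bd_cmul hp hB hs hM (Bd_nrm hp x))

theorem cmul_dd (b : ℕ → ℝ) (M n : ℕ) : cmul p b M (dd n) = 0 ∨
    ∃ k : ℕ, M ≤ n ∧ col p n = k ∧ cmul p b M (dd n) = b k • dd n := by
  by_cases h1 : M ≤ n
  · by_cases h2 : col p n = ⊤
    · left
      ext m
      by_cases hmn : n = m
      · subst hmn; rw [cmul_apply_of_top h2]; rfl
      · simp [cmul, dd_apply, hmn]
    · right
      obtain ⟨k, hk⟩ := ENat.ne_top_iff_exists.1 h2
      refine ⟨k, h1, hk.symm, ?_⟩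
      ext m
      by_cases hmn : n = m
      · subst hmn; rw [cmul_apply h1 hk.symm]; simp
      · simp [cmul, dd_apply, hmn]
  · left
    ext m
    by_cases hmn : n = m
    · subst hmn; rw [cmul_apply_of_lt (by omega)]; rfl
    · simp [cmul, dd_apply, hmn]

theorem sum_cmul (K M : ℕ) (x : V) : ∑ k ∈ Finset.range (K + 1), cmul p (Pi.single k 1) M x =
    cmul p (fun k => if k ≤ K then 1 else 0) M x := by
  ext n
  rw [Finsupp.finsetSum_apply]
  by_cases h1 : M ≤ n
  · by_cases h2 : col p n = ⊤
    · simp [cmul_apply_of_top h2]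
    · obtain ⟨k, hk⟩ := ENat.ne_top_iff_exists.1 h2
      simp only [cmul_apply h1 hk.symm]
      rw [← Finset.sum_mul]
      congr 1
      simp [Pi.single_apply]
  · simp [cmul_apply_of_lt (show n < M by omega)]

end colours

section operators
variable {p : ℝ} [hp : Fact (1 < p)]

variable (p) in
/-- The biorthogonal functionals. -/
noncomputable def dstar (n : ℕ) : Y p →L[ℝ] ℝ := extOp (Finsupp.lapply n : V →ₗ[ℝ] ℝ)

theorem dstar_emb (n : ℕ) (x : V) : dstar p n (emb p x) = x n :=
  extOp_emb (p := p) (Finsupp.lapply n : V →ₗ[ℝ] ℝ) (C := 3) (fun x => abs_apply_le hp.out x n) x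

theorem norm_dstar_le (n : ℕ) : ‖dstar p n‖ ≤ 3 :=
  norm_le_of_emb _ (by norm_num) fun x => by
    rw [dstar_emb]; exact abs_apply_le hp.out x n

/-- The operator on `Y p` induced by a linear map of finitely supported vectors. -/
noncomputable def indOp (A : V →ₗ[ℝ] V) : Y p →L[ℝ] Y p := extOp ((emb p).comp A)

theorem indOp_emb {A : V →ₗ[ℝ] V} {C : ℝ} (h : ∀ x, nrm p (A x) ≤ C * nrm p x) (x : V) :
    indOp A (emb p x) = emb p (A x) :=
  extOp_emb (p := p) ((emb p).comp A) (C := C)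
    (fun x => by rw [LinearMap.comp_apply, norm_emb]; exact h x) x

theorem norm_indOp_le {A : V →ₗ[ℝ] V} {C : ℝ} (hC : 0 ≤ C) (h : ∀ x, nrm p (A x) ≤ C * nrm p x) :
    ‖indOp (p := p) A‖ ≤ C :=
  norm_le_of_emb _ hC fun x => by rw [indOp_emb h, norm_emb]; exact h x

variable (p) in
noncomputable def proj (M : ℕ) : Y p →L[ℝ] Y p := indOp (tr M)

theorem proj_emb (M : ℕ) (x : V) : proj p M (emb p x) = emb p (tr M x) :=
  indOp_emb (nrm_tr_le hp.out M) x

theorem norm_proj_le (M : ℕ) : ‖proj p M‖ ≤ 2 := norm_indOp_le (by norm_num) (nrm_tr_le hp.out M)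

theorem norm_sub_proj_le (M : ℕ) (y : Y p) : ‖y - proj p M y‖ ≤ 3 * ‖y‖ := by
  have h1 := (proj p M).le_opNorm y
  have h2 := mul_le_mul_of_nonneg_right (norm_proj_le (p := p) M) (norm_nonneg y)
  have := norm_sub_le y (proj p M y)
  linarith

theorem proj_eq_sum (M : ℕ) :
    proj p M = ∑ n ∈ Finset.range M, (dstar p n).smulRight (emb p (dd n)) := by
  refine clm_ext_emb fun x => ?_
  rw [proj_emb, _root_.sum_apply]
  simp only [ContinuousLinearMap.smulRight_apply, dstar_emb, ← map_smul]
  rw [← map_sum]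
  congr 1
  ext m
  rw [tr_apply, Finsupp.finsetSum_apply]
  simp [dd_apply]

theorem norm_emb_dd_le (n : ℕ) : ‖emb p (dd n)‖ ≤ 4 := by
  rw [norm_emb]
  exact (nrm_le_iff hp.out).2 (Bd_dd hp.out n)

theorem proj_of_supp {M : ℕ} {x : V} (h : ∀ n, x n ≠ 0 → M ≤ n) : proj p M (emb p x) = 0 := by
  rw [proj_emb]
  have : tr M x = 0 := by
    ext n
    rw [tr_apply]
    split_ifs with hn
    · by_contra hne
      have := h n hne
      omega
    · rfl
  rw [this, map_zero]

theorem tendsto_dstar (y : Y p) : Tendsto (fun n => dstar p n y) atTop (𝓝 0) := by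
  rw [Metric.tendsto_atTop]
  intro ε hε
  obtain ⟨x, hx⟩ := exists_approx y (ε := ε / 3) (by positivity)
  obtain ⟨q, hq⟩ := exists_supp x
  refine ⟨q, fun n hn => ?_⟩
  have h1 := (dstar p n).le_opNorm (y - emb p x)
  rw [map_sub, dstar_emb, hq n hn, sub_zero] at h1
  have h2 := mul_le_mul_of_nonneg_right (norm_dstar_le (p := p) n) (norm_nonneg (y - emb p x))
  rw [dist_zero_right]
  linarith

theorem tendsto_risF {C : ℝ} (hC : 0 ≤ C) (g : Y p →L[ℝ] ℝ) :
    Tendsto (fun x => g (emb p x)) (risF p C) (𝓝 0) := by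
  rw [Metric.tendsto_nhds]
  intro ε hε
  rw [eventually_risF]
  by_contra hcon
  push Not at hcon
  have h : ∀ M, ∃ x, RIS p M C x ∧ ε ≤ g (emb p x) := fun M => by
    obtain ⟨x, hx, hge⟩ := hcon M
    rw [dist_zero_right, Real.norm_eq_abs, le_abs] at hge
    rcases hge with h | h
    · exact ⟨x, hx, h⟩
    · have h2 := hx.smul hp.out (-1)
      rw [abs_neg, abs_one, one_mul] at h2
      exact ⟨_, h2, by simpa using h⟩
  obtain ⟨x, hx, hR⟩ := exists_RISseq h
  obtain ⟨j, hj⟩ := exists_nat_gt (‖g‖ * (3 * C) / ε)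
  obtain ⟨lo, hi, jj, hR⟩ := hR (nn (j + 1))
  have h1 := (nrm_le_iff hp.out).2 (hR.avg_spec hp.out (by omega) hC).1
  rw [← norm_emb] at h1
  have h2 := g.le_opNorm (emb p (avg (j + 1) x))
  have h3 := mul_le_mul_of_nonneg_left h1 (norm_nonneg g)
  have hn : (0 : ℝ) < nn (j + 1) := by exact_mod_cast nn_pos _
  have h4 : (mm (j + 1) : ℝ) * ε ≤ g (emb p (avg (j + 1) x)) := by
    rw [avg, map_smul, map_smul, map_sum, map_sum, smul_eq_mul]
    have : (nn (j + 1) : ℝ) * ε ≤ ∑ i ∈ Finset.range (nn (j + 1)), g (emb p (x i)) :=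
      le_trans (by simp) (Finset.sum_le_sum (f := fun _ => ε) fun i _ => hx i)
    calc (mm (j + 1) : ℝ) * ε = mm (j + 1) / nn (j + 1) * (nn (j + 1) * ε) := by field_simp
      _ ≤ _ := mul_le_mul_of_nonneg_left this (by positivity)
  have h5 : (j : ℝ) ≤ mm (j + 1) := by exact_mod_cast (Nat.le_succ j).trans (le_mm _)
  rw [div_lt_iff₀ hε] at hj
  have h6 := le_abs_self (g (emb p (avg (j + 1) x)))
  rw [← Real.norm_eq_abs] at h6
  nlinarith

theorem tendsto_proj_risF {C : ℝ} (hC : 0 ≤ C) (T : Y p →L[ℝ] Y p) (M : ℕ) :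
    Tendsto (fun x => proj p M (T (emb p x))) (risF p C) (𝓝 0) := by
  simp only [proj_eq_sum, _root_.sum_apply, ContinuousLinearMap.smulRight_apply]
  rw [← Finset.sum_const_zero (s := Finset.range M)]
  refine tendsto_finsetSum _ fun n _ => ?_
  have := (tendsto_risF hC ((dstar p n).comp T)).smul_const (emb p (dd n))
  simpa using this

theorem eventually_exists_near {C : ℝ} (hC : 0 ≤ C) (T : Y p →L[ℝ] Y p) (M : ℕ) {ε : ℝ} (hε : 0 < ε) :
    ∀ᶠ x in risF p C, ∃ y : V, (∀ n, y n ≠ 0 → M ≤ n) ∧ ‖T (emb p x) - emb p y‖ ≤ ε := by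
  have := Metric.tendsto_nhds.1 (tendsto_proj_risF hC T M) (ε / 2) (by positivity)
  filter_upwards [this] with x hx
  rw [dist_zero_right] at hx
  obtain ⟨v, hv⟩ := exists_approx (T (emb p x)) (ε := ε / 6) (by positivity)
  refine ⟨v - tr M v, fun n hn => ?_, ?_⟩
  · by_contra h
    exact hn (by rw [Finsupp.sub_apply, tr_apply, if_pos (by omega), sub_self])
  · rw [map_sub, ← proj_emb]
    have h1 := norm_sub_proj_le M (T (emb p x) - emb p v)
    rw [map_sub] at h1
    have h2 : T (emb p x) - (emb p v - proj p M (emb p v)) =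
        (T (emb p x) - emb p v - (proj p M (T (emb p x)) - proj p M (emb p v))) +
          proj p M (T (emb p x)) := by abel
    rw [h2]
    refine (norm_add_le _ _).trans ?_
    linarith

end operators

section functionals
variable {p : ℝ} [hp : Fact (1 < p)]

structure Fnl (κ : ℕ∞) (M : ℕ) (g : Y p →L[ℝ] ℝ) : Prop where
  norm_le : ‖g‖ ≤ 1
  supp : ∀ n, g (emb p (dd n)) ≠ 0 → M ≤ n ∧ okcol κ (some M) (col p n)

theorem apply_emb (g : Y p →L[ℝ] ℝ) (x : V) : g (emb p x) = ev (fun n => g (emb p (dd n))) x := by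
  have h : (g : Y p →ₗ[ℝ] ℝ).comp (emb p) = ev fun n => g (emb p (dd n)) := by
    refine Finsupp.lhom_ext fun n a => ?_
    rw [LinearMap.comp_apply, show Finsupp.single n a = a • dd n by simp [dd], map_smul, map_smul,
      map_smul, ev_dd]
    rfl
  exact LinearMap.congr_fun h x

theorem Fnl.le {κ : ℕ∞} {M : ℕ} {g : Y p →L[ℝ] ℝ} (h : Fnl κ M g) (y : Y p) : |g y| ≤ ‖y‖ := by
  have := g.le_of_opNorm_le h.norm_le y
  rwa [one_mul] at this

theorem Fnl.neg {κ : ℕ∞} {M : ℕ} {g : Y p →L[ℝ] ℝ} (h : Fnl κ M g) : Fnl κ M (-g) :=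
  ⟨by rw [norm_neg]; exact h.norm_le, fun n hn => h.supp n fun h0 => hn (by simp [h0])⟩

theorem exists_rat_approx {q : ℕ} (a : ℕ → ℝ) {η : ℝ} (hη : 0 < η) : ∃ f : ℕ →₀ ℚ,
    (∀ n, f n ≠ 0 → n < q ∧ a n ≠ 0) ∧ ∀ n < q, |(f n : ℝ) - a n| ≤ η := by
  classical
  have h : ∀ n, ∃ r : ℚ, |(r : ℝ) - a n| ≤ η := fun n => by
    obtain ⟨r, h1, h2⟩ := exists_rat_btwn (show a n - η < a n + η by linarith)
    exact ⟨r, abs_le.2 ⟨by linarith, by linarith⟩⟩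
  choose r hr using h
  refine ⟨Finsupp.onFinset (Finset.range q) (fun n => if n < q ∧ a n ≠ 0 then r n else 0)
    fun n hn => ?_, fun n hn => ?_, fun n hn => ?_⟩
  · by_contra h
    exact hn (if_neg fun h' => h (Finset.mem_range.2 h'.1))
  · by_contra h
    exact hn (by rw [Finsupp.onFinset_apply, if_neg h])
  · rw [Finsupp.onFinset_apply]
    split_ifs with h
    · exact hr n
    · have : a n = 0 := by
        by_contra h0; exact h ⟨hn, h0⟩
      simp [this, hη.le]

theorem abs_ev_sub_le {q : ℕ} {f a : ℕ → ℝ} {η : ℝ} (hf : ∀ n, f n ≠ 0 → n < q)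
    (h : ∀ n < q, |f n - a n| ≤ η) (v : V) :
    |ev f v - ev a (tr q v)| ≤ η * ∑ n ∈ Finset.range q, |v n| := by
  have h1 : ev f v = ev f (tr q v) := (ev_tr_of_lt hf v).symm
  have h2 : ∀ g : ℕ → ℝ, ev g (tr q v) = ∑ n ∈ Finset.range q, tr q v n * g n := fun g =>
    ev_eq_sum _ _ fun n hn => by
      by_contra hlt
      exact hn (by rw [tr_apply, if_neg hlt, mul_zero])
  rw [h1, h2, h2, ← Finset.sum_sub_distrib, Finset.mul_sum]
  refine (Finset.abs_sum_le_sum_abs _ _).trans (Finset.sum_le_sum fun n hn => ?_)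
  have hn' := Finset.mem_range.1 hn
  rw [tr_apply, if_pos hn', ← mul_sub, abs_mul, mul_comm]
  exact mul_le_mul_of_nonneg_right (h n hn') (abs_nonneg _)

theorem exists_forall_apply_le (T : Y p →L[ℝ] Y p) (κ : ℕ∞) {C δ : ℝ} (hC : 0 ≤ C) (hδ : 0 < δ) :
    ∃ M, ∀ x, RIS p M C x → ∀ g, Fnl κ M g → g (emb p x) = 0 → g (T (emb p x)) ≤ δ := by
  obtain ⟨M, ε, hε, hM⟩ := not_bad (T := T) (κ := κ) hC (show 0 < δ / 8 by positivity)
  obtain ⟨M', hM'⟩ := eventually_risF.1 (eventually_exists_near hC T M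
    (ε := min ε (δ / 4)) (by positivity))
  refine ⟨max M M', fun x hx g hg h0 => ?_⟩
  by_contra hlt
  push Not at hlt
  obtain ⟨y, hy, hTy⟩ := hM' x (hx.mono (le_max_right _ _) le_rfl)
  obtain ⟨q, hq⟩ := exists_max_supp x y
  have hqx : tr q x = x := tr_eq_self fun n hn => by
    by_contra h; have := hq n (Or.inl h); omega
  have hqy : tr q y = y := tr_eq_self fun n hn => by
    by_contra h; have := hq n (Or.inr h); omega
  set X := ∑ n ∈ Finset.range q, |x n| with hX
  set W := ∑ n ∈ Finset.range q, |y n| with hW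
  have hX0 : 0 ≤ X := Finset.sum_nonneg fun _ _ => abs_nonneg _
  have hW0 : 0 ≤ W := Finset.sum_nonneg fun _ _ => abs_nonneg _
  set B : ℝ := 3 * q + X + W + 1 with hB
  have hB0 : 0 < B := by positivity
  set m := min (1 / 2) (min ε (δ / 16)) with hm
  have hm0 : 0 < m := by positivity
  have hη : 0 < m / B := by positivity
  have hηB : m / B * B = m := by field_simp
  obtain ⟨f, hf1, hf2⟩ := exists_rat_approx (q := q) (fun n => 1 / 4 * g (emb p (dd n))) hη
  have hf0 : ∀ n, ((f n : ℚ) : ℝ) ≠ 0 → n < q := fun n hn => (hf1 n fun h => hn (by simp [h])).1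
  have hfv : ∀ v, |ev (fun n => (f n : ℝ)) v - 1 / 4 * g (emb p (tr q v))| ≤
      m / B * ∑ n ∈ Finset.range q, |v n| := fun v => by
    have h2 := abs_ev_sub_le hf0 hf2 v
    have h3 := ev_smul (1 / 4) (fun n => g (emb p (dd n))) (tr q v)
    rw [← apply_emb] at h3
    rw [← h3]
    exact h2
  have hηle : ∀ s, 0 ≤ s → s ≤ B → m / B * s ≤ m := fun s _ hs =>
    (mul_le_mul_of_nonneg_left hs hη.le).trans hηB.le
  refine hM x y f ⟨hx.mono (le_max_left _ _) le_rfl, hy, hTy.trans (min_le_left _ _), fun k hk => ?_,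
    ⟨q, fun v t hv hw => ?_⟩, ?_, ?_⟩
  · have := hg.supp k fun h => (hf1 k hk).2 (by simp [h])
    refine ⟨(le_max_left _ _).trans this.1, this.2.of_some fun ξ hξ => ?_⟩
    cases hξ
    exact le_max_left _ _
  · have ht := hw.nonneg hp.out
    have h1 := hg.le (emb p (tr q v))
    rw [norm_emb] at h1
    have h2 := (nrm_le_iff hp.out).2 (Bd_tr hp.out hv hw)
    have h3 : ∑ n ∈ Finset.range q, |v n| ≤ 3 * q * t :=
      (Finset.sum_le_sum (g := fun _ => 3 * t) fun n hn => coord_le hp.out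
        (fun η hη => hv η (hη.trans_lt (Finset.mem_range.1 hn))) hw).trans (by
          rw [Finset.sum_const, Finset.card_range, nsmul_eq_mul]; linarith)
    have h4 : m / B * ∑ n ∈ Finset.range q, |v n| ≤ 1 / 2 * t := by
      calc _ ≤ m / B * (3 * q * t) := mul_le_mul_of_nonneg_left h3 hη.le
        _ = m / B * (3 * q) * t := by ring
        _ ≤ m * t := mul_le_mul_of_nonneg_right (hηle _ (by positivity) (by linarith)) ht
        _ ≤ _ := mul_le_mul_of_nonneg_right (min_le_left _ _) ht
    have h5 := hfv v
    rw [abs_le] at h1 h5 ⊢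
    constructor <;> linarith
  · have h5 := hfv x
    rw [hqx, h0, mul_zero, sub_zero] at h5
    exact h5.trans ((hηle X hX0 (by linarith [show (0:ℝ) ≤ q from Nat.cast_nonneg _])).trans
      ((min_le_right _ _).trans (min_le_left _ _)))
  · have h5 := hfv y
    rw [hqy] at h5
    have h6 := hηle W hW0 (by linarith [show (0:ℝ) ≤ q from Nat.cast_nonneg _])
    have h7 : m ≤ δ / 16 := (min_le_right _ _).trans (min_le_right _ _)
    have h8 := (hg.le (T (emb p x) - emb p y)).trans (hTy.trans (min_le_right _ _))
    rw [map_sub] at h8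
    rw [abs_le] at h5 h8
    linarith

theorem exists_forall_abs_apply_le (T : Y p →L[ℝ] Y p) (κ : ℕ∞) {C δ : ℝ} (hC : 0 ≤ C) (hδ : 0 < δ) :
    ∃ M, ∀ x, RIS p M C x → ∀ g, Fnl κ M g → g (emb p x) = 0 → |g (T (emb p x))| ≤ δ := by
  obtain ⟨M, hM⟩ := exists_forall_apply_le T κ hC hδ
  refine ⟨M, fun x hx g hg h0 => abs_le.2 ⟨?_, hM x hx g hg h0⟩⟩
  have := hM x hx (-g) hg.neg (by simp [h0])
  simp only [_root_.neg_apply] at this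
  linarith

/-- Uniform smallness of the family `y` against the functionals of colour `κ`. -/
def Small {ι : Type} (F : Filter ι) (κ : ℕ∞) (y : ι → Y p) : Prop :=
  ∀ ε > 0, ∃ M, ∀ᶠ i in F, ∀ g, Fnl κ M g → |g (y i)| ≤ ε

theorem Fnl.mono {κ : ℕ∞} {M M' : ℕ} (h : M ≤ M') {g : Y p →L[ℝ] ℝ} (hg : Fnl κ M' g) : Fnl κ M g := by
  refine ⟨hg.norm_le, fun n hn => ⟨h.trans (hg.supp n hn).1, (hg.supp n hn).2.of_some ?_⟩⟩
  intro ξ hξ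
  cases hξ
  exact h

/-- Testing the norm of `A y` on functionals precomposed with `A`. -/
theorem norm_apply_le_of_Fnl {κ : ℕ∞} {M : ℕ} {A : Y p →L[ℝ] Y p} {D ε : ℝ} (hD : 0 < D) (hA : ‖A‖ ≤ D)
    (hs : ∀ n, A (emb p (dd n)) ≠ 0 → M ≤ n ∧ okcol κ (some M) (col p n)) {y : Y p}
    (hy : ∀ g, Fnl κ M g → |g y| ≤ ε) : ‖A y‖ ≤ D * ε := by
  obtain ⟨g, hg, hgy⟩ := exists_dual_vector'' ℝ (A y)
  have h := hy (D⁻¹ • g.comp A) ⟨?_, fun n hn => hs n fun h0 => hn (by simp [h0])⟩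
  · have h2 : g (A y) = ‖A y‖ := hgy
    simp only [_root_.smul_apply, ContinuousLinearMap.comp_apply, smul_eq_mul, h2] at h
    rw [abs_of_nonneg (by positivity), inv_mul_le_iff₀ hD] at h
    exact h
  · rw [norm_smul, Real.norm_eq_abs, abs_of_pos (by positivity), inv_mul_le_iff₀ hD, mul_one]
    refine (g.opNorm_comp_le A).trans ?_
    have := norm_nonneg A
    nlinarith

theorem tendsto_norm_of_small {ι : Type} {F : Filter ι} {y : ι → Y p}
    (hP : ∀ M, Tendsto (fun i => proj p M (y i)) F (𝓝 0)) (hs : ∀ κ, Small F κ y) :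
    Tendsto y F (𝓝 0) := by
  rw [Metric.tendsto_nhds]
  intro ε hε
  obtain ⟨K, hK⟩ := hs ⊤ (ε / 36) (by positivity)
  have hs' := fun l : ℕ => hs (l : ℕ∞) (ε / 36 / (K + 1)) (by positivity)
  choose m hm using hs'
  set M := K + ∑ l ∈ Finset.range (K + 1), m l with hM
  have hKM : K ≤ M := by omega
  have hmM : ∀ l ∈ Finset.range (K + 1), m l ≤ M := fun l hl =>
    (Finset.single_le_sum (f := m) (fun _ _ => Nat.zero_le _) hl).trans (by omega)
  have hR : ∀ l ∈ Finset.range (K + 1), ∀ x, nrm p (cmul p (Pi.single l 1) M x) ≤ 9 * nrm p x :=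
    fun l hl x => by
    have hl' := Finset.mem_range.1 hl
    have := nrm_cmul_le hp.out (b := Pi.single l 1) (M := M) (B := 1) (s := 2) (fun k => ?_) ?_
      (fun k hk => ?_) x
    · norm_num at this; exact this
    · rw [Pi.single_apply]; split_ifs <;> simp
    · have := PV_spike hp.out l 1
      simp only [abs_one, mul_one] at this
      refine (congrArg (fun b => PV p b 2) ?_).mp this
      ext k; rw [Pi.single_apply]
    · rw [Pi.single_apply, if_neg (by omega)]
  have hRK : ∀ x, nrm p (cmul p (fun k => if k ≤ K then 1 else 0) M x) ≤ 6 * nrm p x := fun x => by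
    have := nrm_cmul_le hp.out (M := M) (B := 1) (s := 1) (b := fun k => if k ≤ K then 1 else 0)
      (fun k => by split_ifs <;> simp) (PV_step hp.out K) (fun k hk => if_neg (by omega)) x
    norm_num at this; exact this
  set R := fun l : ℕ => indOp (p := p) (cmul p (Pi.single l 1) M) with hRdef
  set U := (ContinuousLinearMap.id ℝ (Y p) - proj p M) -
    indOp (p := p) (cmul p (fun k => if k ≤ K then 1 else 0) M) with hU
  have hdecomp : ∀ y, y = proj p M y + ∑ l ∈ Finset.range (K + 1), R l y + U y := by
    have : ContinuousLinearMap.id ℝ (Y p) =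
        proj p M + ∑ l ∈ Finset.range (K + 1), R l + U := by
      refine clm_ext_emb fun x => ?_
      have e1 : ∑ l ∈ Finset.range (K + 1), R l (emb p x) =
          indOp (p := p) (cmul p (fun k => if k ≤ K then 1 else 0) M) (emb p x) := by
        rw [indOp_emb hRK, ← sum_cmul, map_sum]
        exact Finset.sum_congr rfl fun l hl => indOp_emb (hR l hl) x
      simp only [hU, _root_.add_apply, _root_.sub_apply, _root_.sum_apply,
        e1]
      abel
    intro y
    have := congrArg (fun A => A y) this
    simpa only [_root_.add_apply, _root_.sum_apply, ContinuousLinearMap.id_apply] using this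
  have hUn : ‖U‖ ≤ 9 := by
    refine norm_le_of_emb _ (by norm_num) fun x => ?_
    simp only [hU, _root_.sub_apply, ContinuousLinearMap.id_apply]
    rw [indOp_emb hRK]
    have h1 := norm_sub_proj_le M (emb p x)
    have h2 := norm_sub_le (emb p x - proj p M (emb p x))
      (emb p (cmul p (fun k => if k ≤ K then 1 else 0) M x))
    have h3 := hRK x
    simp only [norm_emb] at h1 h2 h3 ⊢
    linarith
  have hUs : ∀ n, U (emb p (dd n)) ≠ 0 → K ≤ n ∧ okcol ⊤ (some K) (col p n) := fun n hn => by
    by_contra hcon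
    apply hn
    simp only [hU, _root_.sub_apply, ContinuousLinearMap.id_apply]
    rw [indOp_emb hRK]
    by_cases hMn : M ≤ n
    · rw [proj_of_supp fun k hk => by
        rw [dd_apply] at hk
        by_contra h
        exact hk (if_neg (by omega))]
      have h2 : col p n ≠ ⊤ := fun h => hcon ⟨by omega, Or.inl h⟩
      obtain ⟨k, hk⟩ := ENat.ne_top_iff_exists.1 h2
      have h3 : k ≤ K := by
        by_contra h
        refine hcon ⟨by omega, Or.inr ⟨rfl, ?_⟩⟩
        rw [← hk]
        exact_mod_cast not_le.1 h
      rcases cmul_dd (p := p) (fun k => if k ≤ K then 1 else 0) M n with h | ⟨k', _, h5, h6⟩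
      · exfalso
        have := DFunLike.congr_fun h n
        rw [cmul_apply hMn hk.symm, dd_apply, if_pos h3, if_pos rfl] at this
        simp at this
      · have : k' = k := by rw [← hk] at h5; exact_mod_cast h5.symm
        rw [h6, this, if_pos h3, one_smul, sub_zero, sub_self]
    · have h1 : cmul p (fun k => if k ≤ K then 1 else 0) M (dd n) = 0 := by
        rcases cmul_dd (p := p) (fun k => if k ≤ K then 1 else 0) M n with h | ⟨k', h4, _⟩
        · exact h
        · omega
      have h2 : tr M (dd n) = dd n := tr_eq_self fun k hk => by
        rw [dd_apply, if_neg (by omega)]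
      rw [h1, map_zero, sub_zero, proj_emb, h2, sub_self]
  have hRs : ∀ l ∈ Finset.range (K + 1), ∀ n, R l (emb p (dd n)) ≠ 0 →
      m l ≤ n ∧ okcol l (some (m l)) (col p n) := fun l hl n hn => by
    rw [hRdef] at hn
    simp only at hn
    rw [indOp_emb (hR l hl)] at hn
    rcases cmul_dd (p := p) (Pi.single l 1) M n with h | ⟨k, h4, h5, h6⟩
    · rw [h, map_zero] at hn; exact absurd rfl hn
    · refine ⟨(hmM l hl).trans h4, Or.inl ?_⟩
      by_cases hkl : k = l
      · rw [h5, hkl]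
      · rw [h6, Pi.single_apply, if_neg hkl] at hn
        simp at hn
  have hev : ∀ᶠ i in F, ∀ l ∈ Finset.range (K + 1), ∀ g, Fnl (l : ℕ∞) (m l) g →
      |g (y i)| ≤ ε / 36 / (K + 1) := (Filter.eventually_all_finset _).2 fun l _ => hm l
  filter_upwards [hK, hev, Metric.tendsto_nhds.1 (hP M) (ε / 4) (by positivity)] with i h1 h2 h3
  rw [dist_zero_right] at h3 ⊢
  have h4 := norm_apply_le_of_Fnl (by norm_num) hUn hUs h1
  have h5 : ‖∑ l ∈ Finset.range (K + 1), R l (y i)‖ ≤ ε / 4 := by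
    refine (norm_sum_le _ _).trans ((Finset.sum_le_sum (g := fun _ => 9 * (ε / 36 / (K + 1)))
      fun l hl => norm_apply_le_of_Fnl (by norm_num) (norm_indOp_le (by norm_num) (hR l hl))
        (hRs l hl) (h2 l hl)).trans ?_)
    rw [Finset.sum_const, Finset.card_range, nsmul_eq_mul]
    push_cast
    apply le_of_eq
    field_simp
    norm_num
  rw [hdecomp (y i)]
  have h6 := norm_add₃_le (a := proj p M (y i)) (b := ∑ l ∈ Finset.range (K + 1), R l (y i))
    (c := U (y i))
  linarith

end functionals

section diagonal
variable {p : ℝ} [hp : Fact (1 < p)]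

theorem exists_forall_abs_apply_le_of_norm_le (T : Y p →L[ℝ] Y p) (κ : ℕ∞) {C δ D : ℝ} (hC : 0 ≤ C)
    (hδ : 0 < δ) (hD : 0 < D) : ∃ M, ∀ x, RIS p M C x → ∀ g : Y p →L[ℝ] ℝ, ‖g‖ ≤ D →
      (∀ n, g (emb p (dd n)) ≠ 0 → M ≤ n ∧ okcol κ (some M) (col p n)) →
      g (emb p x) = 0 → |g (T (emb p x))| ≤ δ := by
  obtain ⟨M, hM⟩ := exists_forall_abs_apply_le T κ hC (show 0 < D⁻¹ * δ by positivity)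
  refine ⟨M, fun x hx g hg hs h0 => ?_⟩
  have h := hM x hx (D⁻¹ • g) ⟨?_, fun n hn => hs n fun h0 => hn (by simp [h0])⟩ (by simp [h0])
  · rw [_root_.smul_apply, smul_eq_mul, abs_mul, abs_of_pos (by positivity)] at h
    exact le_of_mul_le_mul_left h (by positivity)
  · rw [norm_smul, Real.norm_eq_abs, abs_of_pos (by positivity), inv_mul_le_iff₀ hD, mul_one]
    exact hg

theorem tendsto_nu (k : ℕ) : Tendsto (fun N => nu N k) atTop atTop :=
  tendsto_atTop_mono (fun N => nu_ge N k) tendsto_id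

theorem tendsto_dd_risF (k : ℕ) : Tendsto (fun N => dd (nu N k)) atTop (risF p 4) := by
  rw [risF, tendsto_iInf]
  intro M
  rw [tendsto_principal]
  filter_upwards [eventually_ge_atTop (max k M)] with N hN
  exact RIS_dd hp.out (nu_spec p (by omega)).1 ((by omega : M ≤ N).trans (nu_ge N k))

theorem dstar_dd (n m : ℕ) : dstar p n (emb p (dd m)) = if m = n then 1 else 0 := by
  rw [dstar_emb, dd_apply]

/-- `T` acts asymptotically on the basis vectors of colour `k` as multiplication by `c`. -/
def Diag (T : Y p →L[ℝ] Y p) (k : ℕ) (c : ℝ) : Prop :=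
  Tendsto (fun N => T (emb p (dd (nu N k))) - c • emb p (dd (nu N k))) atTop (𝓝 0)

theorem abs_dstar_le (n : ℕ) (y : Y p) : |dstar p n y| ≤ 3 * ‖y‖ := by
  have := (dstar p n).le_of_opNorm_le (norm_dstar_le n) y
  exact this

theorem tendsto_sub_dstar_smul (T : Y p →L[ℝ] Y p) (k : ℕ) :
    Tendsto (fun N => T (emb p (dd (nu N k))) -
      dstar p (nu N k) (T (emb p (dd (nu N k)))) • emb p (dd (nu N k))) atTop (𝓝 0) := by
  refine tendsto_norm_of_small (fun M => ?_) fun κ ε hε => ?_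
  · refine ((tendsto_proj_risF (C := 4) (by norm_num) T M).comp (tendsto_dd_risF k)).congr' ?_
    filter_upwards [eventually_ge_atTop M] with N hN
    have := nu_ge N k
    rw [map_sub, map_smul, proj_of_supp fun n hn => ?_, smul_zero, sub_zero]
    · rfl
    · rw [dd_apply] at hn
      by_contra h
      exact hn (if_neg (by omega))
  · obtain ⟨M, hM⟩ := exists_forall_abs_apply_le_of_norm_le T κ (C := 4) (D := 13) (by norm_num) hε
      (by norm_num)
    refine ⟨M, ?_⟩
    filter_upwards [(tendsto_dd_risF (p := p) k).eventually
      (eventually_risF.2 ⟨M, fun x hx => hx⟩)] with N hN g hg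
    have h1 : |g (emb p (dd (nu N k)))| ≤ 4 := (hg.le _).trans (norm_emb_dd_le _)
    have h := hM _ hN (g - g (emb p (dd (nu N k))) • dstar p (nu N k)) ?_ (fun n hn => ?_) ?_
    · simp only [_root_.sub_apply, _root_.smul_apply, smul_eq_mul] at h
      rw [map_sub, map_smul, smul_eq_mul, mul_comm]
      exact h
    · refine (norm_sub_le _ _).trans ?_
      rw [norm_smul, Real.norm_eq_abs]
      have h2 := norm_dstar_le (p := p) (nu N k)
      have h3 := hg.norm_le
      nlinarith [abs_nonneg (g (emb p (dd (nu N k)))), norm_nonneg (dstar p (nu N k))]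
    · apply hg.supp
      intro h0
      apply hn
      simp only [_root_.sub_apply, _root_.smul_apply, smul_eq_mul, dstar_dd, h0]
      split_ifs with h
      · rw [← h, h0]; ring
      · ring
    · simp [dstar_dd]

theorem cauchySeq_dstar (T : Y p →L[ℝ] Y p) (k : ℕ) :
    CauchySeq fun N => dstar p (nu N k) (T (emb p (dd (nu N k)))) := by
  rw [Metric.cauchySeq_iff']
  intro ε hε
  obtain ⟨M, hM⟩ := exists_forall_abs_apply_le_of_norm_le T k (C := 8) (D := 6) (δ := ε / 4)
    (by norm_num) (by positivity) (by norm_num)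
  obtain ⟨N₀, hN₀⟩ := eventually_atTop.1 ((tendsto_dd_risF (p := p) k).eventually
      (eventually_risF.2 ⟨M, fun x hx => hx⟩))
  set N₁ := max N₀ (max M k) with hN₁
  refine ⟨N₁, fun N hN => ?_⟩
  rw [Real.dist_eq]
  by_cases hNN : N = N₁
  · rw [hNN, sub_self, abs_zero]; exact hε
  have hne : nu N k ≠ nu N₁ k := fun h => hNN (nu_injOn (by omega) (by omega) h).1
  have hx := hN₀ N (by omega)
  have hx' := hN₀ N₁ (by omega)
  have hs : ∀ N, N₁ ≤ N → ∀ n, nu N k = n → M ≤ n ∧ okcol (k : ℕ∞) (some M) (col p n) :=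
    fun N hN n hn => hn ▸ ⟨(by omega : M ≤ N).trans (nu_ge N k),
      Or.inl (nu_spec p (by omega)).2.2⟩
  have hd : ∀ N, N₁ ≤ N → ∀ n, dstar p (nu N k) (emb p (dd n)) ≠ 0 →
      M ≤ n ∧ okcol (k : ℕ∞) (some M) (col p n) := fun N hN n hn => hs N hN n <| by
    by_contra h
    exact hn (by rw [dstar_dd, if_neg (Ne.symm h)])
  have h1 := hM _ (hx.mono le_rfl (by norm_num)) (dstar p (nu N₁ k))
    ((norm_dstar_le _).trans (by norm_num)) (hd N₁ le_rfl) (by rw [dstar_dd, if_neg hne])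
  have h2 := hM _ (hx'.mono le_rfl (by norm_num)) (dstar p (nu N k))
    ((norm_dstar_le _).trans (by norm_num)) (hd N hN) (by rw [dstar_dd, if_neg hne.symm])
  have h3 := hM _ ((hx.add hp.out hx').mono le_rfl (by norm_num)) (dstar p (nu N k) - dstar p (nu N₁ k))
    ((norm_sub_le _ _).trans
      ((add_le_add (norm_dstar_le _) (norm_dstar_le _)).trans (by norm_num))) (fun n hn => ?_) ?_
  · simp only [map_add, _root_.sub_apply] at h3
    rw [abs_le] at h1 h2 h3
    rw [abs_lt]
    constructor <;> linarith
  · by_cases h : dstar p (nu N k) (emb p (dd n)) = 0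
    · refine hd N₁ le_rfl n fun h' => hn ?_
      rw [_root_.sub_apply, h, h', sub_zero]
    · exact hd N hN n h
  · simp [dstar_dd, hne, hne.symm]

theorem exists_diag (T : Y p →L[ℝ] Y p) (k : ℕ) : ∃ c, Diag T k c := by
  obtain ⟨c, hc⟩ := cauchySeq_tendsto_of_complete (cauchySeq_dstar T k)
  refine ⟨c, ?_⟩
  have h : Tendsto (fun N => (dstar p (nu N k) (T (emb p (dd (nu N k)))) - c) •
      emb p (dd (nu N k))) atTop (𝓝 0) := by
    refine squeeze_zero_norm (a := fun N => |dstar p (nu N k) (T (emb p (dd (nu N k)))) - c| * 4)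
      (fun N => ?_) ?_
    · rw [norm_smul, Real.norm_eq_abs]
      exact mul_le_mul_of_nonneg_left (norm_emb_dd_le _) (abs_nonneg _)
    · have := ((hc.sub_const c).abs).mul_const 4
      simpa using this
  have h2 := (tendsto_sub_dstar_smul T k).add h
  rw [add_zero] at h2
  refine h2.congr fun N => ?_
  rw [sub_smul]
  abel

theorem tendsto_dstar_apply {n : ℕ → ℕ} {y : ℕ → Y p} (h : Tendsto y atTop (𝓝 0)) :
    Tendsto (fun i => dstar p (n i) (y i)) atTop (𝓝 0) := by
  refine squeeze_zero_norm (a := fun i => 3 * ‖y i‖) (fun i => abs_dstar_le _ _) ?_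
  simpa using h.norm.const_mul 3

theorem Diag.tendsto {T : Y p →L[ℝ] Y p} {k : ℕ} {c : ℝ} (h : Diag T k c) :
    Tendsto (fun N => dstar p (nu N k) (T (emb p (dd (nu N k))))) atTop (𝓝 c) := by
  have := (tendsto_dstar_apply (n := fun N => nu N k) h).add_const c
  rw [zero_add] at this
  refine this.congr fun N => ?_
  simp [dstar_dd]

theorem Diag.unique {T : Y p →L[ℝ] Y p} {k : ℕ} {c c' : ℝ} (h : Diag T k c) (h' : Diag T k c') :
    c = c' := tendsto_nhds_unique h.tendsto h'.tendsto

theorem Diag.add {S T : Y p →L[ℝ] Y p} {k : ℕ} {a b : ℝ} (hS : Diag S k a) (hT : Diag T k b) :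
    Diag (S + T) k (a + b) := by
  have := Tendsto.add hS hT
  rw [add_zero] at this
  refine this.congr fun N => ?_
  rw [_root_.add_apply, add_smul]
  abel

theorem Diag.smul {T : Y p →L[ℝ] Y p} {k : ℕ} {b : ℝ} (a : ℝ) (hT : Diag T k b) :
    Diag (a • T) k (a * b) := by
  have := Tendsto.const_smul hT a
  rw [smul_zero] at this
  refine this.congr fun N => ?_
  rw [_root_.smul_apply, smul_sub, smul_smul]

theorem Diag.mul {S T : Y p →L[ℝ] Y p} {k : ℕ} {a b : ℝ} (hS : Diag S k a) (hT : Diag T k b) :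
    Diag (S * T) k (a * b) := by
  have h1 := (S.continuous.tendsto 0).comp hT
  rw [map_zero] at h1
  have := h1.add (Tendsto.const_smul hS b)
  rw [smul_zero, add_zero] at this
  refine this.congr fun N => ?_
  rw [ContinuousLinearMap.mul_def, ContinuousLinearMap.comp_apply, Function.comp_apply, map_sub, map_smul, smul_sub, smul_smul,
    mul_comm b a]
  abel

theorem Diag.one (k : ℕ) : Diag (1 : Y p →L[ℝ] Y p) k 1 := by
  refine tendsto_const_nhds.congr fun N => ?_
  rw [one_smul, one_apply_eq_self, sub_self]

theorem Diag.abs_le {T : Y p →L[ℝ] Y p} {k : ℕ} {c : ℝ} (h : Diag T k c) : |c| ≤ 12 * ‖T‖ := by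
  refine le_of_tendsto h.tendsto.abs (Eventually.of_forall fun N => ?_)
  have h1 := abs_dstar_le (nu N k) (T (emb p (dd (nu N k))))
  have h2 := T.le_opNorm (emb p (dd (nu N k)))
  have h3 := mul_le_mul_of_nonneg_left (norm_emb_dd_le (p := p) (nu N k)) (norm_nonneg T)
  linarith

variable (p) in
/-- The diagonal symbol of an operator. -/
noncomputable def symbol : (Y p →L[ℝ] Y p) →ₐ[ℝ] (ℕ → ℝ) :=
  AlgHom.ofLinearMap
    { toFun := fun T k => (exists_diag T k).choose
      map_add' := fun S T => funext fun k =>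
        (exists_diag (S + T) k).choose_spec.unique
          ((exists_diag S k).choose_spec.add (exists_diag T k).choose_spec)
      map_smul' := fun a T => funext fun k =>
        (exists_diag (a • T) k).choose_spec.unique ((exists_diag T k).choose_spec.smul a) }
    (funext fun k => (exists_diag 1 k).choose_spec.unique (Diag.one k))
    (fun S T => funext fun k => (exists_diag (S * T) k).choose_spec.unique
      ((exists_diag S k).choose_spec.mul (exists_diag T k).choose_spec))

theorem diag_symbol (T : Y p →L[ℝ] Y p) (k : ℕ) : Diag T k (symbol p T k) :=
  (exists_diag T k).choose_spec

theorem symbol_eq {T : Y p →L[ℝ] Y p} {k : ℕ} {c : ℝ} (h : Diag T k c) : symbol p T k = c :=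
  (diag_symbol T k).unique h

theorem symbol_eq_zero_of_isCompactOperator {T : Y p →L[ℝ] Y p} (hT : IsCompactOperator ⇑T) :
    symbol p T = 0 := by
  funext k
  have hK := IsCompactOperator.isCompact_closure_image_closedBall (f := (T : Y p →ₗ[ℝ] Y p)) hT 4
  obtain ⟨a, -, φ, hφ, ha⟩ := hK.tendsto_subseq (x := fun N => T (emb p (dd (nu N k)))) fun N =>
    subset_closure ⟨emb p (dd (nu N k)), by simpa using norm_emb_dd_le _, rfl⟩
  have h1 : Tendsto (fun i => T (emb p (dd (nu (φ i) k))) - a) atTop (𝓝 0) := by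
    simpa using ha.sub_const a
  have h2 := tendsto_dstar_apply (n := fun i => nu (φ i) k) h1
  have h3 := h2.add (((tendsto_dstar a).comp (tendsto_nu k)).comp hφ.tendsto_atTop)
  refine tendsto_nhds_unique ((diag_symbol T k).tendsto.comp hφ.tendsto_atTop) ?_
  rw [add_zero] at h3
  refine h3.congr fun i => ?_
  simp

theorem tendsto_risF_of_diag_zero {T : Y p →L[ℝ] Y p} (hT : ∀ k, Diag T k 0) {C : ℝ} (hC : 0 ≤ C) :
    Tendsto (fun x => T (emb p x)) (risF p C) (𝓝 0) := by
  refine tendsto_norm_of_small (tendsto_proj_risF hC T) fun κ ε hε => ?_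
  obtain ⟨M, hM⟩ := exists_forall_abs_apply_le_of_norm_le T κ (C := 5 * C) (D := 16) (δ := ε / 2)
    (by positivity) (by positivity) (by norm_num)
  refine ⟨M, eventually_risF.2 ⟨M, fun x hx g hg => ?_⟩⟩
  obtain ⟨l, hl⟩ : ∃ l : ℕ, okcol κ (some M) l := by
    by_cases hκ : κ = ⊤
    · exact ⟨M + 1, Or.inr ⟨hκ, by exact_mod_cast Nat.lt_succ_self M⟩⟩
    · obtain ⟨k, rfl⟩ := ENat.ne_top_iff_exists.1 hκ
      exact ⟨k, Or.inl rfl⟩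
  obtain ⟨q, hq⟩ := exists_supp x
  have e1 : ∀ᶠ N in atTop, |dstar p (nu N l) (T (emb p x))| < ε / 20 := by
    have := Metric.tendsto_nhds.1 ((tendsto_dstar (T (emb p x))).comp (tendsto_nu l)) (ε / 20)
      (by positivity)
    simpa using this
  have e2 : ∀ᶠ N in atTop, ‖T (emb p (dd (nu N l)))‖ < ε / (64 * (C + 1)) := by
    have := Metric.tendsto_nhds.1 (hT l) (ε / (64 * (C + 1))) (by positivity)
    simpa using this
  obtain ⟨N, h1, h2, hN⟩ := (e1.and (e2.and (eventually_ge_atTop (max l (max M q))))).exists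
  have hνN := nu_ge N l
  obtain ⟨hν0, -, hν2⟩ := nu_spec p (N := N) (k := l) (by omega)
  set ν := nu N l with hν
  have hxν : x ν = 0 := hq ν (by omega)
  set f := g (emb p x) with hf
  set a := 1 - g (emb p (dd ν)) with ha
  have hfC : |f| ≤ C := (hg.le _).trans (by rw [norm_emb]; exact (nrm_le_iff hp.out).2 hx.bd)
  have hgd : |g (emb p (dd ν))| ≤ 4 := (hg.le _).trans (norm_emb_dd_le _)
  have ha5 : |a| ≤ 5 := by rw [abs_le] at hgd ⊢; constructor <;> linarith
  have hd := (RIS_dd hp.out (M := M) hν0 (by omega)).smul hp.out (-f)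
  have hx' := hM (x + -f • dd ν) ((hx.add hp.out hd).mono le_rfl (by rw [abs_neg]; linarith))
    (g + a • dstar p ν) ?_ (fun n hn => ?_) ?_
  · simp only [map_add, map_smul, _root_.add_apply, _root_.smul_apply, smul_eq_mul] at hx'
    have h3 := abs_dstar_le ν (T (emb p (dd ν)))
    have h4 := hg.le (T (emb p (dd ν)))
    set τ := ‖T (emb p (dd ν))‖ with hτ
    have hτ0 : 0 ≤ τ := norm_nonneg _
    have h5 : |a * dstar p ν (T (emb p x))| ≤ 5 * (ε / 20) := by
      rw [abs_mul]; exact mul_le_mul ha5 h1.le (abs_nonneg _) (by norm_num)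
    have h6 : |a * dstar p ν (T (emb p (dd ν)))| ≤ 5 * (3 * τ) := by
      rw [abs_mul]; exact mul_le_mul ha5 h3 (abs_nonneg _) (by norm_num)
    have h7 : |f * (g (T (emb p (dd ν))) + a * dstar p ν (T (emb p (dd ν))))| ≤ C * (16 * τ) := by
      rw [abs_mul]
      refine mul_le_mul hfC ((abs_add_le _ _).trans (by linarith)) (abs_nonneg _) hC
    have h8 : C * (16 * τ) ≤ ε / 4 := by
      rw [lt_div_iff₀ (by positivity)] at h2
      nlinarith
    rw [abs_le] at hx' h5 h7 ⊢
    constructor <;> nlinarith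
  · refine (norm_add_le _ _).trans ?_
    rw [norm_smul, Real.norm_eq_abs]
    have h2 := norm_dstar_le (p := p) ν
    have h3 := hg.norm_le
    nlinarith [abs_nonneg a, norm_nonneg (dstar p ν)]
  · by_cases hn0 : g (emb p (dd n)) = 0
    · have hnν : n = ν := by
        by_contra h
        apply hn
        rw [_root_.add_apply, _root_.smul_apply, hn0, dstar_dd, if_neg h]
        simp
      rw [hnν, hν2]
      exact ⟨by omega, hl⟩
    · exact hg.supp n hn0
  · simp only [map_add, map_smul, _root_.add_apply, _root_.smul_apply, smul_eq_mul, dstar_emb,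
      dd_apply, if_true, hxν, ← hf, ha]
    ring

theorem exists_forall_norm_apply_le {S : Y p →L[ℝ] Y p}
    (hS : ∀ C : ℝ, 0 ≤ C → Tendsto (fun x => S (emb p x)) (risF p C) (𝓝 0)) {ε : ℝ} (hε : 0 < ε) :
    ∃ M, ∀ x : V, (∀ n, x n ≠ 0 → M ≤ n) → ‖S (emb p x)‖ ≤ ε * nrm p x := by
  have key : ∀ C : ℝ, 0 ≤ C → ∃ M, ∀ x, RIS p M C x → ‖S (emb p x)‖ ≤ ε / 2 := fun C hC => by
    obtain ⟨M, hM⟩ := eventually_risF.1 (Metric.tendsto_nhds.1 (hS C hC) (ε / 2) (by positivity))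
    exact ⟨M, fun x hx => by have := hM x hx; rw [dist_zero_right] at this; exact this.le⟩
  obtain ⟨M₁, h₁⟩ := key 2 (by norm_num)
  obtain ⟨M₂, h₂⟩ := key (2 * mm M₁) (by positivity)
  refine ⟨max M₁ M₂, fun x hx => ?_⟩
  have h0 : 0 ≤ nrm p x := by rw [← norm_emb]; exact norm_nonneg _
  rcases h0.eq_or_lt with h0 | h0
  · have : emb p x = 0 := by rw [← norm_eq_zero, norm_emb, h0]
    rw [this, map_zero, norm_zero, ← h0, mul_zero]
  · have hb := (Bd_nrm hp.out x).smul hp.out (nrm p x)⁻¹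
    rw [abs_of_pos (by positivity), inv_mul_cancel₀ h0.ne'] at hb
    obtain ⟨y, hy, hxy⟩ := exists_split hp.out (x := (nrm p x)⁻¹ • x) (M := max M₁ M₂)
      (fun n hn => hx n fun h => hn (by simp [h])) hb M₁
    have e1 := h₁ y (hy.mono (by omega) le_rfl)
    have e2 := h₂ _ (hxy.mono (by omega) le_rfl)
    have e3 := norm_add_le (S (emb p y)) (S (emb p ((nrm p x)⁻¹ • x - y)))
    rw [← map_add, ← map_add, add_sub_cancel, map_smul, map_smul, norm_smul, Real.norm_eq_abs,
      abs_of_pos (by positivity)] at e3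
    rw [mul_comm, ← inv_mul_le_iff₀ h0]
    linarith

theorem isCompactOperator_proj (M : ℕ) : IsCompactOperator ⇑(proj p M) := by
  have h : ∀ (f : Y p →L[ℝ] ℝ) (y : Y p), IsCompactOperator ⇑(f.smulRight y) := fun f y =>
    (isCompactOperator_of_locallyCompactSpace_dom f).clm_comp
      (ContinuousLinearMap.toSpanSingleton ℝ y)
  rw [proj_eq_sum]
  exact Submodule.sum_mem (compactOperator (RingHom.id ℝ) (Y p) (Y p)) fun n _ => h _ _

theorem isCompactOperator_of_tendsto_risF {S : Y p →L[ℝ] Y p}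
    (hS : ∀ C : ℝ, 0 ≤ C → Tendsto (fun x => S (emb p x)) (risF p C) (𝓝 0)) :
    IsCompactOperator ⇑S := by
  refine isCompactOperator_of_tendsto (l := atTop) (F := fun M => S.comp (proj p M)) ?_
    (Eventually.of_forall fun M => (isCompactOperator_proj M).clm_comp S)
  rw [Metric.tendsto_atTop]
  intro ε hε
  obtain ⟨M, hM⟩ := exists_forall_norm_apply_le hS (show 0 < ε / 4 by positivity)
  refine ⟨M, fun n hn => ?_⟩
  rw [dist_comm, dist_eq_norm]
  refine lt_of_le_of_lt (norm_le_of_emb _ (C := ε / 4 * 3) (by positivity) fun x => ?_) (by linarith)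
  rw [_root_.sub_apply, ContinuousLinearMap.comp_apply, proj_emb, ← map_sub, ← map_sub, mul_assoc]
  refine (hM _ fun k hk => ?_).trans (mul_le_mul_of_nonneg_left ?_ (by positivity))
  · by_contra h
    exact hk (by rw [Finsupp.sub_apply, tr_apply, if_pos (by omega), sub_self])
  · rw [← norm_emb, map_sub, ← proj_emb, ← norm_emb]
    exact norm_sub_proj_le _ _

theorem symbol_eq_zero_iff {T : Y p →L[ℝ] Y p} : symbol p T = 0 ↔ IsCompactOperator ⇑T := by
  refine ⟨fun h => isCompactOperator_of_tendsto_risF fun C hC =>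
    tendsto_risF_of_diag_zero (fun k => ?_) hC, symbol_eq_zero_of_isCompactOperator⟩
  have := diag_symbol T k
  rwa [h] at this

end diagonal

section variation
variable {p : ℝ}

theorem PV.sum_le (hp : 1 < p) {b : ℕ → ℝ} {v : ℝ} (h : PV p b v) (r : ℕ) {k : ℕ → ℕ}
    (hk : StrictMono k) : ∑ n ∈ Finset.range r, |b (k (n + 1)) - b (k n)| ^ p ≤ v ^ p := by
  have h1 := PV_iff.1 h r k hk
  have h0 : 0 ≤ ∑ n ∈ Finset.range r, |b (k (n + 1)) - b (k n)| ^ p :=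
    Finset.sum_nonneg fun _ _ => by positivity
  have h2 := Real.rpow_le_rpow (by positivity) h1 (by linarith : 0 ≤ p)
  rwa [Real.rpow_inv_rpow h0 (by linarith)] at h2

theorem abs_sub_rpow_le_of_sum_le {b : ℕ → ℝ} {K : ℕ} {η : ℝ}
    (H : ∀ (r : ℕ) (k : ℕ → ℕ), StrictMono k → K ≤ k 0 →
      ∑ n ∈ Finset.range r, |b (k (n + 1)) - b (k n)| ^ p ≤ η) {i j : ℕ} (hi : K ≤ i) (hij : i < j) :
    |b j - b i| ^ p ≤ η := by
  have := H 1 (fun n => i + n * (j - i)) (strictMono_nat_of_lt_succ fun n => by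
    rw [Nat.succ_mul]; omega) (by simpa using hi)
  simp only [Finset.range_one, Finset.sum_singleton, zero_add, one_mul, zero_mul, add_zero] at this
  rwa [Nat.add_sub_cancel' hij.le] at this

theorem PV.abs_sub_le (hp : 1 < p) {b : ℕ → ℝ} {v : ℝ} (h : PV p b v) {i j : ℕ} (hij : i < j) :
    |b j - b i| ≤ v := by
  have h1 := abs_sub_rpow_le_of_sum_le (K := 0) (fun r k hk _ => h.sum_le hp r hk) (Nat.zero_le i) hij
  exact (Real.rpow_le_rpow_iff (abs_nonneg _) (h.nonneg hp) (by linarith)).1 h1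

theorem exists_forall_sum_le (hp : 1 < p) {b : ℕ → ℝ} {v η : ℝ} (h : PV p b v) (hη : 0 < η) :
    ∃ K, ∀ (r : ℕ) (k : ℕ → ℕ), StrictMono k → K ≤ k 0 →
      ∑ n ∈ Finset.range r, |b (k (n + 1)) - b (k n)| ^ p ≤ η := by
  set S : Set ℝ := {s | ∃ (r : ℕ) (k : ℕ → ℕ), StrictMono k ∧
    s = ∑ n ∈ Finset.range r, |b (k (n + 1)) - b (k n)| ^ p} with hS
  have hbdd : BddAbove S := ⟨v ^ p, by rintro s ⟨r, k, hk, rfl⟩; exact h.sum_le hp r hk⟩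
  have hne : S.Nonempty := ⟨_, 0, id, strictMono_id, rfl⟩
  obtain ⟨s, ⟨r₀, k₀, hk₀, rfl⟩, hs⟩ := exists_lt_of_lt_csSup hne (sub_lt_self (sSup S) hη)
  refine ⟨k₀ r₀ + 1, fun r k hk hK => ?_⟩
  have hmono : StrictMono fun n => if n ≤ r₀ then k₀ n else k (n - (r₀ + 1)) := by
    refine strictMono_nat_of_lt_succ fun n => ?_
    rcases lt_trichotomy n r₀ with h1 | h1 | h1
    · rw [if_pos h1.le, if_pos (by omega)]
      exact hk₀ (Nat.lt_succ_self n)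
    · rw [if_pos h1.le, if_neg (by omega), h1, Nat.sub_self]
      omega
    · rw [if_neg (by omega), if_neg (by omega)]
      exact hk (by omega)
  have h1 := le_csSup hbdd ⟨r₀ + 1 + r, _, hmono, rfl⟩
  rw [Finset.sum_range_add, Finset.sum_range_succ] at h1
  have h2 : ∑ n ∈ Finset.range r₀, |b (if n + 1 ≤ r₀ then k₀ (n + 1) else k (n + 1 - (r₀ + 1))) -
      b (if n ≤ r₀ then k₀ n else k (n - (r₀ + 1)))| ^ p =
      ∑ n ∈ Finset.range r₀, |b (k₀ (n + 1)) - b (k₀ n)| ^ p := Finset.sum_congr rfl fun n hn => by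
    have := Finset.mem_range.1 hn
    rw [if_pos (by omega), if_pos (by omega)]
  have h3 : ∑ n ∈ Finset.range r, |b (if r₀ + 1 + n + 1 ≤ r₀ then k₀ (r₀ + 1 + n + 1) else
      k (r₀ + 1 + n + 1 - (r₀ + 1))) -
      b (if r₀ + 1 + n ≤ r₀ then k₀ (r₀ + 1 + n) else k (r₀ + 1 + n - (r₀ + 1)))| ^ p =
      ∑ n ∈ Finset.range r, |b (k (n + 1)) - b (k n)| ^ p := Finset.sum_congr rfl fun n _ => by
    rw [if_neg (by omega), if_neg (by omega), show r₀ + 1 + n + 1 - (r₀ + 1) = n + 1 by omega,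
      show r₀ + 1 + n - (r₀ + 1) = n by omega]
  have h4 : 0 ≤ |b (if r₀ + 1 ≤ r₀ then k₀ (r₀ + 1) else k (r₀ + 1 - (r₀ + 1))) -
      b (if r₀ ≤ r₀ then k₀ r₀ else k (r₀ - (r₀ + 1)))| ^ p := by positivity
  rw [h2, h3] at h1
  linarith

theorem PV_tail (hp : 1 < p) {b : ℕ → ℝ} {K : ℕ} {η : ℝ} (hη : 0 ≤ η)
    (H : ∀ (r : ℕ) (k : ℕ → ℕ), StrictMono k → K ≤ k 0 →
      ∑ n ∈ Finset.range r, |b (k (n + 1)) - b (k n)| ^ p ≤ η) (hb : ∀ n, K ≤ n → |b n| ^ p ≤ η) :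
    PV p (fun n => if n < K then 0 else b n) ((2 * η) ^ p⁻¹) := by
  rw [PV_iff]
  intro r k hk
  refine Real.rpow_le_rpow (Finset.sum_nonneg fun _ _ => by positivity) ?_
    (inv_nonneg.2 (by linarith))
  have hex : ∃ n, K ≤ k n := ⟨K, hk.id_le K⟩
  obtain ⟨n₀, hn₀, hlt⟩ : ∃ n, K ≤ k n ∧ ∀ m < n, k m < K :=
    ⟨Nat.find hex, Nat.find_spec hex, fun m hm => not_le.1 (Nat.find_min hex hm)⟩
  have hge : ∀ n, K ≤ k (n₀ + n) := fun n => hn₀.trans (hk.monotone (Nat.le_add_right _ _))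
  refine (Finset.sum_le_sum_of_subset_of_nonneg
    (Finset.range_mono (Nat.le_add_left r n₀)) fun _ _ _ => by positivity).trans ?_
  rw [Finset.sum_range_add, two_mul]
  refine add_le_add ?_ ?_
  · cases n₀ with
    | zero => simpa using hη
    | succ m =>
      rw [Finset.sum_range_succ, Finset.sum_eq_zero fun n hn => ?_, zero_add, if_neg (not_lt.2 hn₀),
        if_pos (hlt m (Nat.lt_succ_self m)), sub_zero]
      · exact hb _ hn₀
      · have := Finset.mem_range.1 hn
        rw [if_pos (hlt _ (by omega)), if_pos (hlt _ (by omega)), sub_zero, abs_zero,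
          Real.zero_rpow (by linarith)]
  · refine (Finset.sum_congr rfl fun n _ => ?_).trans_le
      (H r (fun n => k (n₀ + n)) (fun a b h => hk (by omega)) (hge 0))
    rw [if_neg (not_lt.2 (hge n)), add_assoc, if_neg (not_lt.2 (hge (n + 1)))]

theorem exists_PV_tail (hp : 1 < p) {b : ℕ → ℝ} {B v ε : ℝ} (hB : ∀ k, |b k| ≤ B) (h : PV p b v)
    (hε : 0 < ε) : ∃ (l : ℝ) (K : ℕ), |l| ≤ B ∧ (∀ n, K ≤ n → |b n - l| ≤ ε) ∧
      PV p (fun n => if n < K then 0 else b n - l) ε := by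
  have hp0 : 0 < p := by linarith
  have hc : CauchySeq b := by
    rw [Metric.cauchySeq_iff']
    intro δ hδ
    obtain ⟨K, hK⟩ := exists_forall_sum_le hp h (show 0 < (δ / 2) ^ p by positivity)
    refine ⟨K, fun n hn => ?_⟩
    rcases hn.eq_or_lt with rfl | hlt
    · simpa using hδ
    · have := abs_sub_rpow_le_of_sum_le hK le_rfl hlt
      rw [Real.rpow_le_rpow_iff (abs_nonneg _) (by positivity) hp0] at this
      rw [Real.dist_eq]
      linarith
  obtain ⟨l, hl⟩ := cauchySeq_tendsto_of_complete hc
  obtain ⟨K, hK⟩ := exists_forall_sum_le hp h (show 0 < ε ^ p / 2 by positivity)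
  have hbl : ∀ n, K ≤ n → |b n - l| ^ p ≤ ε ^ p / 2 := fun n hn => by
    have h1 : Tendsto (fun j => |b j - b n| ^ p) atTop (𝓝 (|l - b n| ^ p)) :=
      ((hl.sub_const _).abs).rpow_const (Or.inr hp0.le)
    rw [abs_sub_comm]
    refine le_of_tendsto h1 ?_
    filter_upwards [eventually_gt_atTop n] with j hj
    exact abs_sub_rpow_le_of_sum_le hK hn hj
  refine ⟨l, K, le_of_tendsto hl.abs (Eventually.of_forall hB), fun n hn => ?_, ?_⟩
  · rw [← Real.rpow_le_rpow_iff (abs_nonneg _) hε.le hp0]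
    have := Real.rpow_pos_of_pos hε p
    linarith [hbl n hn]
  · have := PV_tail hp (b := fun n => b n - l) (by positivity)
      (fun r k hk h0 => by simpa only [sub_sub_sub_cancel_right] using hK r k hk h0) hbl
    rwa [mul_div_cancel₀ _ two_ne_zero, Real.rpow_rpow_inv hε.le hp0.ne'] at this

theorem vpNorm_le (hp : 1 < p) {b : ℕ → ℝ} {B v : ℝ} (hB : ∀ k, |b k| ≤ B) (h : PV p b v) :
    vpNorm p b ≤ B + v :=
  add_le_add (csSup_le (Set.range_nonempty _) (by rintro _ ⟨i, rfl⟩; exact hB i))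
    (csSup_le ⟨0, zero_mem_pVarSet hp b⟩ h)

theorem le_vpNorm (hp : 1 < p) {b : ℕ → ℝ} (h : b ∈ boundedPVariation p) :
    (∀ k, |b k| ≤ vpNorm p b) ∧ PV p b (vpNorm p b) := by
  have hv : PV p b (sSup (pVarSet p b)) := fun v hv => le_csSup h hv
  have hbdd : BddAbove (Set.range fun i => |b i|) := by
    refine ⟨|b 0| + sSup (pVarSet p b), ?_⟩
    rintro _ ⟨i, rfl⟩
    have h0 := hv.nonneg hp
    rcases Nat.eq_zero_or_pos i with rfl | hi
    · simpa using h0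
    · have := hv.abs_sub_le hp hi
      have h1 := abs_sub_abs_le_abs_sub (b i) (b 0)
      simp only
      linarith
  have hB : ∀ k, |b k| ≤ sSup (Set.range fun i => |b i|) := fun k => le_csSup hbdd ⟨k, rfl⟩
  have := hv.nonneg hp
  exact ⟨fun k => (hB k).trans (le_add_of_nonneg_right this),
    hv.mono (le_add_of_nonneg_left ((abs_nonneg _).trans (hB 0)))⟩

end variation

section block
variable {p : ℝ}

theorem sum_smul_dd_nu_apply (a : ℕ → ℝ) (N j : ℕ) (s : Finset ℕ) :
    (∑ k ∈ s, a k • dd (nu N k)) (nu N j) = if j ∈ s then a j else 0 := by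
  have h : ∀ k, nu N k = nu N j ↔ k = j := fun k => by unfold nu; omega
  rw [Finsupp.finsetSum_apply]
  simp [dd_apply, h]

theorem blk_sum_smul_dd_nu (a : ℕ → ℝ) {K N : ℕ} (h : K ≤ N) :
    blk N (∑ k ∈ Finset.range (K + 1), a k • dd (nu N k)) = fun j => if j ≤ K then a j else 0 := by
  funext j
  simp only [blk]
  split_ifs with h1 h2 h2
  · rw [show 2 * (N ^ 2 + j) = nu N j from rfl, sum_smul_dd_nu_apply,
      if_pos (Finset.mem_range.2 (by omega))]
  · rw [show 2 * (N ^ 2 + j) = nu N j from rfl, sum_smul_dd_nu_apply,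
      if_neg (fun h => h2 (by have := Finset.mem_range.1 h; omega))]
  · omega
  · rfl

theorem exists_eq_nu_of_sum_ne {a : ℕ → ℝ} {K N n : ℕ}
    (h : (∑ k ∈ Finset.range (K + 1), a k • dd (nu N k)) n ≠ 0) : ∃ k ≤ K, n = nu N k := by
  rw [Finsupp.finsetSum_apply] at h
  obtain ⟨k, hk, hne⟩ := Finset.exists_ne_zero_of_sum_ne_zero h
  refine ⟨k, by have := Finset.mem_range.1 hk; omega, ?_⟩
  by_contra hcon
  exact hne (by rw [Finsupp.smul_apply, dd_apply, if_neg (Ne.symm hcon), smul_zero])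

theorem Bd_sum_dd_nu (hp : 1 < p) {K N : ℕ} (h : K ≤ N) :
    Bd p 4 (∑ k ∈ Finset.range (K + 1), (1 : ℝ) • dd (nu N k)) := by
  refine Bd_of_col hp (M := N) (fun n hn => ?_) (fun γ hγ => ?_) fun N' => ?_
  · obtain ⟨k, hk, rfl⟩ := exists_eq_nu_of_sum_ne (a := fun _ => 1) hn
    rw [(nu_spec p (by omega)).2.2]
    exact ⟨nu_ge N k, ENat.natCast_ne_top k, by exact_mod_cast hk.trans h⟩
  · have h4 : ∀ k, |en p γ (nu N k)| ≤ 4 := fun k => by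
      have := (Bd_dd hp (nu N k)).1 γ
      rwa [ev_dd] at this
    simp only [one_smul, map_sum, ev_dd]
    by_cases hex : ∃ k ∈ Finset.range (K + 1), en p γ (nu N k) ≠ 0
    · obtain ⟨k, hk, hne⟩ := hex
      rw [Finset.sum_eq_single_of_mem k hk fun k' hk' hkk => ?_]
      · exact h4 k
      · by_contra hne'
        have h1 := en_col p γ hγ _ hne
        have h2 := en_col p γ hγ _ hne'
        rw [(nu_spec p (by have := Finset.mem_range.1 hk; omega)).2.2] at h1
        rw [(nu_spec p (by have := Finset.mem_range.1 hk'; omega)).2.2, ← h1] at h2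
        exact hkk (by exact_mod_cast h2)
    · push Not at hex
      rw [Finset.sum_eq_zero hex, abs_zero]
      norm_num
  · by_cases hN : N' = N
    · subst hN
      have := blk_sum_smul_dd_nu (fun _ => (1 : ℝ)) h
      rw [this]
      exact (PV_step hp K).mono (by norm_num)
    · have : blk N' (∑ k ∈ Finset.range (K + 1), (1 : ℝ) • dd (nu N k)) = fun _ => 0 := by
        funext j
        simp only [blk]
        split_ifs with hj
        · by_contra hne
          obtain ⟨k, hk, he⟩ := exists_eq_nu_of_sum_ne (a := fun _ => 1) hne
          exact hN (nu_injOn hj (by omega) he).1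
        · rfl
      rw [this]
      exact (PV_zero hp).mono (by norm_num)

end block

section range
variable {p : ℝ} [hp : Fact (1 < p)]

theorem PV_symbol (T : Y p →L[ℝ] Y p) : PV p (symbol p T) (4 * ‖T‖) := by
  rw [PV_iff]
  intro r k hk
  set K := k r with hK
  set b := symbol p T with hb
  have h0 : Tendsto (fun N => ∑ j ∈ Finset.range (K + 1),
      (T (emb p (dd (nu N j))) - b j • emb p (dd (nu N j)))) atTop (𝓝 0) := by
    rw [← Finset.sum_const_zero (s := Finset.range (K + 1))]
    exact tendsto_finsetSum _ fun j _ => diag_symbol T j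
  have h1 : Tendsto (fun N => 4 * ‖T‖ + ‖∑ j ∈ Finset.range (K + 1),
      (T (emb p (dd (nu N j))) - b j • emb p (dd (nu N j)))‖) atTop (𝓝 (4 * ‖T‖)) := by
    simpa using h0.norm.const_add (4 * ‖T‖)
  refine ge_of_tendsto h1 ?_
  filter_upwards [eventually_ge_atTop K] with N hN
  set x := ∑ j ∈ Finset.range (K + 1), (1 : ℝ) • dd (nu N j) with hx
  set y := ∑ j ∈ Finset.range (K + 1), b j • dd (nu N j) with hy
  have hxy : ∑ j ∈ Finset.range (K + 1), (T (emb p (dd (nu N j))) - b j • emb p (dd (nu N j))) =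
      T (emb p x) - emb p y := by
    simp [hx, hy, Finset.sum_sub_distrib]
  have h2 : ‖emb p x‖ ≤ 4 := by
    rw [norm_emb]; exact (nrm_le_iff hp.out).2 (Bd_sum_dd_nu hp.out hN)
  have h3 := PV_iff.1 ((Bd_nrm hp.out y).2 N) r k hk
  rw [hy, blk_sum_smul_dd_nu b hN, ← hy] at h3
  have h4 : ∀ n, n ≤ r → k n ≤ K := fun n hn => hk.monotone hn
  simp only at h3
  have h8 : ∑ n ∈ Finset.range r, |(if k (n + 1) ≤ K then b (k (n + 1)) else 0) -
      (if k n ≤ K then b (k n) else 0)| ^ p =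
        ∑ n ∈ Finset.range r, |b (k (n + 1)) - b (k n)| ^ p :=
    Finset.sum_congr rfl fun n hn => by
      rw [if_pos (h4 _ (by have := Finset.mem_range.1 hn; omega)),
        if_pos (h4 _ (by have := Finset.mem_range.1 hn; omega))]
  rw [h8, ← norm_emb] at h3
  rw [hxy]
  have h5 := T.le_opNorm (emb p x)
  have h6 := mul_le_mul_of_nonneg_left h2 (norm_nonneg T)
  have h7 := norm_sub_norm_le (emb p y) (T (emb p x))
  rw [norm_sub_rev] at h7
  linarith

theorem vpNorm_symbol_le (T : Y p →L[ℝ] Y p) : vpNorm p (symbol p T) ≤ 16 * ‖T‖ :=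
  (vpNorm_le hp.out (fun k => (diag_symbol T k).abs_le) (PV_symbol T)).trans_eq (by ring)

theorem diag_indOp_cmul {b : ℕ → ℝ} {M : ℕ} {C : ℝ}
    (h : ∀ x, nrm p (cmul p b M x) ≤ C * nrm p x) (k : ℕ) : Diag (indOp (p := p) (cmul p b M)) k (b k) := by
  refine tendsto_const_nhds.congr' ?_
  filter_upwards [eventually_ge_atTop (max k M)] with N hN
  have hν := nu_ge N k
  rw [indOp_emb h, ← map_smul, ← map_sub]
  rcases cmul_dd (p := p) b M (nu N k) with h0 | ⟨k', _, h2, h3⟩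
  · have := DFunLike.congr_fun h0 (nu N k)
    rw [cmul_apply (by omega) (nu_spec p (by omega)).2.2, dd_apply, if_pos rfl, mul_one,
      Finsupp.zero_apply] at this
    rw [h0, this, zero_smul, sub_zero, map_zero]
  · rw [(nu_spec p (by omega)).2.2] at h2
    rw [h3, show k' = k by exact_mod_cast h2.symm, sub_self, map_zero]

theorem exists_symbol_approx {b : ℕ → ℝ} {s : ℝ} (hs : 0 < s) (hB : ∀ k, |b k| ≤ s) (hv : PV p b s) :
    ∃ T : Y p →L[ℝ] Y p, ‖T‖ ≤ 12 * s ∧ (∀ k, |(b - symbol p T) k| ≤ s / 2) ∧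
      PV p (b - symbol p T) (s / 2) := by
  obtain ⟨l, K, hl, h1, h2⟩ := exists_PV_tail hp.out hB hv (half_pos hs)
  set d : ℕ → ℝ := fun n => if n < K then 0 else b n - l with hd
  set a : ℕ → ℝ := fun n => if n < K then b n - l else 0 with ha
  have had : a = b + ((-l) • (fun _ => 1) + (-1 : ℝ) • d) := by
    funext n
    simp only [ha, hd, Pi.add_apply, Pi.smul_apply, smul_eq_mul]
    split_ifs <;> ring
  have hconst : PV p (fun _ => (1 : ℝ)) 0 := PV_iff.2 fun r k _ => by
    simp [Real.zero_rpow (show p ≠ 0 by linarith [hp.out]),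
      Real.zero_rpow (inv_ne_zero (show p ≠ 0 by linarith [hp.out]))]
  have haPV : PV p a (s + s / 2) := by
    have := hv.add hp.out ((hconst.smul hp.out (-l)).add hp.out (h2.smul hp.out (-1)))
    rw [← had, mul_zero, zero_add, abs_neg, abs_one, one_mul] at this
    exact this
  have haB : ∀ k, |a k| ≤ 2 * s := fun k => by
    simp only [ha]
    split_ifs
    · have := abs_sub (b k) l
      linarith [hB k]
    · rw [abs_zero]; linarith
  have hn := nrm_cmul_le hp.out haB haPV (M := K) fun k hk => if_neg (by omega)
  set R := indOp (p := p) (cmul p a K) with hR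
  have hRn : ‖R‖ ≤ 3 * (2 * s + (s + s / 2)) := norm_indOp_le (by positivity) hn
  have hT : ∀ k, (b - symbol p (l • 1 + R)) k = d k := fun k => by
    rw [Pi.sub_apply, symbol_eq (((Diag.one k).smul l).add (diag_indOp_cmul hn k))]
    simp only [ha, hd]
    split_ifs <;> ring
  refine ⟨l • 1 + R, ?_, fun k => ?_, ?_⟩
  · refine (norm_add_le _ _).trans ?_
    have : ‖l • (1 : Y p →L[ℝ] Y p)‖ ≤ s * 1 := by
      rw [norm_smul]
      exact mul_le_mul hl ContinuousLinearMap.norm_id_le (norm_nonneg _) hs.le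
    linarith
  · rw [hT]
    simp only [hd]
    split_ifs with h
    · rw [abs_zero]; positivity
    · exact h1 k (by omega)
  · rw [show b - symbol p (l • 1 + R) = d from funext hT]
    exact h2

theorem exists_symbol_eq {b : ℕ → ℝ} {s : ℝ} (hs : 0 < s) (hB : ∀ k, |b k| ≤ s) (hv : PV p b s) :
    ∃ T : Y p →L[ℝ] Y p, ‖T‖ ≤ 24 * s ∧ symbol p T = b := by
  have step : ∀ (b : ℕ → ℝ) (s : ℝ), ∃ T : Y p →L[ℝ] Y p, 0 < s → (∀ k, |b k| ≤ s) → PV p b s →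
      ‖T‖ ≤ 12 * s ∧ (∀ k, |(b - symbol p T) k| ≤ s / 2) ∧ PV p (b - symbol p T) (s / 2) := by
    intro b s
    by_cases h : 0 < s ∧ (∀ k, |b k| ≤ s) ∧ PV p b s
    · obtain ⟨T, hT⟩ := exists_symbol_approx h.1 h.2.1 h.2.2
      exact ⟨T, fun _ _ _ => hT⟩
    · exact ⟨0, fun h1 h2 h3 => absurd ⟨h1, h2, h3⟩ h⟩
  choose F hF using step
  set β : ℕ → ℕ → ℝ := fun n => Nat.rec b (fun i c => c - symbol p (F c (s / 2 ^ i))) n with hβ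
  have hβs : ∀ i, β (i + 1) = β i - symbol p (F (β i) (s / 2 ^ i)) := fun i => rfl
  have hs2 : ∀ i : ℕ, 0 < s / 2 ^ i := fun i => by positivity
  have hQ : ∀ i, (∀ k, |β i k| ≤ s / 2 ^ i) ∧ PV p (β i) (s / 2 ^ i) := by
    intro i
    induction i with
    | zero => simpa [hβ] using ⟨hB, hv⟩
    | succ i ih =>
      have := (hF (β i) _ (hs2 i) ih.1 ih.2).2
      rw [hβs, pow_succ, ← div_div]
      exact this
  set T := fun i => F (β i) (s / 2 ^ i) with hT
  have hTn : ∀ i, ‖T i‖ ≤ 24 * s / 2 / 2 ^ i := fun i =>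
    ((hF (β i) _ (hs2 i) (hQ i).1 (hQ i).2).1).trans_eq (by ring)
  have hsum : Summable T := Summable.of_norm_bounded (summable_geometric_two' _) hTn
  refine ⟨∑' i, T i, tsum_of_norm_bounded (hasSum_geometric_two' _) hTn, ?_⟩
  funext k
  set φ := LinearMap.mkContinuous ((LinearMap.proj k).comp (symbol p).toLinearMap) 12
    fun T => (diag_symbol T k).abs_le with hφ
  have h1 := (hsum.hasSum.mapL φ).tendsto_sum_nat
  have h2 : ∀ n, ∑ i ∈ Finset.range n, φ (T i) = b k - β n k := fun n => by
    induction n with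
    | zero => simp [hβ]
    | succ n ih =>
      rw [Finset.sum_range_succ, ih, hβs, Pi.sub_apply]
      change b k - β n k + symbol p (T n) k = _
      ring
  have h3 : Tendsto (fun n => β n k) atTop (𝓝 0) := by
    refine squeeze_zero_norm (fun n => (hQ n).1 k) ?_
    have := (tendsto_pow_atTop_nhds_zero_of_lt_one (r := (1 / 2 : ℝ)) (by norm_num)
      (by norm_num)).const_mul s
    rw [mul_zero] at this
    exact this.congr fun n => by rw [one_div, inv_pow, div_eq_mul_inv]
  refine tendsto_nhds_unique h1 ?_
  simp only [h2]
  simpa using h3.const_sub (b k)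

theorem range_symbol : Set.range ⇑(symbol p) = boundedPVariation p := by
  ext b
  constructor
  · rintro ⟨T, rfl⟩
    exact ⟨_, PV_symbol T⟩
  · intro h
    obtain ⟨h1, h2⟩ := le_vpNorm hp.out h
    have h0 := h2.nonneg hp.out
    obtain ⟨T, -, hT⟩ := exists_symbol_eq (p := p) (s := vpNorm p b + 1) (by linarith)
      (fun k => (h1 k).trans (by linarith)) (h2.mono (by linarith))
    exact ⟨T, hT⟩

theorem infDist_le_vpNorm_symbol (T : Y p →L[ℝ] Y p) :
    Metric.infDist T {K : Y p →L[ℝ] Y p | IsCompactOperator ⇑K} ≤ 24 * vpNorm p (symbol p T) := by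
  obtain ⟨h1, h2⟩ := le_vpNorm hp.out ⟨_, PV_symbol T⟩
  have h0 := h2.nonneg hp.out
  refine le_of_forall_pos_le_add fun ε hε => ?_
  obtain ⟨T', hT', he⟩ := exists_symbol_eq (p := p) (s := vpNorm p (symbol p T) + ε / 24)
    (by positivity) (fun k => (h1 k).trans (by linarith)) (h2.mono (by linarith))
  have hmem : T - T' ∈ {K : Y p →L[ℝ] Y p | IsCompactOperator ⇑K} :=
    symbol_eq_zero_iff.1 (by rw [map_sub, he, sub_self])
  refine (Metric.infDist_le_dist_of_mem hmem).trans ?_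
  rw [dist_eq_norm, sub_sub_cancel]
  linarith

theorem vpNorm_symbol_le_infDist (T : Y p →L[ℝ] Y p) :
    vpNorm p (symbol p T) ≤ 16 * Metric.infDist T {K : Y p →L[ℝ] Y p | IsCompactOperator ⇑K} := by
  rw [← div_le_iff₀' (by norm_num)]
  refine (Metric.le_infDist ⟨0, isCompactOperator_zero⟩).2 fun {K} hK => ?_
  rw [div_le_iff₀' (by norm_num), dist_eq_norm]
  have := vpNorm_symbol_le (T - K)
  rwa [map_sub, symbol_eq_zero_iff.2 hK, sub_zero] at this

end range

end JamesCalkin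

/-- **Theorem.** For every `1 < p < ∞` the unitization `ℝe_ω ⊕ J_p` of the `p`-th James
space, realized as the algebra `𝒱_p` of real sequences of bounded `p`-variation with
pointwise multiplication, is isomorphic as a Banach algebra to the Calkin algebra of some
Banach space `𝒴`.  This is expressed via an algebra homomorphism `Φ : ℒ(𝒴) → (ℕ → ℝ)`
(pointwise operations) whose range is `𝒱_p`, sending the identity to the constant sequence
`1`, whose kernel is exactly the ideal of compact operators, and such that `‖Φ(T)‖_{𝒱_p}`
is equivalent to the Calkin norm `inf {‖T - K‖ : K compact}`. -/
theorem james_p_unitization_is_calkin_algebra (p : ℝ) (hp₁ : 1 < p) :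
    ∃ (Y : BanachSpacePkg)
      (Φ : (Y.carrier →L[ℝ] Y.carrier) →ₐ[ℝ] (ℕ → ℝ)),
      Φ 1 = (fun _ => 1) ∧
      Set.range ⇑Φ = boundedPVariation p ∧
      (∀ T : Y.carrier →L[ℝ] Y.carrier, Φ T = 0 ↔ IsCompactOperator ⇑T) ∧
      ∃ c C : ℝ, 0 < c ∧ 0 < C ∧
        ∀ T : Y.carrier →L[ℝ] Y.carrier,
          c * Metric.infDist T {K : Y.carrier →L[ℝ] Y.carrier | IsCompactOperator ⇑K} ≤
            vpNorm p (Φ T) ∧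
          vpNorm p (Φ T) ≤
            C * Metric.infDist T {K : Y.carrier →L[ℝ] Y.carrier | IsCompactOperator ⇑K} := by
  have : Fact (1 < p) := ⟨hp₁⟩
  refine ⟨⟨JamesCalkin.Y p⟩, JamesCalkin.symbol p, map_one _, JamesCalkin.range_symbol,
    fun T => JamesCalkin.symbol_eq_zero_iff, 24⁻¹, 16, by norm_num, by norm_num, fun T => ⟨?_,
      JamesCalkin.vpNorm_symbol_le_infDist T⟩⟩
  rw [inv_mul_le_iff₀ (by norm_num)]
  exact JamesCalkin.infDist_le_vpNorm_symbol T
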